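/- Let p₁, p₂ be two distinct points in ℝ² and let θ₁, θ₂ be positive integers. Let u solve the singular Liouville equation Δu + 2e^u = 4π(θ₁−1)δ_{p₁} + 4π(θ₂−1)δ_{p₂} in the classical sense (that is, u is C² on ℝ² ∖ {p₁, p₂}, Δu + 2e^u = 0 there, and for each i ∈ {1,2} the function x ↦ u(x) − 2(θᵢ−1)log|x−pᵢ| is bounded in a punctured neighborhood of pᵢ), and assume ∫_{ℝ²} e^u < ∞. Then there exists a positive integer θ₃ such that θ₁ + θ₂ + θ₃ is odd, θᵢ + θⱼ > θₖ for every permutation (i,j,k) of (1,2,3), and (1/(2π)) ∫_{ℝ²} e^u = θ₁ + θ₂ + θ₃ − 1. -/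

import Mathlib

noncomputable section
open Real MeasureTheory Metric Filter Topology

/-- The plane `ℝ²` with the Euclidean metric. -/
abbrev E2 := EuclideanSpace ℝ (Fin 2)

/-- The Euclidean Laplacian on `ℝ²`: `Δu = ∂²u/∂x₁² + ∂²u/∂x₂²`. -/
noncomputable def lap (u : E2 → ℝ) (x : E2) : ℝ :=
  ∑ i : Fin 2, fderiv ℝ (fun y => fderiv ℝ u y (EuclideanSpace.single i 1)) x
    (EuclideanSpace.single i 1)

open ComplexConjugate
open scoped Interval

open ComplexConjugate

/-- The real-linear map `v ↦ a v + b v̄` of `ℂ`. -/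
def wirtingerMap (a b : ℂ) : ℂ →L[ℝ] ℂ :=
  a • ContinuousLinearMap.id ℝ ℂ + b • (Complex.conjCLE : ℂ →L[ℝ] ℂ)

theorem wirtingerMap_apply (a b v : ℂ) : wirtingerMap a b v = a * v + b * conj v := by
  simp [wirtingerMap]

/-- `f` is real differentiable at `z` with Wirtinger derivatives `∂f = a` and `∂̄f = b`. -/
def HasWirtingerAt (f : ℂ → ℂ) (a b z : ℂ) : Prop :=
  HasFDerivAt f (wirtingerMap a b) z

namespace HasWirtingerAt

variable {f g : ℂ → ℂ} {a b a' b' z : ℂ}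

theorem congr_deriv (hf : HasWirtingerAt f a b z) (ha : a = a') (hb : b = b') :
    HasWirtingerAt f a' b' z := by
  subst ha hb; exact hf

theorem congr_of_eventuallyEq (hf : HasWirtingerAt f a b z) (h : g =ᶠ[𝓝 z] f) :
    HasWirtingerAt g a b z :=
  HasFDerivAt.congr_of_eventuallyEq hf h

theorem continuousAt (hf : HasWirtingerAt f a b z) : ContinuousAt f z :=
  HasFDerivAt.continuousAt hf

theorem of_hasFDerivAt {L : ℂ →L[ℝ] ℂ} (hf : HasFDerivAt f L z)
    (ha : a = (L 1 - Complex.I * L Complex.I) / 2) (hb : b = (L 1 + Complex.I * L Complex.I) / 2) :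
    HasWirtingerAt f a b z := by
  have : L = wirtingerMap a b := by
    ext v
    rw [wirtingerMap_apply]
    have hv : v = v.re • (1 : ℂ) + v.im • Complex.I := by
      simp
    have hc : conj v = v.re - v.im * Complex.I := by
      apply Complex.ext <;> simp
    have hv' : v = v.re + v.im * Complex.I := by simp
    conv_lhs => rw [hv, map_add, map_smul, map_smul]
    rw [hc, ha, hb]
    have hl : (L 1 - Complex.I * L Complex.I) / 2 * v =
        (L 1 - Complex.I * L Complex.I) / 2 * (v.re + v.im * Complex.I) := by rw [← hv']
    conv_rhs => rw [hl]
    simp only [Complex.real_smul]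
    linear_combination (v.im * L Complex.I) * Complex.I_sq
  rw [this] at hf
  exact hf

theorem unique (hf : HasWirtingerAt f a b z) (hg : HasWirtingerAt f a' b' z) :
    a = a' ∧ b = b' := by
  have h : wirtingerMap a b = wirtingerMap a' b' := HasFDerivAt.unique hf hg
  have h1 := congrArg (fun L : ℂ →L[ℝ] ℂ => L 1) h
  have h2 := congrArg (fun L : ℂ →L[ℝ] ℂ => L Complex.I) h
  simp only [wirtingerMap_apply, map_one, Complex.conj_I, mul_one] at h1 h2
  have h3 : a - b = a' - b' := by
    apply mul_right_cancel₀ Complex.I_ne_zero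
    linear_combination h2
  constructor
  · linear_combination (h1 + h3) / 2
  · linear_combination (h1 - h3) / 2

theorem const (c : ℂ) : HasWirtingerAt (fun _ => c) 0 0 z := by
  have := hasFDerivAt_const (𝕜 := ℝ) c z
  refine of_hasFDerivAt this ?_ ?_ <;> simp

theorem add (hf : HasWirtingerAt f a b z) (hg : HasWirtingerAt g a' b' z) :
    HasWirtingerAt (fun x => f x + g x) (a + a') (b + b') z := by
  refine of_hasFDerivAt (HasFDerivAt.add hf hg) ?_ ?_ <;>
  · simp only [add_apply, wirtingerMap_apply, map_one, Complex.conj_I]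
    ring_nf
    simp only [Complex.I_sq]
    ring

theorem neg (hf : HasWirtingerAt f a b z) : HasWirtingerAt (fun x => - f x) (-a) (-b) z := by
  refine of_hasFDerivAt (HasFDerivAt.neg hf) ?_ ?_ <;>
  · simp only [neg_apply, wirtingerMap_apply, map_one, Complex.conj_I]
    ring_nf
    simp only [Complex.I_sq]
    ring

theorem sub (hf : HasWirtingerAt f a b z) (hg : HasWirtingerAt g a' b' z) :
    HasWirtingerAt (fun x => f x - g x) (a - a') (b - b') z := by
  simpa [sub_eq_add_neg] using hf.add hg.neg

theorem mul (hf : HasWirtingerAt f a b z) (hg : HasWirtingerAt g a' b' z) :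
    HasWirtingerAt (fun x => f x * g x) (a * g z + f z * a') (b * g z + f z * b') z := by
  refine of_hasFDerivAt (HasFDerivAt.mul hf hg) ?_ ?_ <;>
  · simp only [add_apply, smul_apply, smul_eq_mul,
      wirtingerMap_apply, map_one, Complex.conj_I]
    ring_nf
    simp only [Complex.I_sq]
    ring

theorem conjugate (hf : HasWirtingerAt f a b z) :
    HasWirtingerAt (fun x => conj (f x)) (conj b) (conj a) z := by
  have h : HasFDerivAt (fun x => (Complex.conjCLE : ℂ →L[ℝ] ℂ) (f x))
      ((Complex.conjCLE : ℂ →L[ℝ] ℂ).comp (wirtingerMap a b)) z :=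
    (Complex.conjCLE : ℂ →L[ℝ] ℂ).hasFDerivAt.comp z hf
  have h' : HasFDerivAt (fun x => (starRingEnd ℂ) (f x))
      ((Complex.conjCLE : ℂ →L[ℝ] ℂ).comp (wirtingerMap a b)) z := h
  refine of_hasFDerivAt h' ?_ ?_ <;>
  · simp [wirtingerMap_apply]
    ring_nf
    simp only [Complex.I_sq]
    ring

theorem of_hasDerivAt (hf : HasDerivAt f a z) : HasWirtingerAt f a 0 z := by
  refine of_hasFDerivAt (hf.hasFDerivAt.restrictScalars ℝ) ?_ ?_ <;>
  · simp
    ring_nf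
    simp only [Complex.I_sq]
    ring

/-- Composition with a holomorphic map on the inside. -/
theorem comp_hasDerivAt {φ : ℂ → ℂ} {φ' : ℂ} (hf : HasWirtingerAt f a b (φ z))
    (hφ : HasDerivAt φ φ' z) :
    HasWirtingerAt (fun x => f (φ x)) (a * φ') (b * (starRingEnd ℂ) φ') z := by
  have h : HasFDerivAt (fun x => f (φ x)) ((wirtingerMap a b).comp _) z :=
    HasFDerivAt.comp z hf (hφ.hasFDerivAt.restrictScalars ℝ)
  refine of_hasFDerivAt h ?_ ?_ <;>
  · simp [wirtingerMap_apply]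
    ring_nf
    simp only [Complex.I_sq]
    ring

/-- Composition with a holomorphic map on the outside. -/
theorem hasDerivAt_comp {φ : ℂ → ℂ} {φ' : ℂ} (hφ : HasDerivAt φ φ' (f z))
    (hf : HasWirtingerAt f a b z) : HasWirtingerAt (fun x => φ (f x)) (φ' * a) (φ' * b) z := by
  have h : HasFDerivAt (fun x => φ (f x)) _ z :=
    HasFDerivAt.comp z (hφ.hasFDerivAt.restrictScalars ℝ) hf
  refine of_hasFDerivAt h ?_ ?_ <;>
  · simp [wirtingerMap_apply]
    ring_nf
    simp only [Complex.I_sq]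
    ring

theorem inv (hf : HasWirtingerAt f a b z) (h0 : f z ≠ 0) :
    HasWirtingerAt (fun x => (f x)⁻¹) (-a / f z ^ 2) (-b / f z ^ 2) z :=
  (hasDerivAt_comp (hasDerivAt_inv h0) hf).congr_deriv (by ring) (by ring)

theorem div (hf : HasWirtingerAt f a b z) (hg : HasWirtingerAt g a' b' z) (h0 : g z ≠ 0) :
    HasWirtingerAt (fun x => f x / g x) ((a * g z - f z * a') / g z ^ 2)
      ((b * g z - f z * b') / g z ^ 2) z := by
  have := hf.mul (hg.inv h0)
  simp only [div_eq_mul_inv]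
  refine this.congr_deriv ?_ ?_ <;> field_simp <;> ring

/-- Derivative along a real curve. -/
theorem comp_curve {γ : ℝ → ℂ} {v : ℂ} {t : ℝ} (hf : HasWirtingerAt f a b (γ t))
    (hγ : HasDerivAt γ v t) :
    HasDerivAt (fun s => f (γ s)) (a * v + b * (starRingEnd ℂ) v) t := by
  have h := HasFDerivAt.comp_hasDerivAt t hf hγ
  rwa [wirtingerMap_apply] at h

end HasWirtingerAt

open scoped Interval

/-- Green's theorem on a rectangle. -/
theorem HasWirtingerAt.integral_boundary_rect {f a b : ℂ → ℂ} {z w : ℂ}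
    (hf : ∀ x ∈ Complex.Rectangle z w, HasWirtingerAt f (a x) (b x) x)
    (hb : ContinuousOn b (Complex.Rectangle z w)) :
    (∫ x : ℝ in z.re..w.re, f (x + z.im * Complex.I)) -
        (∫ x : ℝ in z.re..w.re, f (x + w.im * Complex.I)) +
        Complex.I • (∫ y : ℝ in z.im..w.im, f (w.re + y * Complex.I)) -
        Complex.I • (∫ y : ℝ in z.im..w.im, f (z.re + y * Complex.I)) =
      ∫ x : ℝ in z.re..w.re, ∫ y : ℝ in z.im..w.im, 2 * Complex.I * b (x + y * Complex.I) := by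
  have key : ∀ x, Complex.I • wirtingerMap (a x) (b x) 1 - wirtingerMap (a x) (b x) Complex.I =
      2 * Complex.I * b x := by
    intro x
    simp only [wirtingerMap_apply, map_one, Complex.conj_I, smul_eq_mul]
    ring
  rw [Complex.integral_boundary_rect_of_continuousOn_of_hasFDerivAt_real f
    (fun x => wirtingerMap (a x) (b x)) z w
    (fun x hx => (hf x hx).continuousAt.continuousWithinAt) ?_ ?_]
  · simp only [key]
  · intro x hx
    refine hf x ⟨Set.Ioo_subset_Icc_self hx.1, Set.Ioo_subset_Icc_self hx.2⟩
  · simp only [key]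
    refine (continuousOn_const.mul hb).integrableOn_compact ?_
    exact (isCompact_uIcc.reProdIm isCompact_uIcc)

theorem mem_rectangle_of_horizontal {z w : ℂ} {x y : ℝ} (hx : x ∈ [[z.re, w.re]])
    (hy : y ∈ [[z.im, w.im]]) : (x + y * Complex.I : ℂ) ∈ Complex.Rectangle z w :=
  ⟨by simpa using hx, by simpa using hy⟩

theorem hasDerivAt_horizontal (x y : ℝ) :
    HasDerivAt (fun s : ℝ => (s + y * Complex.I : ℂ)) 1 x := by
  simpa using (Complex.ofRealCLM.hasDerivAt (x := x)).add_const (y * Complex.I : ℂ)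

theorem hasDerivAt_vertical (x y : ℝ) :
    HasDerivAt (fun s : ℝ => (x + s * Complex.I : ℂ)) Complex.I y := by
  simpa using ((Complex.ofRealCLM.hasDerivAt (x := y)).mul_const Complex.I).const_add (x : ℂ)

/-- A Morera criterion: if `∂̄X = ∂g` and `∂̄α = g` with `g` real, then `X - ∂α` is holomorphic. -/
theorem differentiableOn_sub_of_wirtinger {Ω : Set ℂ} (hΩ : IsOpen Ω)
    {α p g X x y : ℂ → ℂ}
    (hα : ∀ z ∈ Ω, HasWirtingerAt α (p z) (g z) z)
    (hX : ∀ z ∈ Ω, HasWirtingerAt X (x z) (y z) z)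
    (hg : ∀ z ∈ Ω, HasWirtingerAt g (y z) (conj (y z)) z)
    (hreal : ∀ z ∈ Ω, conj (g z) = g z)
    (hp : ContinuousOn p Ω) (hy : ContinuousOn y Ω) :
    DifferentiableOn ℂ (fun z => X z - p z) Ω := by
  have hgc : ContinuousOn g Ω := fun z hz => (hg z hz).continuousAt.continuousWithinAt
  have hXc : ContinuousOn X Ω := fun z hz => (hX z hz).continuousAt.continuousWithinAt
  intro z0 hz0
  obtain ⟨r, hr, hball⟩ := Metric.isOpen_iff.1 hΩ z0 hz0
  suffices h : DifferentiableOn ℂ (fun z => X z - p z) (ball z0 r) from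
    (h.differentiableAt (ball_mem_nhds z0 hr)).differentiableWithinAt
  apply Complex.IsExactOn.differentiableOn isOpen_ball
  apply Complex.IsConservativeOn.isExactOn_ball ((hXc.sub hp).mono hball)
  intro z w hR
  have hRΩ : Complex.Rectangle z w ⊆ Ω := hR.trans hball
  rw [← add_eq_zero_iff_eq_neg, Complex.wedgeIntegral_add_wedgeIntegral_eq]
  have GX := HasWirtingerAt.integral_boundary_rect (fun t ht => hX t (hRΩ ht)) (hy.mono hRΩ)
  have Gg := HasWirtingerAt.integral_boundary_rect (fun t ht => hg t (hRΩ ht))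
    ((Complex.continuous_conj.comp_continuousOn hy).mono hRΩ)
  have ch : ∀ {F : ℂ → ℂ}, ContinuousOn F Ω → ∀ {c : ℝ}, c ∈ [[z.im, w.im]] →
      IntervalIntegrable (fun s : ℝ => F (s + c * Complex.I)) volume z.re w.re := by
    intro F hF c hc
    apply ContinuousOn.intervalIntegrable
    refine hF.comp (by fun_prop) ?_
    intro s hs
    exact hRΩ (mem_rectangle_of_horizontal hs hc)
  have cv : ∀ {F : ℂ → ℂ}, ContinuousOn F Ω → ∀ {c : ℝ}, c ∈ [[z.re, w.re]] →
      IntervalIntegrable (fun s : ℝ => F (c + s * Complex.I)) volume z.im w.im := by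
    intro F hF c hc
    apply ContinuousOn.intervalIntegrable
    refine hF.comp (by fun_prop) ?_
    intro s hs
    exact hRΩ (mem_rectangle_of_horizontal hc hs)
  have horiz : ∀ {c : ℝ}, c ∈ [[z.im, w.im]] →
      (∫ s : ℝ in z.re..w.re, p (s + c * Complex.I)) +
        (∫ s : ℝ in z.re..w.re, g (s + c * Complex.I)) =
      α (w.re + c * Complex.I) - α (z.re + c * Complex.I) := by
    intro c hc
    rw [← intervalIntegral.integral_add (ch hp hc) (ch hgc hc)]
    refine intervalIntegral.integral_eq_sub_of_hasDerivAt (f := fun s : ℝ => α (s + c * Complex.I))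
      ?_ ((ch hp hc).add (ch hgc hc))
    intro s hs
    simpa using HasWirtingerAt.comp_curve (γ := fun s : ℝ => (s + c * Complex.I : ℂ))
      (hα _ (hRΩ (mem_rectangle_of_horizontal hs hc))) (hasDerivAt_horizontal s c)
  have vert : ∀ {c : ℝ}, c ∈ [[z.re, w.re]] →
      Complex.I * (∫ s : ℝ in z.im..w.im, p (c + s * Complex.I)) -
        Complex.I * (∫ s : ℝ in z.im..w.im, g (c + s * Complex.I)) =
      α (c + w.im * Complex.I) - α (c + z.im * Complex.I) := by
    intro c hc
    rw [← mul_sub, ← intervalIntegral.integral_sub (cv hp hc) (cv hgc hc),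
      ← intervalIntegral.integral_const_mul]
    refine intervalIntegral.integral_eq_sub_of_hasDerivAt (f := fun s : ℝ => α (c + s * Complex.I))
      ?_ (((cv hp hc).sub (cv hgc hc)).const_mul _)
    intro s hs
    have := HasWirtingerAt.comp_curve (γ := fun s : ℝ => (c + s * Complex.I : ℂ))
      (hα _ (hRΩ (mem_rectangle_of_horizontal hc hs))) (hasDerivAt_vertical c s)
    refine this.congr_deriv ?_
    simp only [Complex.conj_I]
    ring
  have conjh : ∀ {c : ℝ}, c ∈ [[z.im, w.im]] →
      conj (∫ s : ℝ in z.re..w.re, g (s + c * Complex.I)) =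
        ∫ s : ℝ in z.re..w.re, g (s + c * Complex.I) := by
    intro c hc
    rw [← intervalIntegral.intervalIntegral_conj]
    exact intervalIntegral.integral_congr fun s hs =>
      hreal _ (hRΩ (mem_rectangle_of_horizontal hs hc))
  have conjv : ∀ {c : ℝ}, c ∈ [[z.re, w.re]] →
      conj (∫ s : ℝ in z.im..w.im, g (c + s * Complex.I)) =
        ∫ s : ℝ in z.im..w.im, g (c + s * Complex.I) := by
    intro c hc
    rw [← intervalIntegral.intervalIntegral_conj]
    exact intervalIntegral.integral_congr fun s hs =>
      hreal _ (hRΩ (mem_rectangle_of_horizontal hc hs))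
  have Gg' := congrArg conj Gg
  simp only [smul_eq_mul, map_sub, map_add, map_mul, Complex.conj_I,
    conjh Set.left_mem_uIcc, conjh Set.right_mem_uIcc, conjv Set.left_mem_uIcc,
    conjv Set.right_mem_uIcc, ← intervalIntegral.intervalIntegral_conj,
    Complex.conj_conj, Complex.conj_ofNat] at Gg'
  have hneg : (∫ x : ℝ in z.re..w.re, ∫ s : ℝ in z.im..w.im,
      2 * -Complex.I * y (x + s * Complex.I)) = - ∫ x : ℝ in z.re..w.re, ∫ s : ℝ in z.im..w.im,
      2 * Complex.I * y (x + s * Complex.I) := by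
    simp only [mul_neg, neg_mul, intervalIntegral.integral_neg]
  rw [hneg] at Gg'
  simp only [Pi.sub_apply]
  rw [intervalIntegral.integral_sub (ch hXc Set.left_mem_uIcc) (ch hp Set.left_mem_uIcc),
    intervalIntegral.integral_sub (ch hXc Set.right_mem_uIcc) (ch hp Set.right_mem_uIcc),
    intervalIntegral.integral_sub (cv hXc Set.left_mem_uIcc) (cv hp Set.left_mem_uIcc),
    intervalIntegral.integral_sub (cv hXc Set.right_mem_uIcc) (cv hp Set.right_mem_uIcc)]
  simp only [smul_eq_mul] at GX ⊢
  have h1 := horiz (c := z.im) Set.left_mem_uIcc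
  have h2 := horiz (c := w.im) Set.right_mem_uIcc
  have h3 := vert (c := z.re) Set.left_mem_uIcc
  have h4 := vert (c := w.re) Set.right_mem_uIcc
  linear_combination GX + Gg' - h1 + h2 + h3 - h4

theorem StarConvex.ray_mem {Ω : Set ℂ} {c : ℂ} (hs : StarConvex ℝ c Ω) {z : ℂ} (hz : z ∈ Ω)
    {t : ℝ} (ht : t ∈ Set.Icc (0 : ℝ) 1) : c + t * (z - c) ∈ Ω := by
  have := hs.add_smul_sub_mem hz ht.1 ht.2
  simpa using this

section LinearODE

variable {E : Type*} [NormedAddCommGroup E] [NormedSpace ℂ E]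

/-- The primitive of `f` along the segments issued from `c`. -/
def radialPrimitive (f : ℂ → E) (c z : ℂ) : E :=
  ∫ t in (0 : ℝ)..1, (z - c) • f (c + t * (z - c))

theorem hasDerivAt_ray (c v : ℂ) (t : ℝ) :
    HasDerivAt (fun s : ℝ => c + s * v) v t := by
  simpa using ((Complex.ofRealCLM.hasDerivAt (x := t)).mul_const v).const_add c

theorem radialPrimitive_self (f : ℂ → E) (c : ℂ) : radialPrimitive f c c = 0 := by
  simp [radialPrimitive]

theorem norm_radialPrimitive_le {f : ℂ → E} {c z : ℂ} {M R : ℝ} {n : ℕ} 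
    (h : ∀ t ∈ Set.Icc (0 : ℝ) 1, ‖f (c + t * (z - c))‖ ≤ M * (t * R) ^ n) (hR : ‖z - c‖ ≤ R) :
    ‖radialPrimitive f c z‖ ≤ M * R ^ (n + 1) / (n + 1) := by
  have hR0 : 0 ≤ R := (norm_nonneg _).trans hR
  have : ‖radialPrimitive f c z‖ ≤ ∫ t in (0 : ℝ)..1, R * (M * (t * R) ^ n) := by
    apply intervalIntegral.norm_integral_le_of_norm_le zero_le_one
    · refine Eventually.of_forall fun t ht => ?_
      rw [norm_smul]
      have := h t (Set.Ioc_subset_Icc_self ht)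
      gcongr
    · apply Continuous.intervalIntegrable
      fun_prop
  refine this.trans (le_of_eq ?_)
  have h2 : ∀ t : ℝ, R * (M * (t * R) ^ n) = M * R ^ (n + 1) * t ^ n := by
    intro t; ring
  simp only [h2]
  rw [intervalIntegral.integral_const_mul, integral_pow]
  simp
  ring

variable [CompleteSpace E]

theorem hasDerivAt_radialPrimitive {f : ℂ → E} {Ω : Set ℂ} {c : ℂ} (hΩ : IsOpen Ω)
    (hs : StarConvex ℝ c Ω) (hf : DifferentiableOn ℂ f Ω) {z : ℂ} (hz : z ∈ Ω) :
    HasDerivAt (radialPrimitive f c) (f z) z := by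
  obtain ⟨δ, hδ, hball⟩ := Metric.nhds_basis_closedBall.mem_iff.1 (hΩ.mem_nhds hz)
  have hf' : ContinuousOn (deriv f) Ω := (hf.deriv hΩ).continuousOn
  have hfc : ContinuousOn f Ω := hf.continuousOn
  set G : ℂ → ℝ → E := fun w t => (w - c) • f (c + t * (w - c)) with hG
  set G' : ℂ → ℝ → E := fun w t => f (c + t * (w - c)) + (t * (w - c)) • deriv f (c + t * (w - c))
    with hG'
  have hmaps : Set.MapsTo (fun q : ℂ × ℝ => c + q.2 * (q.1 - c)) (Ω ×ˢ Set.Icc (0 : ℝ) 1) Ω :=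
    fun q hq => hs.ray_mem hq.1 hq.2
  have hcomp : ∀ {F : ℂ → E}, ContinuousOn F Ω →
      ContinuousOn (fun q : ℂ × ℝ => F (c + q.2 * (q.1 - c))) (Ω ×ˢ Set.Icc (0 : ℝ) 1) := by
    intro F hF
    exact hF.comp (by fun_prop) hmaps
  have hGc : ContinuousOn (fun q : ℂ × ℝ => G q.1 q.2) (Ω ×ˢ Set.Icc (0 : ℝ) 1) :=
    ContinuousOn.smul (by fun_prop) (hcomp hfc)
  have hG'c : ContinuousOn (fun q : ℂ × ℝ => G' q.1 q.2) (Ω ×ˢ Set.Icc (0 : ℝ) 1) :=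
    (hcomp hfc).add (ContinuousOn.smul (by fun_prop) (hcomp hf'))
  have hslice : ∀ {F : ℂ → ℝ → E}, ContinuousOn (fun q : ℂ × ℝ => F q.1 q.2)
      (Ω ×ˢ Set.Icc (0 : ℝ) 1) → ∀ w ∈ Ω, IntervalIntegrable (F w) volume 0 1 := by
    intro F hF w hw
    apply ContinuousOn.intervalIntegrable
    rw [Set.uIcc_of_le zero_le_one]
    exact hF.comp (f := fun t : ℝ => (w, t)) (by fun_prop) (fun t ht => ⟨hw, ht⟩)
  obtain ⟨K, hK⟩ := ((isCompact_closedBall z δ).prod (isCompact_Icc (a := (0 : ℝ)) (b := 1))).exists_bound_of_continuousOn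
    (hG'c.mono (Set.prod_mono hball le_rfl))
  have hΙ : Ι (0 : ℝ) 1 ⊆ Set.Icc 0 1 := by
    rw [Set.uIoc_of_le zero_le_one]; exact Set.Ioc_subset_Icc_self
  have hdiff : ∀ w ∈ Ω, ∀ t ∈ Set.Icc (0 : ℝ) 1, HasDerivAt f (deriv f (c + t * (w - c)))
      (c + t * (w - c)) := fun w hw t ht =>
    (hf.differentiableAt (hΩ.mem_nhds (hs.ray_mem hw ht))).hasDerivAt
  have key := (intervalIntegral.hasDerivAt_integral_of_dominated_loc_of_deriv_le
    (F := G) (F' := G') (x₀ := z) (bound := fun _ => K) (μ := volume)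
    (closedBall_mem_nhds z hδ)
    (by
      filter_upwards [hΩ.mem_nhds hz] with w hw
      exact (hslice hGc w hw).def'.aestronglyMeasurable)
    (hslice hGc z hz) (hslice hG'c z hz).def'.aestronglyMeasurable
    (Eventually.of_forall fun t ht w hw => hK (w, t) ⟨hw, hΙ ht⟩)
    intervalIntegrable_const
    (Eventually.of_forall fun t ht w hw => by
      have h1 : HasDerivAt (fun w : ℂ => c + t * (w - c)) (t : ℂ) w := by
        simpa using (((hasDerivAt_id w).sub_const c).const_mul (t : ℂ)).const_add c
      have h2 := (hdiff w (hball hw) t (hΙ ht)).scomp w h1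
      have h3 : HasDerivAt (fun w : ℂ => w - c) 1 w := (hasDerivAt_id w).sub_const c
      refine (h3.smul h2).congr_deriv ?_
      simp only [hG', one_smul, smul_smul]
      rw [add_comm, mul_comm (w - c)]
      rfl)).2
  refine key.congr_deriv ?_
  have hprim : ∀ t ∈ [[(0 : ℝ), 1]], HasDerivAt (fun s : ℝ => (s : ℂ) • f (c + s * (z - c)))
      (G' z t) t := by
    intro t ht
    rw [Set.uIcc_of_le zero_le_one] at ht
    have h2 := (hdiff z hz t ht).scomp t (hasDerivAt_ray c (z - c) t)
    have h3 : HasDerivAt (fun s : ℝ => (s : ℂ)) 1 t := by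
      exact Complex.ofRealCLM.hasDerivAt (x := t)
    refine (h3.smul h2).congr_deriv ?_
    simp only [hG', one_smul, smul_smul]
    rw [add_comm]
    rfl
  rw [intervalIntegral.integral_eq_sub_of_hasDerivAt hprim (hslice hG'c z hz)]
  simp

/-- Picard iterates of the linear system `y' = A y`, `y(c) = y₀`. -/
def picardIterate (A : ℂ → E →L[ℂ] E) (c : ℂ) (y₀ : E) : ℕ → ℂ → E
  | 0 => fun _ => y₀
  | n + 1 => radialPrimitive (fun w => A w (picardIterate A c y₀ n w)) c

/-- Holomorphic linear systems have holomorphic solutions on star-shaped domains. -/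
theorem exists_solution_linearODE {A : ℂ → E →L[ℂ] E} {Ω : Set ℂ} {c : ℂ} (hΩ : IsOpen Ω)
    (hs : StarConvex ℝ c Ω) (hA : DifferentiableOn ℂ A Ω) (y₀ : E) :
    ∃ y : ℂ → E, y c = y₀ ∧ ∀ z ∈ Ω, HasDerivAt y (A z (y z)) z := by
  set Y := picardIterate A c y₀ with hY
  have hd : ∀ n, DifferentiableOn ℂ (Y n) Ω ∧
      ∀ z ∈ Ω, HasDerivAt (Y (n + 1)) (A z (Y n z)) z := by
    have step : ∀ n, DifferentiableOn ℂ (Y n) Ω →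
        ∀ z ∈ Ω, HasDerivAt (Y (n + 1)) (A z (Y n z)) z := fun n hn z hz =>
      hasDerivAt_radialPrimitive hΩ hs (hA.clm_apply hn) hz
    intro n
    induction n with
    | zero => exact ⟨differentiableOn_const _, step 0 (differentiableOn_const _)⟩
    | succ n ih =>
      have h1 : DifferentiableOn ℂ (Y (n + 1)) Ω := fun z hz =>
        (ih.2 z hz).differentiableAt.differentiableWithinAt
      exact ⟨h1, step _ h1⟩
  have hYc : ∀ n, Y (n + 1) c = 0 := fun n => radialPrimitive_self _ _
  refine ⟨fun z => ∑' n, Y n z, ?_, ?_⟩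
  · change ∑' n, Y n c = y₀
    rw [tsum_eq_single 0]
    · rfl
    · intro n hn
      obtain ⟨m, rfl⟩ := Nat.exists_eq_succ_of_ne_zero hn
      exact hYc m
  · intro z hz
    obtain ⟨δ, hδ, hball⟩ := Metric.nhds_basis_closedBall.mem_iff.1 (hΩ.mem_nhds hz)
    have hAc : ContinuousOn (fun q : ℂ × ℝ => A (c + q.2 * (q.1 - c)))
        (closedBall z δ ×ˢ Set.Icc (0 : ℝ) 1) :=
      hA.continuousOn.comp (by fun_prop) (fun q hq => hs.ray_mem (hball hq.1) hq.2)
    obtain ⟨K, hK⟩ := ((isCompact_closedBall z δ).prod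
      (isCompact_Icc (a := (0 : ℝ)) (b := 1))).exists_bound_of_continuousOn hAc
    set R := ‖z - c‖ + δ with hR
    have hRpos : 0 < R := by positivity
    have hK0 : 0 ≤ K := (norm_nonneg _).trans (hK (z, 0) ⟨mem_closedBall_self hδ.le, by simp⟩)
    have hRle : ∀ w ∈ closedBall z δ, ‖w - c‖ ≤ R := by
      intro w hw
      have : ‖w - c‖ ≤ ‖z - c‖ + ‖w - z‖ := by
        rw [show w - c = (z - c) + (w - z) by ring]; exact norm_add_le _ _
      rw [mem_closedBall, dist_eq_norm] at hw
      linarith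
    have hb : ∀ n, ∀ w ∈ closedBall z δ, ∀ t ∈ Set.Icc (0 : ℝ) 1,
        ‖Y n (c + t * (w - c))‖ ≤ ‖y₀‖ * K ^ n / n.factorial * (t * R) ^ n := by
      intro n
      induction n with
      | zero => intro w _ t _; simp [hY, picardIterate]
      | succ n ih =>
        intro w hw t ht
        have := norm_radialPrimitive_le (f := fun w => A w (Y n w)) (c := c)
          (z := c + t * (w - c)) (M := ‖y₀‖ * K ^ (n + 1) / n.factorial) (R := t * R) (n := n)
          ?_ ?_
        · refine this.trans (le_of_eq ?_)
          rw [Nat.factorial_succ]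
          push_cast
          field_simp
        · intro s hs'
          have e : c + s * (c + t * (w - c) - c) = c + ((s * t : ℝ) : ℂ) * (w - c) := by
            push_cast; ring
          have hst : s * t ∈ Set.Icc (0 : ℝ) 1 :=
            ⟨mul_nonneg hs'.1 ht.1, mul_le_one₀ hs'.2 ht.1 ht.2⟩
          rw [e]
          refine (ContinuousLinearMap.le_opNorm _ _).trans ?_
          have h1 := hK (w, s * t) ⟨hw, hst⟩
          have h2 := ih w hw _ hst
          simp only at h1
          calc _ ≤ K * (‖y₀‖ * K ^ n / n.factorial * (s * t * R) ^ n) := by gcongr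
            _ = _ := by ring
        · rw [add_sub_cancel_left, norm_mul, Complex.norm_real, Real.norm_of_nonneg ht.1]
          exact mul_le_mul_of_nonneg_left (hRle w hw) ht.1
    have hle : ∀ n, ∀ w ∈ ball z δ, ‖Y n w‖ ≤ ‖y₀‖ * ((K * R) ^ n / n.factorial) := by
      intro n w hw
      have := hb n w (ball_subset_closedBall hw) 1 (by simp)
      simp only [Complex.ofReal_one, one_mul, add_sub_cancel] at this
      refine this.trans (le_of_eq ?_)
      rw [mul_pow]; ring
    have hsum : Summable fun n : ℕ => ‖y₀‖ * ((K * R) ^ n / n.factorial) :=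
      (Real.summable_pow_div_factorial (K * R)).mul_left _
    have hsub : ball z δ ⊆ Ω := ball_subset_closedBall.trans hball
    have hzb : z ∈ ball z δ := mem_ball_self hδ
    have hdo := Complex.differentiableOn_tsum_of_summable_norm hsum
      (fun n => (hd n).1.mono hsub) isOpen_ball hle
    have hsd := Complex.hasSum_deriv_of_summable_norm hsum
      (fun n => (hd n).1.mono hsub) isOpen_ball hle hzb
    have hda := (hdo.differentiableAt (isOpen_ball.mem_nhds hzb)).hasDerivAt
    refine hda.congr_deriv ?_
    have hYs : Summable fun n => Y n z := Summable.of_norm_bounded hsum fun n => hle n z hzb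
    have h4 : HasSum (fun n => A z (Y n z)) (A z (∑' n, Y n z)) := hYs.hasSum.mapL (A z)
    have h5 : HasSum (fun n => deriv (Y n) z) (A z (∑' n, Y n z)) := by
      rw [← hasSum_nat_add_iff' 1]
      have h0 : deriv (Y 0) z = 0 := by
        change deriv (fun _ : ℂ => y₀) z = 0
        simp
      simp only [Finset.range_one, Finset.sum_singleton, h0, sub_zero]
      convert h4 using 1
      funext n
      exact ((hd n).2 z hz).deriv
    exact hsd.unique h5

end LinearODE

/-- Second-order holomorphic linear equations on star-shaped domains. -/
theorem exists_solution_second_order {s r : ℂ → ℂ} {Ω : Set ℂ} {c : ℂ} (hΩ : IsOpen Ω)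
    (hs : StarConvex ℝ c Ω) (hsd : DifferentiableOn ℂ s Ω) (hrd : DifferentiableOn ℂ r Ω)
    (y₀ v₀ : ℂ) :
    ∃ y v : ℂ → ℂ, y c = y₀ ∧ v c = v₀ ∧ ∀ z ∈ Ω, HasDerivAt y (v z) z ∧
      HasDerivAt v (s z * v z - r z * y z) z := by
  obtain ⟨Y, hYc, hY⟩ := exists_solution_linearODE (E := ℂ × ℂ)
    (A := fun z => (ContinuousLinearMap.inl ℂ ℂ ℂ).comp (ContinuousLinearMap.snd ℂ ℂ ℂ) +
      (s z • (ContinuousLinearMap.inr ℂ ℂ ℂ).comp (ContinuousLinearMap.snd ℂ ℂ ℂ) -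
        r z • (ContinuousLinearMap.inr ℂ ℂ ℂ).comp (ContinuousLinearMap.fst ℂ ℂ ℂ)))
    hΩ hs (by fun_prop) (y₀, v₀)
  refine ⟨fun z => (Y z).1, fun z => (Y z).2, by simp [hYc], by simp [hYc], fun z hz => ?_⟩
  have h := hY z hz
  have h1 := h.hasFDerivAt.fst.hasDerivAt
  have h2 := h.hasFDerivAt.snd.hasDerivAt
  constructor
  · refine h1.congr_deriv ?_
    simp
  · refine h2.congr_deriv ?_
    simp

/-- `h > 0` satisfies `h ∂∂̄h - |∂h|² = |W|²` on `Ω`, where `W` is holomorphic without zeros. -/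
def IsLiouvillePair (Ω : Set ℂ) (h : ℂ → ℝ) (W : ℂ → ℂ) : Prop :=
  (∀ z ∈ Ω, 0 < h z) ∧ DifferentiableOn ℂ W Ω ∧ (∀ z ∈ Ω, W z ≠ 0) ∧
    ∃ a b e : ℂ → ℂ, ContinuousOn b Ω ∧ ∀ z ∈ Ω,
      HasWirtingerAt (fun x => (h x : ℂ)) (a z) (conj (a z)) z ∧ HasWirtingerAt a (b z) (e z) z ∧
        h z * e z - a z * conj (a z) = W z * conj (W z)

theorem IsLiouvillePair.mono {Ω Ω' : Set ℂ} {h : ℂ → ℝ} {W : ℂ → ℂ} (H : IsLiouvillePair Ω h W)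
    (hsub : Ω' ⊆ Ω) : IsLiouvillePair Ω' h W := by
  obtain ⟨hp, hW, hW0, a, b, e, hb, hd⟩ := H
  exact ⟨fun z hz => hp z (hsub hz), hW.mono hsub, fun z hz => hW0 z (hsub hz), a, b, e,
    hb.mono hsub, fun z hz => hd z (hsub hz)⟩

/-- Pullback of a solution by a locally injective holomorphic map. -/
theorem IsLiouvillePair.comp {Ω Ω' : Set ℂ} {h : ℂ → ℝ} {W φ φ' φ'' : ℂ → ℂ} (H : IsLiouvillePair Ω h W)
    (hmaps : Set.MapsTo φ Ω' Ω) (hφ : ∀ z ∈ Ω', HasDerivAt φ (φ' z) z)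
    (hφ' : ∀ z ∈ Ω', HasDerivAt φ' (φ'' z) z) (hφ'' : ContinuousOn φ'' Ω')
    (h0 : ∀ z ∈ Ω', φ' z ≠ 0) :
    IsLiouvillePair Ω' (fun z => h (φ z)) (fun z => W (φ z) * φ' z) := by
  obtain ⟨hp, hW, hW0, a, b, e, hb, hd⟩ := H
  have hφd : DifferentiableOn ℂ φ Ω' := fun z hz =>
    (hφ z hz).differentiableAt.differentiableWithinAt
  have hφ'd : DifferentiableOn ℂ φ' Ω' := fun z hz =>
    (hφ' z hz).differentiableAt.differentiableWithinAt
  have ha : ContinuousOn a Ω := fun z hz => (hd z hz).2.1.continuousAt.continuousWithinAt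
  refine ⟨fun z hz => hp _ (hmaps hz), (hW.comp hφd hmaps).mul hφ'd,
    fun z hz => mul_ne_zero (hW0 _ (hmaps hz)) (h0 z hz),
    fun z => a (φ z) * φ' z, fun z => b (φ z) * φ' z * φ' z + a (φ z) * φ'' z,
    fun z => e (φ z) * conj (φ' z) * φ' z, ?_, fun z hz => ?_⟩
  · exact (((hb.comp hφd.continuousOn hmaps).mul hφ'd.continuousOn).mul hφ'd.continuousOn).add
      ((ha.comp hφd.continuousOn hmaps).mul hφ'')
  · obtain ⟨h1, h2, h3⟩ := hd _ (hmaps hz)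
    refine ⟨(h1.comp_hasDerivAt (hφ z hz)).congr_deriv rfl (by simp), ?_, ?_⟩
    · exact ((h2.comp_hasDerivAt (hφ z hz)).mul (.of_hasDerivAt (hφ' z hz))).congr_deriv
        (by ring) (by ring)
    · simp only [map_mul]
      linear_combination (φ' z * conj (φ' z)) * h3

/-- A positive solution on a star-shaped domain is `|P|² + |Q|²` with `P`, `Q` holomorphic. -/
theorem IsLiouvillePair.exists_rep {Ω : Set ℂ} {h : ℂ → ℝ} {W : ℂ → ℂ} {c : ℂ}
    (H : IsLiouvillePair Ω h W) (hΩ : IsOpen Ω) (hs : StarConvex ℝ c Ω) (hc : c ∈ Ω) :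
    ∃ P Q : ℂ → ℂ, DifferentiableOn ℂ P Ω ∧ DifferentiableOn ℂ Q Ω ∧
      ∀ z ∈ Ω, (h z : ℂ) = P z * conj (P z) + Q z * conj (Q z) := by
  obtain ⟨hp, hW, hW0, a, b, e, hb, hd⟩ := H
  have hh0 : ∀ z ∈ Ω, (h z : ℂ) ≠ 0 := fun z hz => by exact_mod_cast (hp z hz).ne'
  have ha : ContinuousOn a Ω := fun z hz => (hd z hz).2.1.continuousAt.continuousWithinAt
  have hhc : ContinuousOn (fun z => (h z : ℂ)) Ω :=
    fun z hz => (hd z hz).1.continuousAt.continuousWithinAt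
  have hWc := hW.continuousOn
  have hW' : ∀ z ∈ Ω, HasDerivAt W (deriv W z) z := fun z hz =>
    (hW.differentiableAt (hΩ.mem_nhds hz)).hasDerivAt
  have hW'd : DifferentiableOn ℂ (deriv W) Ω := hW.deriv hΩ
  set s : ℂ → ℂ := fun z => deriv W z / W z with hs_def
  have hsd : DifferentiableOn ℂ s Ω := hW'd.div hW hW0
  have hs' : ∀ z ∈ Ω, HasWirtingerAt s (deriv s z) 0 z := fun z hz =>
    .of_hasDerivAt (hsd.differentiableAt (hΩ.mem_nhds hz)).hasDerivAt
  have hα : ∀ z ∈ Ω, HasWirtingerAt (fun x => a x / h x)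
      ((b z * h z - a z * a z) / (h z : ℂ) ^ 2) (W z * conj (W z) / (h z : ℂ) ^ 2) z := by
    intro z hz
    obtain ⟨h1, h2, h3⟩ := hd z hz
    exact (h2.div h1 (hh0 z hz)).congr_deriv rfl (by rw [← h3]; ring)
  have hg : ∀ z ∈ Ω, HasWirtingerAt (fun x => W x * conj (W x) / (h x : ℂ) ^ 2)
      ((s z - 2 * (a z / h z)) * (W z * conj (W z) / (h z : ℂ) ^ 2))
      (conj ((s z - 2 * (a z / h z)) * (W z * conj (W z) / (h z : ℂ) ^ 2))) z := by
    intro z hz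
    obtain ⟨h1, h2, h3⟩ := hd z hz
    have hw := HasWirtingerAt.of_hasDerivAt (hW' z hz)
    have := (hw.mul hw.conjugate).div (h1.mul h1) (mul_ne_zero (hh0 z hz) (hh0 z hz))
    have hh := hh0 z hz
    have hw0 := hW0 z hz
    have hw1 : conj (W z) ≠ 0 := by simpa using hw0
    simp only [pow_two]
    refine this.congr_deriv ?_ ?_
    · simp only [hs_def, map_zero]
      field_simp
      ring
    · simp only [hs_def, map_mul, map_sub, map_div₀, Complex.conj_conj,
        Complex.conj_ofReal, Complex.conj_ofNat]
      field_simp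
      ring
  have hX : ∀ z ∈ Ω, HasWirtingerAt (fun x => s x * (a x / h x) - (a x / h x) * (a x / h x))
      (deriv s z * (a z / h z) + (s z - 2 * (a z / h z)) *
        ((b z * h z - a z * a z) / (h z : ℂ) ^ 2))
      ((s z - 2 * (a z / h z)) * (W z * conj (W z) / (h z : ℂ) ^ 2)) z := by
    intro z hz
    exact (((hs' z hz).mul (hα z hz)).sub ((hα z hz).mul (hα z hz))).congr_deriv
      (by ring) (by ring)
  have hr := differentiableOn_sub_of_wirtinger hΩ hα hX hg
    (fun z hz => by simp [mul_comm])
    (by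
      refine ContinuousOn.div ((hb.mul hhc).sub (ha.mul ha)) (hhc.pow 2) ?_
      exact fun z hz => pow_ne_zero 2 (hh0 z hz))
    (by
      refine ContinuousOn.mul (hsd.continuousOn.sub (continuousOn_const.mul (ha.div hhc hh0)))
        (ContinuousOn.div (hWc.mul (Complex.continuous_conj.comp_continuousOn hWc)) (hhc.pow 2) ?_)
      exact fun z hz => pow_ne_zero 2 (hh0 z hz))
  set r : ℂ → ℂ := fun z => s z * (a z / h z) - (a z / h z) * (a z / h z) -
    (b z * h z - a z * a z) / (h z : ℂ) ^ 2 with hr_def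
  have hb_eq : ∀ z ∈ Ω, b z = s z * a z - r z * h z := by
    intro z hz
    have := hh0 z hz
    simp only [hr_def]
    field_simp
    ring
  clear_value r
  have he_real : ∀ z ∈ Ω, conj (e z) = e z := by
    intro z hz
    have h3 := (hd z hz).2.2
    have : e z = (W z * conj (W z) + a z * conj (a z)) / h z := by
      rw [eq_div_iff (hh0 z hz)]; linear_combination h3
    rw [this]
    simp [mul_comm]
  have he : ∀ z ∈ Ω, HasWirtingerAt e (s z * e z - r z * conj (a z))
      (conj (s z * e z - r z * conj (a z))) z := by
    intro z hz
    obtain ⟨h1, h2, h3⟩ := hd z hz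
    have hw := HasWirtingerAt.of_hasDerivAt (hW' z hz)
    have hh := hh0 z hz
    have hw0 := hW0 z hz
    have hw1 : conj (W z) ≠ 0 := by simpa using hw0
    have h5 := ((hw.mul hw.conjugate).add (h2.mul h2.conjugate)).div h1 hh
    have h6 : HasWirtingerAt e _ _ z := h5.congr_of_eventuallyEq (by
      filter_upwards [hΩ.mem_nhds hz] with x hx
      rw [eq_div_iff (hh0 x hx)]
      linear_combination (hd x hx).2.2)
    have hcj : conj (b z) = conj (s z) * conj (a z) - conj (r z) * h z := by
      rw [hb_eq z hz]; simp
    have hs0 : s z * W z = deriv W z := by simp only [hs_def]; field_simp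
    have hs1 : conj (s z) * conj (W z) = conj (deriv W z) := by rw [← map_mul, hs0]
    refine h6.congr_deriv ?_ ?_
    · rw [he_real z hz, hb_eq z hz, ← hs0, map_zero]
      field_simp
      linear_combination (- s z * h z + a z) * h3
    · rw [hcj, map_sub, map_mul, map_mul, he_real z hz, ← hs1, Complex.conj_conj]
      field_simp
      linear_combination (- conj (s z) * h z + conj (a z)) * h3
  set ρ : ℝ := √(h c) with hρ
  have hρ0 : 0 < ρ := Real.sqrt_pos.2 (hp c hc)
  have hρc : (ρ : ℂ) ≠ 0 := by exact_mod_cast hρ0.ne'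
  have hρ2 : (ρ : ℂ) * ρ = h c := by
    rw [← Complex.ofReal_mul, Real.mul_self_sqrt (hp c hc).le]
  obtain ⟨P, P', hP0, hP'0, hP⟩ := exists_solution_second_order hΩ hs hsd hr ρ (a c / ρ)
  obtain ⟨Q, Q', hQ0, hQ'0, hQ⟩ := exists_solution_second_order hΩ hs hsd hr 0 (W c / ρ)
  refine ⟨P, Q, fun z hz => (hP z hz).1.differentiableAt.differentiableWithinAt,
    fun z hz => (hQ z hz).1.differentiableAt.differentiableWithinAt, fun z hz => ?_⟩
  set k : ℂ → ℂ := fun z => h z - P z * conj (P z) - Q z * conj (Q z) with hk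
  set m : ℂ → ℂ := fun z => a z - P' z * conj (P z) - Q' z * conj (Q z) with hm
  set l : ℂ → ℂ := fun z => e z - P' z * conj (P' z) - Q' z * conj (Q' z) with hl
  have hkw : ∀ z ∈ Ω, HasWirtingerAt k (m z) (conj (m z)) z := by
    intro z hz
    have p1 := HasWirtingerAt.of_hasDerivAt (hP z hz).1
    have q1 := HasWirtingerAt.of_hasDerivAt (hQ z hz).1
    refine (((hd z hz).1.sub (p1.mul p1.conjugate)).sub (q1.mul q1.conjugate)).congr_deriv ?_ ?_
    · simp only [hm, map_zero]; ring
    · simp only [hm, map_sub, map_mul, Complex.conj_conj]; ring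
  have hmw : ∀ z ∈ Ω, HasWirtingerAt m (s z * m z - r z * k z) (l z) z := by
    intro z hz
    have p1 := HasWirtingerAt.of_hasDerivAt (hP z hz).1
    have q1 := HasWirtingerAt.of_hasDerivAt (hQ z hz).1
    have p2 := HasWirtingerAt.of_hasDerivAt (hP z hz).2
    have q2 := HasWirtingerAt.of_hasDerivAt (hQ z hz).2
    refine (((hd z hz).2.1.sub (p2.mul p1.conjugate)).sub (q2.mul q1.conjugate)).congr_deriv ?_ ?_
    · rw [hb_eq z hz]; simp only [hm, hk, map_zero]; ring
    · simp only [hl]; ring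
  have hlw : ∀ z ∈ Ω, HasWirtingerAt l (s z * l z - r z * conj (m z))
      (conj (s z * l z - r z * conj (m z))) z := by
    intro z hz
    have p2 := HasWirtingerAt.of_hasDerivAt (hP z hz).2
    have q2 := HasWirtingerAt.of_hasDerivAt (hQ z hz).2
    refine (((he z hz).sub (p2.mul p2.conjugate)).sub (q2.mul q2.conjugate)).congr_deriv ?_ ?_
    · simp only [hm, hl, map_zero, map_sub, map_mul, Complex.conj_conj]; ring
    · simp only [hm, hl, map_sub, map_mul, Complex.conj_conj]; ring
  have hray : ∀ t ∈ Set.Icc (0 : ℝ) 1, c + t * (z - c) ∈ Ω := fun t ht => hs.ray_mem hz ht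
  have hrayc : ContinuousOn (fun t : ℝ => c + t * (z - c)) (Set.Icc 0 1) := by fun_prop
  obtain ⟨S, hS⟩ := (isCompact_Icc (a := (0 : ℝ)) (b := 1)).exists_bound_of_continuousOn
    (hsd.continuousOn.comp hrayc hray)
  obtain ⟨R, hR⟩ := (isCompact_Icc (a := (0 : ℝ)) (b := 1)).exists_bound_of_continuousOn
    (hr.continuousOn.comp hrayc hray)
  have hS0 : 0 ≤ S := (norm_nonneg _).trans (hS 0 (by simp))
  have hR0 : 0 ≤ R := (norm_nonneg _).trans (hR 0 (by simp))
  set F : ℝ → ℂ × ℂ × ℂ := fun t =>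
    (k (c + t * (z - c)), m (c + t * (z - c)), l (c + t * (z - c))) with hF
  set F' : ℂ → ℂ × ℂ × ℂ := fun w =>
    (m w * (z - c) + conj (m w) * conj (z - c),
      (s w * m w - r w * k w) * (z - c) + l w * conj (z - c),
      (s w * l w - r w * conj (m w)) * (z - c) +
        conj (s w * l w - r w * conj (m w)) * conj (z - c)) with hF'
  have hFd : ∀ t ∈ Set.Icc (0 : ℝ) 1, HasDerivAt F (F' (c + t * (z - c))) t := fun t ht =>
    ((hkw _ (hray t ht)).comp_curve (γ := fun t : ℝ => c + t * (z - c))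
      (hasDerivAt_ray c (z - c) t)).prodMk
      (((hmw _ (hray t ht)).comp_curve (γ := fun t : ℝ => c + t * (z - c))
        (hasDerivAt_ray c (z - c) t)).prodMk
      ((hlw _ (hray t ht)).comp_curve (γ := fun t : ℝ => c + t * (z - c))
        (hasDerivAt_ray c (z - c) t)))
  have hzero := eq_zero_of_abs_deriv_le_mul_abs_self_of_eq_zero_right (f := F) (a := 0) (b := 1)
    (K := 2 * (1 + S + R) * ‖z - c‖)
    (fun t ht => (hFd t ht).continuousAt.continuousWithinAt)
    (fun t ht => (hFd t (Set.Ico_subset_Icc_self ht)).hasDerivWithinAt)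
    (by
      have h3 := (hd c hc).2.2
      simp only [hF, Complex.ofReal_zero, zero_mul, add_zero, Prod.mk_eq_zero]
      refine ⟨?_, ?_, ?_⟩
      · simp only [hk, hP0, hQ0, Complex.conj_ofReal, hρ2]; simp
      · simp only [hm, hP0, hQ0, hP'0, hQ'0, Complex.conj_ofReal]
        field_simp
        simp
      · simp only [hl, hP'0, hQ'0, Complex.conj_ofReal, map_div₀]
        field_simp
        rw [pow_two, hρ2]
        linear_combination h3)
    (by
      intro t ht
      have ht' := Set.Ico_subset_Icc_self ht
      have hs1 := hS t ht'
      have hr1 := hR t ht'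
      simp only [Function.comp] at hs1 hr1
      set w := c + t * (z - c) with hw
      have hk1 : ‖k w‖ ≤ ‖F t‖ := norm_fst_le (F t)
      have hm1 : ‖m w‖ ≤ ‖F t‖ := (norm_fst_le (F t).2).trans (norm_snd_le (F t))
      have hl1 : ‖l w‖ ≤ ‖F t‖ := (norm_snd_le (F t).2).trans (norm_snd_le (F t))
      have hF0 : 0 ≤ ‖F t‖ := norm_nonneg _
      have gen : ∀ x y : ℂ, ‖x‖ ≤ (1 + S + R) * ‖F t‖ → ‖y‖ ≤ (1 + S + R) * ‖F t‖ →
          ‖x * (z - c) + y * conj (z - c)‖ ≤ 2 * (1 + S + R) * ‖z - c‖ * ‖F t‖ := by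
        intro x y hx hy
        refine (norm_add_le _ _).trans ?_
        rw [norm_mul, norm_mul, RCLike.norm_conj]
        have h1 := mul_le_mul_of_nonneg_right hx (norm_nonneg (z - c))
        have h2 := mul_le_mul_of_nonneg_right hy (norm_nonneg (z - c))
        linarith
      have one : ∀ x : ℂ, ‖x‖ ≤ ‖F t‖ → ‖x‖ ≤ (1 + S + R) * ‖F t‖ := by
        intro x hx; nlinarith [mul_nonneg hS0 hF0, mul_nonneg hR0 hF0]
      have two : ∀ x y : ℂ, ‖x‖ ≤ ‖F t‖ → ‖y‖ ≤ ‖F t‖ →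
          ‖s w * x - r w * y‖ ≤ (1 + S + R) * ‖F t‖ := by
        intro x y hx hy
        refine (norm_sub_le _ _).trans ?_
        rw [norm_mul, norm_mul]
        have h1 := mul_le_mul hs1 hx (norm_nonneg _) hS0
        have h2 := mul_le_mul hr1 hy (norm_nonneg _) hR0
        linarith
      rw [Prod.norm_def, Prod.norm_def]
      refine max_le ?_ (max_le ?_ ?_)
      · exact gen _ _ (one _ hm1) (one _ (by rwa [RCLike.norm_conj]))
      · exact gen _ _ (two _ _ hm1 hk1) (one _ hl1)
      · have h2 := two (l w) (conj (m w)) hl1 (by rwa [RCLike.norm_conj])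
        exact gen _ _ h2 (by rwa [RCLike.norm_conj]))
  have h1 := hzero 1 (by simp)
  have h2 := congrArg Prod.fst h1
  simp only [hF, Complex.ofReal_one, one_mul, add_sub_cancel, Prod.fst_zero, hk] at h2
  linear_combination h2

/-- `h = |P|² + |Q|²` on `Ω` with `P`, `Q` holomorphic. -/
def IsRep (Ω : Set ℂ) (h : ℂ → ℝ) (P Q : ℂ → ℂ) : Prop :=
  DifferentiableOn ℂ P Ω ∧ DifferentiableOn ℂ Q Ω ∧
    ∀ z ∈ Ω, (h z : ℂ) = P z * conj (P z) + Q z * conj (Q z)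

/-- The Wronskian `P Q' - P' Q`. -/
def wronskian (P Q : ℂ → ℂ) (z : ℂ) : ℂ := P z * deriv Q z - deriv P z * Q z

theorem hasWirtingerAt_sum_mul_conj {P Q R S : ℂ → ℂ} {p q r s z : ℂ} (hP : HasDerivAt P p z)
    (hQ : HasDerivAt Q q z) (hR : HasDerivAt R r z) (hS : HasDerivAt S s z) :
    HasWirtingerAt (fun x => P x * conj (R x) + Q x * conj (S x))
      (p * conj (R z) + q * conj (S z)) (P z * conj r + Q z * conj s) z := by
  have p1 := HasWirtingerAt.of_hasDerivAt hP
  have q1 := HasWirtingerAt.of_hasDerivAt hQ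
  have r1 := HasWirtingerAt.of_hasDerivAt hR
  have s1 := HasWirtingerAt.of_hasDerivAt hS
  exact ((p1.mul r1.conjugate).add (q1.mul s1.conjugate)).congr_deriv (by simp) (by simp)

/-- Differentiating `|P₁|² + |Q₁|² = |P₂|² + |Q₂|²`. -/
theorem deriv_identities_of_norm_eq {U : Set ℂ} (hU : IsOpen U) {P₁ Q₁ P₂ Q₂ : ℂ → ℂ}
    (hP₁ : DifferentiableOn ℂ P₁ U) (hQ₁ : DifferentiableOn ℂ Q₁ U)
    (hP₂ : DifferentiableOn ℂ P₂ U) (hQ₂ : DifferentiableOn ℂ Q₂ U)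
    (heq : ∀ z ∈ U, P₁ z * conj (P₁ z) + Q₁ z * conj (Q₁ z) =
      P₂ z * conj (P₂ z) + Q₂ z * conj (Q₂ z)) {z : ℂ} (hz : z ∈ U) :
    deriv P₁ z * conj (P₁ z) + deriv Q₁ z * conj (Q₁ z) =
        deriv P₂ z * conj (P₂ z) + deriv Q₂ z * conj (Q₂ z) ∧
      deriv P₁ z * conj (deriv P₁ z) + deriv Q₁ z * conj (deriv Q₁ z) =
        deriv P₂ z * conj (deriv P₂ z) + deriv Q₂ z * conj (deriv Q₂ z) := by
  have d : ∀ {F : ℂ → ℂ}, DifferentiableOn ℂ F U → ∀ z ∈ U, HasDerivAt F (deriv F z) z :=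
    fun hF z hz => (hF.differentiableAt (hU.mem_nhds hz)).hasDerivAt
  have first : ∀ z ∈ U, deriv P₁ z * conj (P₁ z) + deriv Q₁ z * conj (Q₁ z) =
        deriv P₂ z * conj (P₂ z) + deriv Q₂ z * conj (Q₂ z) := by
    intro z hz
    have h1 := hasWirtingerAt_sum_mul_conj (d hP₁ z hz) (d hQ₁ z hz) (d hP₁ z hz) (d hQ₁ z hz)
    have h2 := hasWirtingerAt_sum_mul_conj (d hP₂ z hz) (d hQ₂ z hz) (d hP₂ z hz) (d hQ₂ z hz)
    refine (h1.unique (h2.congr_of_eventuallyEq ?_)).1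
    filter_upwards [hU.mem_nhds hz] with x hx using heq x hx
  refine ⟨first z hz, ?_⟩
  have h1 := hasWirtingerAt_sum_mul_conj (d (hP₁.deriv hU) z hz) (d (hQ₁.deriv hU) z hz)
    (d hP₁ z hz) (d hQ₁ z hz)
  have h2 := hasWirtingerAt_sum_mul_conj (d (hP₂.deriv hU) z hz) (d (hQ₂.deriv hU) z hz)
    (d hP₂ z hz) (d hQ₂ z hz)
  refine (h1.unique (h2.congr_of_eventuallyEq ?_)).2
  filter_upwards [hU.mem_nhds hz] with x hx using first x hx

theorem IsRep.wronskian_norm {Ω : Set ℂ} {h : ℂ → ℝ} {P Q W : ℂ → ℂ} (hΩ : IsOpen Ω)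
    (hR : IsRep Ω h P Q) (H : IsLiouvillePair Ω h W) {z : ℂ} (hz : z ∈ Ω) :
    wronskian P Q z * conj (wronskian P Q z) = W z * conj (W z) := by
  obtain ⟨hP, hQ, hPQ⟩ := hR
  obtain ⟨-, -, -, a, b, e, -, hd⟩ := H
  have d : ∀ {F : ℂ → ℂ}, DifferentiableOn ℂ F Ω → ∀ z ∈ Ω, HasDerivAt F (deriv F z) z :=
    fun hF z hz => (hF.differentiableAt (hΩ.mem_nhds hz)).hasDerivAt
  have first : ∀ z ∈ Ω, a z = deriv P z * conj (P z) + deriv Q z * conj (Q z) := by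
    intro z hz
    have h1 := hasWirtingerAt_sum_mul_conj (d hP z hz) (d hQ z hz) (d hP z hz) (d hQ z hz)
    refine ((hd z hz).1.unique (h1.congr_of_eventuallyEq ?_)).1
    filter_upwards [hΩ.mem_nhds hz] with x hx using hPQ x hx
  have h2 := hasWirtingerAt_sum_mul_conj (d (hP.deriv hΩ) z hz) (d (hQ.deriv hΩ) z hz)
    (d hP z hz) (d hQ z hz)
  have second : e z = _ := ((hd z hz).2.1.unique (h2.congr_of_eventuallyEq (by
    filter_upwards [hΩ.mem_nhds hz] with x hx using first x hx))).2
  rw [← (hd z hz).2.2, hPQ z hz, second, first z hz]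
  simp only [wronskian, map_sub, map_mul, map_add, Complex.conj_conj]
  ring

theorem IsRep.wronskian_ne_zero {Ω : Set ℂ} {h : ℂ → ℝ} {P Q W : ℂ → ℂ} (hΩ : IsOpen Ω)
    (hR : IsRep Ω h P Q) (H : IsLiouvillePair Ω h W) {z : ℂ} (hz : z ∈ Ω) :
    wronskian P Q z ≠ 0 := by
  intro h0
  have := hR.wronskian_norm hΩ H hz
  rw [h0, zero_mul, Complex.mul_conj] at this
  have h1 : Complex.normSq (W z) = 0 := by exact_mod_cast this.symm
  exact H.2.2.1 z hz (Complex.normSq_eq_zero.1 h1)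

theorem mul_conj_add_eq_zero {x y : ℂ} (h : x * conj x + y * conj y = 0) : x = 0 ∧ y = 0 := by
  rw [Complex.mul_conj, Complex.mul_conj] at h
  have h1 : Complex.normSq x + Complex.normSq y = 0 := by exact_mod_cast h
  have hx := Complex.normSq_nonneg x
  have hy := Complex.normSq_nonneg y
  exact ⟨Complex.normSq_eq_zero.1 (by linarith), Complex.normSq_eq_zero.1 (by linarith)⟩

theorem exists_const_of_norm_add_eq_one {U : Set ℂ} (hU : IsOpen U) (hUc : IsPreconnected U)
    {f g : ℂ → ℂ} (hf : DifferentiableOn ℂ f U) (hg : DifferentiableOn ℂ g U)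
    (h : ∀ z ∈ U, f z * conj (f z) + g z * conj (g z) = 1) :
    ∃ x y : ℂ, (∀ z ∈ U, f z = x) ∧ (∀ z ∈ U, g z = y) ∧ x * conj x + y * conj y = 1 := by
  have key : ∀ z ∈ U, deriv f z = 0 ∧ deriv g z = 0 := by
    intro z hz
    have := (deriv_identities_of_norm_eq hU hf hg (differentiableOn_const (1 : ℂ))
      (differentiableOn_const (0 : ℂ)) (fun z hz => by rw [h z hz]; simp) hz).2
    refine mul_conj_add_eq_zero (this.trans ?_)
    simp only [deriv_const, zero_mul, add_zero]
  rcases U.eq_empty_or_nonempty with rfl | ⟨z₀, hz₀⟩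
  · exact ⟨1, 0, by simp, by simp, by simp⟩
  · refine ⟨f z₀, g z₀, fun z hz => ?_, fun z hz => ?_, h z₀ hz₀⟩
    · exact hU.is_const_of_deriv_eq_zero hUc hf (fun z hz => (key z hz).1) hz hz₀
    · exact hU.is_const_of_deriv_eq_zero hUc hg (fun z hz => (key z hz).2) hz hz₀

/-- Two representations of the same function differ by a constant unitary matrix. -/
theorem IsRep.exists_unitary {U : Set ℂ} (hU : IsOpen U) (hUc : IsPreconnected U)
    {h : ℂ → ℝ} {P₁ Q₁ P₂ Q₂ : ℂ → ℂ} (H₁ : IsRep U h P₁ Q₁) (H₂ : IsRep U h P₂ Q₂)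
    (hW : ∀ z ∈ U, wronskian P₁ Q₁ z ≠ 0) :
    ∃ v₁₁ v₁₂ v₂₁ v₂₂ : ℂ,
      (∀ z ∈ U, P₂ z = P₁ z * v₁₁ + Q₁ z * v₂₁ ∧ Q₂ z = P₁ z * v₁₂ + Q₁ z * v₂₂) ∧
      v₁₁ * conj v₁₁ + v₁₂ * conj v₁₂ = 1 ∧ v₂₁ * conj v₂₁ + v₂₂ * conj v₂₂ = 1 ∧
      (U.Nonempty → v₁₁ * conj v₂₁ + v₁₂ * conj v₂₂ = 0) := by
  obtain ⟨hP₁, hQ₁, h₁⟩ := H₁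
  obtain ⟨hP₂, hQ₂, h₂⟩ := H₂
  have heq : ∀ z ∈ U, P₁ z * conj (P₁ z) + Q₁ z * conj (Q₁ z) =
      P₂ z * conj (P₂ z) + Q₂ z * conj (Q₂ z) := fun z hz => by rw [← h₁ z hz, h₂ z hz]
  have ids := fun z hz => deriv_identities_of_norm_eq hU hP₁ hQ₁ hP₂ hQ₂ heq (z := z) hz
  have dP₁ := hP₁.deriv hU
  have dQ₁ := hQ₁.deriv hU
  have dP₂ := hP₂.deriv hU
  have dQ₂ := hQ₂.deriv hU
  have hwd : DifferentiableOn ℂ (wronskian P₁ Q₁) U := (hP₁.mul dQ₁).sub (dP₁.mul hQ₁)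
  have hw0 : ∀ z ∈ U, P₁ z * deriv Q₁ z - deriv P₁ z * Q₁ z ≠ 0 := hW
  have hwc : ∀ z ∈ U, conj (P₁ z) * conj (deriv Q₁ z) - conj (deriv P₁ z) * conj (Q₁ z) ≠ 0 := by
    intro z hz
    have : conj (P₁ z * deriv Q₁ z - deriv P₁ z * Q₁ z) ≠ 0 := by
      rw [Ne, map_eq_zero]; exact hw0 z hz
    simpa only [map_sub, map_mul] using this
  obtain ⟨v₁₁, v₁₂, e₁₁, e₁₂, n₁⟩ := exists_const_of_norm_add_eq_one hU hUc
    (f := fun z => (deriv Q₁ z * P₂ z - Q₁ z * deriv P₂ z) / wronskian P₁ Q₁ z)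
    (g := fun z => (deriv Q₁ z * Q₂ z - Q₁ z * deriv Q₂ z) / wronskian P₁ Q₁ z)
    (((dQ₁.mul hP₂).sub (hQ₁.mul dP₂)).div hwd hW) (((dQ₁.mul hQ₂).sub (hQ₁.mul dQ₂)).div hwd hW)
    (by
      intro z hz
      have i0 := heq z hz
      obtain ⟨i1, i2⟩ := ids z hz
      have i3 := congrArg conj i1
      simp only [map_add, map_mul, Complex.conj_conj] at i3
      simp only [wronskian, map_div₀, map_sub, map_mul]
      rw [div_mul_div_comm, div_mul_div_comm, ← add_div, div_eq_one_iff_eq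
        (mul_ne_zero (hw0 z hz) (hwc z hz))]
      linear_combination (-deriv Q₁ z * conj (deriv Q₁ z)) * i0 + Q₁ z * conj (deriv Q₁ z) * i1
        + deriv Q₁ z * conj (Q₁ z) * i3 - Q₁ z * conj (Q₁ z) * i2)
  obtain ⟨v₂₁, v₂₂, e₂₁, e₂₂, n₂⟩ := exists_const_of_norm_add_eq_one hU hUc
    (f := fun z => (P₁ z * deriv P₂ z - deriv P₁ z * P₂ z) / wronskian P₁ Q₁ z)
    (g := fun z => (P₁ z * deriv Q₂ z - deriv P₁ z * Q₂ z) / wronskian P₁ Q₁ z)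
    (((hP₁.mul dP₂).sub (dP₁.mul hP₂)).div hwd hW) (((hP₁.mul dQ₂).sub (dP₁.mul hQ₂)).div hwd hW)
    (by
      intro z hz
      have i0 := heq z hz
      obtain ⟨i1, i2⟩ := ids z hz
      have i3 := congrArg conj i1
      simp only [map_add, map_mul, Complex.conj_conj] at i3
      simp only [wronskian, map_div₀, map_sub, map_mul]
      rw [div_mul_div_comm, div_mul_div_comm, ← add_div, div_eq_one_iff_eq
        (mul_ne_zero (hw0 z hz) (hwc z hz))]
      linear_combination (-deriv P₁ z * conj (deriv P₁ z)) * i0 + P₁ z * conj (deriv P₁ z) * i1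
        + deriv P₁ z * conj (P₁ z) * i3 - P₁ z * conj (P₁ z) * i2)
  refine ⟨v₁₁, v₁₂, v₂₁, v₂₂, fun z hz => ?_, n₁, n₂, ?_⟩
  · have := hw0 z hz
    rw [← e₁₁ z hz, ← e₁₂ z hz, ← e₂₁ z hz, ← e₂₂ z hz]
    simp only [wronskian]
    constructor <;> rw [mul_div_assoc', mul_div_assoc', ← add_div, eq_div_iff this] <;> ring
  · rintro ⟨z, hz⟩
    rw [← e₁₁ z hz, ← e₁₂ z hz, ← e₂₁ z hz, ← e₂₂ z hz]
    have i0 := heq z hz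
    obtain ⟨i1, i2⟩ := ids z hz
    have i3 := congrArg conj i1
    simp only [map_add, map_mul, Complex.conj_conj] at i3
    simp only [wronskian, map_div₀, map_sub, map_mul]
    rw [div_mul_div_comm, div_mul_div_comm, ← add_div, div_eq_zero_iff]
    left
    linear_combination (deriv Q₁ z * conj (deriv P₁ z)) * i0 - Q₁ z * conj (deriv P₁ z) * i1
        - deriv Q₁ z * conj (P₁ z) * i3 + Q₁ z * conj (P₁ z) * i2

/-- Representations glue along connected overlaps. -/
theorem IsRep.glue {Ω₁ Ω₂ : Set ℂ} (hΩ₁ : IsOpen Ω₁) (hΩ₂ : IsOpen Ω₂)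
    (hc : IsPreconnected (Ω₁ ∩ Ω₂)) (hne : (Ω₁ ∩ Ω₂).Nonempty) {h : ℂ → ℝ} {W P₁ Q₁ P₂ Q₂ : ℂ → ℂ}
    (H₁ : IsRep Ω₁ h P₁ Q₁) (H₂ : IsRep Ω₂ h P₂ Q₂) (H : IsLiouvillePair Ω₂ h W) :
    ∃ P Q : ℂ → ℂ, IsRep (Ω₁ ∪ Ω₂) h P Q := by
  classical
  have hU := hΩ₁.inter hΩ₂
  have R₁ : IsRep (Ω₁ ∩ Ω₂) h P₁ Q₁ := ⟨H₁.1.mono Set.inter_subset_left,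
    H₁.2.1.mono Set.inter_subset_left, fun z hz => H₁.2.2 z hz.1⟩
  have R₂ : IsRep (Ω₁ ∩ Ω₂) h P₂ Q₂ := ⟨H₂.1.mono Set.inter_subset_right,
    H₂.2.1.mono Set.inter_subset_right, fun z hz => H₂.2.2 z hz.2⟩
  obtain ⟨v₁₁, v₁₂, v₂₁, v₂₂, hv, n₁, n₂, n₃⟩ := R₂.exists_unitary hU hc R₁
    (fun z hz => H₂.wronskian_ne_zero hΩ₂ H hz.2)
  have n₃ := n₃ hne
  have n₄ := congrArg conj n₃
  simp only [map_add, map_mul, Complex.conj_conj, map_zero] at n₄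
  have glueD : ∀ {F G : ℂ → ℂ}, DifferentiableOn ℂ F Ω₁ → DifferentiableOn ℂ G Ω₂ →
      (∀ z ∈ Ω₁ ∩ Ω₂, F z = G z) →
      DifferentiableOn ℂ (fun z => if z ∈ Ω₁ then F z else G z) (Ω₁ ∪ Ω₂) := by
    intro F G hF hG hFG z hz
    apply DifferentiableAt.differentiableWithinAt
    rcases hz with hz | hz
    · refine (hF.differentiableAt (hΩ₁.mem_nhds hz)).congr_of_eventuallyEq ?_
      filter_upwards [hΩ₁.mem_nhds hz] with x hx
      simp [hx]
    · refine (hG.differentiableAt (hΩ₂.mem_nhds hz)).congr_of_eventuallyEq ?_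
      filter_upwards [hΩ₂.mem_nhds hz] with x hx
      by_cases hx1 : x ∈ Ω₁
      · simp [hx1, hFG x ⟨hx1, hx⟩]
      · simp [hx1]
  refine ⟨fun z => if z ∈ Ω₁ then P₁ z else P₂ z * v₁₁ + Q₂ z * v₂₁,
    fun z => if z ∈ Ω₁ then Q₁ z else P₂ z * v₁₂ + Q₂ z * v₂₂,
    glueD H₁.1 ((H₂.1.mul_const _).add (H₂.2.1.mul_const _)) (fun z hz => (hv z hz).1),
    glueD H₁.2.1 ((H₂.1.mul_const _).add (H₂.2.1.mul_const _)) (fun z hz => (hv z hz).2), ?_⟩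
  intro z hz
  by_cases hz1 : z ∈ Ω₁
  · simp only [hz1, if_true]
    exact H₁.2.2 z hz1
  · simp only [hz1, if_false]
    rw [H₂.2.2 z (hz.resolve_left hz1)]
    simp only [map_add, map_mul]
    linear_combination (-P₂ z * conj (P₂ z)) * n₁ - Q₂ z * conj (Q₂ z) * n₂
      - P₂ z * conj (Q₂ z) * n₃ - Q₂ z * conj (P₂ z) * n₄

theorem IsRep.norm_sq {Ω : Set ℂ} {h : ℂ → ℝ} {P Q : ℂ → ℂ} (hR : IsRep Ω h P Q) {z : ℂ}
    (hz : z ∈ Ω) : h z = ‖P z‖ ^ 2 + ‖Q z‖ ^ 2 := by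
  have := hR.2.2 z hz
  rw [Complex.mul_conj', Complex.mul_conj'] at this
  exact_mod_cast this

/-- The Wronskian of a representation is a constant multiple of `W`. -/
theorem IsRep.wronskian_eq {Ω : Set ℂ} {h : ℂ → ℝ} {P Q W : ℂ → ℂ} (hΩ : IsOpen Ω)
    (hc : IsPreconnected Ω) (hR : IsRep Ω h P Q) (H : IsLiouvillePair Ω h W) :
    ∃ κ : ℂ, κ ≠ 0 ∧ ∀ z ∈ Ω, wronskian P Q z = κ * W z := by
  have hW0 := H.2.2.1
  have hwd : DifferentiableOn ℂ (wronskian P Q) Ω :=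
    (hR.1.mul (hR.2.1.deriv hΩ)).sub ((hR.1.deriv hΩ).mul hR.2.1)
  obtain ⟨x, y, hx, hy, hxy⟩ := exists_const_of_norm_add_eq_one hΩ hc
    (f := fun z => wronskian P Q z / W z) (g := fun _ => 0) (hwd.div H.2.1 hW0)
    (differentiableOn_const 0) (by
      intro z hz
      have h1 := hW0 z hz
      have h2 : conj (W z) ≠ 0 := by rw [Ne, map_eq_zero]; exact h1
      rw [map_div₀, div_mul_div_comm, hR.wronskian_norm hΩ H hz, zero_mul, add_zero,
        div_self (mul_ne_zero h1 h2)])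
  rcases Ω.eq_empty_or_nonempty with rfl | ⟨z₀, hz₀⟩
  · exact ⟨1, one_ne_zero, by simp⟩
  · refine ⟨x, ?_, fun z hz => by rw [← hx z hz, div_mul_cancel₀ _ (hW0 z hz)]⟩
    rw [← hx z₀ hz₀]
    exact div_ne_zero (hR.wronskian_ne_zero hΩ H hz₀) (hW0 z₀ hz₀)

theorem eq_one_of_unit_rows_of_trace {v₁₁ v₁₂ v₂₁ v₂₂ : ℂ}
    (n₁ : v₁₁ * conj v₁₁ + v₁₂ * conj v₁₂ = 1) (n₂ : v₂₁ * conj v₂₁ + v₂₂ * conj v₂₂ = 1)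
    (htr : v₁₁ + v₂₂ = 2) : v₁₁ = 1 ∧ v₁₂ = 0 ∧ v₂₁ = 0 ∧ v₂₂ = 1 := by
  have hc := congrArg conj htr
  simp only [map_add, Complex.conj_ofNat] at hc
  have key : ((v₁₁ - 1) * conj (v₁₁ - 1) + v₁₂ * conj v₁₂) +
      (v₂₁ * conj v₂₁ + (v₂₂ - 1) * conj (v₂₂ - 1)) = 0 := by
    simp only [map_sub, map_one]
    linear_combination n₁ + n₂ - htr - hc
  simp only [Complex.mul_conj] at key
  have key' : (Complex.normSq (v₁₁ - 1) + Complex.normSq v₁₂) +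
      (Complex.normSq v₂₁ + Complex.normSq (v₂₂ - 1)) = 0 := by exact_mod_cast key
  have a1 := Complex.normSq_nonneg (v₁₁ - 1)
  have a2 := Complex.normSq_nonneg v₁₂
  have a3 := Complex.normSq_nonneg v₂₁
  have a4 := Complex.normSq_nonneg (v₂₂ - 1)
  refine ⟨sub_eq_zero.1 (Complex.normSq_eq_zero.1 ?_), Complex.normSq_eq_zero.1 ?_,
    Complex.normSq_eq_zero.1 ?_, sub_eq_zero.1 (Complex.normSq_eq_zero.1 ?_)⟩ <;> linarith

/-- A bounded holomorphic function on a left half-plane has slowly varying vertical shifts. -/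
theorem norm_shift_sub_le {P : ℂ → ℂ} {L M T : ℝ} (hP : DifferentiableOn ℂ P {ζ | ζ.re < L})
    (hM : ∀ ζ : ℂ, ζ.re < L → ‖P ζ‖ ≤ M) {ζ : ℂ} (hζ : ζ.re < L) :
    ‖P (ζ + T * Complex.I) - P ζ‖ ≤ 2 * M / (L - ζ.re) * |T| := by
  have hopen : IsOpen {ζ : ℂ | ζ.re < L} := isOpen_lt Complex.continuous_re continuous_const
  have hρ : 0 < L - ζ.re := sub_pos.2 hζ
  have hder : ∀ w : ℂ, w.re = ζ.re → ‖deriv P w‖ ≤ 2 * M / (L - ζ.re) := by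
    intro w hw
    have hsub : closedBall w ((L - ζ.re) / 2) ⊆ {ζ | ζ.re < L} := by
      intro x hx
      rw [mem_closedBall, dist_eq_norm] at hx
      have := (Complex.abs_re_le_norm (x - w)).trans hx
      rw [Complex.sub_re, abs_le] at this
      change x.re < L
      linarith [this.2]
    have := Complex.norm_deriv_le_of_forall_mem_sphere_norm_le (c := w) (R := (L - ζ.re) / 2)
      (C := M) (f := P) (by positivity)
      (DifferentiableOn.diffContOnCl_ball hP hsub)
      (fun x hx => hM x (hsub (sphere_subset_closedBall hx)))
    refine this.trans (le_of_eq ?_)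
    field_simp
  have := (convex_univ (𝕜 := ℝ) (E := ℝ)).norm_image_sub_le_of_norm_hasDerivWithin_le
    (f := fun t : ℝ => P (ζ + t * Complex.I)) (C := 2 * M / (L - ζ.re))
    (f' := fun t => deriv P (ζ + t * Complex.I) * Complex.I) (x := 0) (y := T)
    (fun t _ => by
      have hmem : ζ + t * Complex.I ∈ {ζ : ℂ | ζ.re < L} := by simpa using hζ
      exact ((hP.differentiableAt (hopen.mem_nhds hmem)).hasDerivAt.comp_of_eq t
        (hasDerivAt_ray ζ Complex.I t) rfl).hasDerivWithinAt)
    (fun t _ => by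
      rw [norm_mul, Complex.norm_I, mul_one]
      exact hder _ (by simp)) trivial trivial
  simpa using this

/-- A representation on the universal cover of a punctured disc has trivial monodromy when `h`
is bounded above and below. -/
theorem IsRep.periodic_of_bounded {L c M : ℝ} {h : ℂ → ℝ} {P Q W : ℂ → ℂ}
    (hR : IsRep {ζ | ζ.re < L} h P Q) (H : IsLiouvillePair {ζ | ζ.re < L} h W) (hc : 0 < c)
    (hlow : ∀ ζ : ℂ, ζ.re < L → c ≤ h ζ) (hup : ∀ ζ : ℂ, ζ.re < L → h ζ ≤ M)
    (hper : ∀ ζ, h (ζ + (2 * π : ℝ) * Complex.I) = h ζ)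
    (hWper : ∀ ζ, W (ζ + (2 * π : ℝ) * Complex.I) = W ζ) :
    ∀ ζ : ℂ, ζ.re < L → P (ζ + (2 * π : ℝ) * Complex.I) = P ζ ∧
      Q (ζ + (2 * π : ℝ) * Complex.I) = Q ζ := by
  set τ : ℂ := (2 * π : ℝ) * Complex.I with hτ
  have hopen : IsOpen {ζ : ℂ | ζ.re < L} := isOpen_lt Complex.continuous_re continuous_const
  have hconv : IsPreconnected {ζ : ℂ | ζ.re < L} := (convex_halfSpace_re_lt L).isPreconnected
  have hτre : ∀ ζ : ℂ, (ζ + τ).re = ζ.re := by intro ζ; simp [hτ]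
  have hmaps : Set.MapsTo (fun ζ => ζ + τ) {ζ : ℂ | ζ.re < L} {ζ : ℂ | ζ.re < L} := by
    intro ζ hζ; simpa only [Set.mem_ofPred_eq, hτre] using hζ
  have hR' : IsRep {ζ | ζ.re < L} h (fun ζ => P (ζ + τ)) (fun ζ => Q (ζ + τ)) :=
    ⟨hR.1.comp (by fun_prop) hmaps, hR.2.1.comp (by fun_prop) hmaps,
      fun ζ hζ => by rw [← hper]; exact hR.2.2 _ (hmaps hζ)⟩
  obtain ⟨v₁₁, v₁₂, v₂₁, v₂₂, hv, n₁, n₂, -⟩ := hR.exists_unitary hopen hconv hR'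
    (fun z hz => hR.wronskian_ne_zero hopen H hz)
  obtain ⟨κ, hκ, hκW⟩ := hR.wronskian_eq hopen hconv H
  have hd : ∀ {F : ℂ → ℂ}, DifferentiableOn ℂ F {ζ : ℂ | ζ.re < L} → ∀ ζ : ℂ, ζ.re < L →
      HasDerivAt F (deriv F ζ) ζ := fun hF ζ hζ =>
    (hF.differentiableAt (hopen.mem_nhds hζ)).hasDerivAt
  have hderP : ∀ ζ : ℂ, ζ.re < L → deriv P (ζ + τ) = deriv P ζ * v₁₁ + deriv Q ζ * v₂₁ := by
    intro ζ hζ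
    rw [← deriv_comp_add_const]
    refine HasDerivAt.deriv (HasDerivAt.congr_of_eventuallyEq
      (((hd hR.1 ζ hζ).mul_const v₁₁).add ((hd hR.2.1 ζ hζ).mul_const v₂₁)) ?_)
    filter_upwards [hopen.mem_nhds hζ] with x hx using (hv x hx).1
  have hderQ : ∀ ζ : ℂ, ζ.re < L → deriv Q (ζ + τ) = deriv P ζ * v₁₂ + deriv Q ζ * v₂₂ := by
    intro ζ hζ
    rw [← deriv_comp_add_const]
    refine HasDerivAt.deriv (HasDerivAt.congr_of_eventuallyEq
      (((hd hR.1 ζ hζ).mul_const v₁₂).add ((hd hR.2.1 ζ hζ).mul_const v₂₂)) ?_)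
    filter_upwards [hopen.mem_nhds hζ] with x hx using (hv x hx).2
  have hdet : v₁₁ * v₂₂ - v₁₂ * v₂₁ = 1 := by
    have hζ : ((L - 1 : ℝ) : ℂ).re < L := by simp
    set ζ : ℂ := ((L - 1 : ℝ) : ℂ)
    have h1 : wronskian P Q (ζ + τ) = wronskian P Q ζ := by
      rw [hκW _ (hmaps hζ), hκW _ hζ, hWper]
    have h0 := hR.wronskian_ne_zero hopen H hζ
    have h2 : wronskian P Q (ζ + τ) = wronskian P Q ζ * (v₁₁ * v₂₂ - v₁₂ * v₂₁) := by
      simp only [wronskian]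
      rw [hderP ζ hζ, hderQ ζ hζ, (hv ζ hζ).1, (hv ζ hζ).2]
      ring
    rw [h1] at h2
    exact (mul_left_cancel₀ h0 (by rw [mul_one]; exact h2)).symm
  have hPM : ∀ ζ : ℂ, ζ.re < L → ‖P ζ‖ ≤ √M := fun ζ hζ => Real.le_sqrt_of_sq_le (by
    have := hR.norm_sq hζ; have := hup ζ hζ; nlinarith [sq_nonneg ‖Q ζ‖])
  have hQM : ∀ ζ : ℂ, ζ.re < L → ‖Q ζ‖ ≤ √M := fun ζ hζ => Real.le_sqrt_of_sq_le (by
    have := hR.norm_sq hζ; have := hup ζ hζ; nlinarith [sq_nonneg ‖P ζ‖])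
  have hlim : ∀ {F : ℂ → ℂ}, DifferentiableOn ℂ F {ζ | ζ.re < L} →
      (∀ ζ : ℂ, ζ.re < L → ‖F ζ‖ ≤ √M) →
      Tendsto (fun n : ℕ => F (((L - (n + 1) : ℝ) : ℂ) + τ) - F ((L - (n + 1) : ℝ) : ℂ))
        atTop (𝓝 0) := by
    intro F hF hFM
    have h0 : Tendsto (fun n : ℕ => 2 * √M * |2 * π| * (1 / ((n : ℝ) + 1))) atTop (𝓝 0) := by
      simpa using tendsto_one_div_add_atTop_nhds_zero_nat.const_mul (2 * √M * |2 * π|)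
    refine squeeze_zero_norm (fun n => ?_) h0
    have := norm_shift_sub_le (T := 2 * π) hF hFM (ζ := ((L - (n + 1) : ℝ) : ℂ)) (by
      rw [Complex.ofReal_re]; linarith [(Nat.cast_nonneg n : (0 : ℝ) ≤ n)])
    refine this.trans (le_of_eq ?_)
    rw [Complex.ofReal_re, sub_sub_cancel]
    ring
  have hlimP := hlim hR.1 hPM
  have hlimQ := hlim hR.2.1 hQM
  have htr : v₁₁ + v₂₂ = 2 := by
    by_contra hne
    have hne' : 2 - v₁₁ - v₂₂ ≠ 0 := fun h0 => hne (by linear_combination -h0)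
    have hmem : ∀ n : ℕ, ((L - (n + 1) : ℝ) : ℂ).re < L := fun n => by
      rw [Complex.ofReal_re]; linarith [(Nat.cast_nonneg n : (0 : ℝ) ≤ n)]
    have tP : Tendsto (fun n : ℕ => P ((L - (n + 1) : ℝ) : ℂ)) atTop (𝓝 0) := by
      have := ((hlimP.mul_const (v₂₂ - 1)).sub (hlimQ.mul_const v₂₁)).mul_const (2 - v₁₁ - v₂₂)⁻¹
      simp only [zero_mul, sub_zero] at this
      refine this.congr fun n => ?_
      rw [(hv _ (hmem n)).1, (hv _ (hmem n)).2, mul_inv_eq_iff_eq_mul₀ hne']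
      linear_combination P ((L - (n + 1) : ℝ) : ℂ) * hdet
    have tQ : Tendsto (fun n : ℕ => Q ((L - (n + 1) : ℝ) : ℂ)) atTop (𝓝 0) := by
      have := ((hlimQ.mul_const (v₁₁ - 1)).sub (hlimP.mul_const v₁₂)).mul_const (2 - v₁₁ - v₂₂)⁻¹
      simp only [zero_mul, sub_zero] at this
      refine this.congr fun n => ?_
      rw [(hv _ (hmem n)).1, (hv _ (hmem n)).2, mul_inv_eq_iff_eq_mul₀ hne']
      linear_combination Q ((L - (n + 1) : ℝ) : ℂ) * hdet
    have tS := (tP.norm.pow 2).add (tQ.norm.pow 2)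
    simp only [norm_zero, ne_eq, OfNat.ofNat_ne_zero, not_false_eq_true, zero_pow, add_zero] at tS
    have := ge_of_tendsto' tS (fun n => by rw [← hR.norm_sq (hmem n)]; exact hlow _ (hmem n))
    linarith
  obtain ⟨rfl, rfl, rfl, rfl⟩ := eq_one_of_unit_rows_of_trace n₁ n₂ htr
  intro ζ hζ
  have := hv ζ hζ
  simpa using this

theorem descend_periodic {P : ℂ → ℂ} {p : ℂ} {ε : ℝ}
    (hP : DifferentiableOn ℂ P {ζ | ζ.re < Real.log ε})
    (hper : ∀ ζ : ℂ, ζ.re < Real.log ε → P (ζ + (2 * π : ℝ) * Complex.I) = P ζ) :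
    DifferentiableOn ℂ (fun z => P (Complex.log (z - p))) (ball p ε \ {p}) := by
  have hopen : IsOpen {ζ : ℂ | ζ.re < Real.log ε} :=
    isOpen_lt Complex.continuous_re continuous_const
  have hnat : ∀ (n : ℕ) (ζ : ℂ), ζ.re < Real.log ε → P (ζ + n * (2 * π * Complex.I)) = P ζ := by
    intro n
    induction n with
    | zero => intro ζ _; simp
    | succ n ih =>
      intro ζ hζ
      rw [← ih ζ hζ, ← hper (ζ + n * (2 * π * Complex.I)) (by simpa using hζ)]
      congr 1
      push_cast
      ring
  have hint : ∀ (n : ℤ) (ζ : ℂ), ζ.re < Real.log ε → P (ζ + n * (2 * π * Complex.I)) = P ζ := by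
    intro n ζ hζ
    obtain ⟨m, rfl | rfl⟩ := n.eq_nat_or_neg
    · exact_mod_cast hnat m ζ hζ
    · rw [← hnat m (ζ + ((-m : ℤ) : ℂ) * (2 * π * Complex.I)) (by simpa using hζ)]
      congr 1
      push_cast
      ring
  have hlogexp : ∀ ζ : ℂ, ζ.re < Real.log ε → P (Complex.log (Complex.exp ζ)) = P ζ := by
    intro ζ hζ
    obtain ⟨n, hn⟩ := Complex.exp_eq_exp_iff_exists_int.1
      (Complex.exp_log (Complex.exp_ne_zero ζ))
    rw [hn]
    exact hint n ζ hζ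
  intro z hz
  apply DifferentiableAt.differentiableWithinAt
  have hz0 : z - p ≠ 0 := sub_ne_zero.2 hz.2
  set ζ₀ := Complex.log (z - p) with hζ₀
  have hexp : Complex.exp ζ₀ = z - p := Complex.exp_log hz0
  have hre : ζ₀.re < Real.log ε := by
    rw [hζ₀, Complex.log_re]
    refine Real.log_lt_log (norm_pos_iff.2 hz0) ?_
    simpa [dist_eq_norm] using hz.1
  set g : ℂ → ℂ := fun x => ζ₀ + Complex.log ((x - p) / Complex.exp ζ₀) with hg
  have hgz : g z = ζ₀ := by simp [hg, hexp, div_self hz0]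
  have hgd : DifferentiableAt ℂ g z := by
    refine (DifferentiableAt.clog (by fun_prop) ?_).const_add ζ₀
    rw [hexp, div_self hz0]
    simp
  have hcomp : DifferentiableAt ℂ (fun x => P (g x)) z :=
    DifferentiableAt.comp z (g := P) (by rw [hgz]; exact hP.differentiableAt (hopen.mem_nhds hre)) hgd
  refine hcomp.congr_of_eventuallyEq ?_
  have h1 : ∀ᶠ x in 𝓝 z, (g x).re < Real.log ε :=
    hgd.continuousAt.eventually (by rw [hgz]; exact hopen.mem_nhds hre)
  have h2 : ∀ᶠ x in 𝓝 z, x ≠ p := isOpen_ne.mem_nhds hz.2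
  filter_upwards [h1, h2] with x hx hxp
  have : Complex.exp (g x) = x - p := by
    simp only [hg, Complex.exp_add]
    rw [Complex.exp_log (div_ne_zero (sub_ne_zero.2 hxp) (Complex.exp_ne_zero _)),
      mul_div_cancel₀ _ (Complex.exp_ne_zero _)]
  rw [← this]
  exact hlogexp _ hx

/-- A solution on a punctured disc which is bounded above and below is `|P|² + |Q|²` with
single-valued `P`, `Q`. -/
theorem IsLiouvillePair.exists_rep_punctured {p : ℂ} {ε c M : ℝ} (hε : 0 < ε) {h : ℂ → ℝ}
    {W : ℂ → ℂ} (H : IsLiouvillePair (ball p ε \ {p}) h W) (hc : 0 < c)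
    (hlow : ∀ z ∈ ball p ε \ {p}, c ≤ h z) (hup : ∀ z ∈ ball p ε \ {p}, h z ≤ M) :
    ∃ P Q : ℂ → ℂ, IsRep (ball p ε \ {p}) h P Q := by
  have hopen : IsOpen {ζ : ℂ | ζ.re < Real.log ε} :=
    isOpen_lt Complex.continuous_re continuous_const
  have hmaps : Set.MapsTo (fun ζ => p + Complex.exp ζ) {ζ : ℂ | ζ.re < Real.log ε}
      (ball p ε \ {p}) := by
    intro ζ hζ
    refine ⟨?_, ?_⟩
    · rw [mem_ball, dist_eq_norm, add_sub_cancel_left, Complex.norm_exp]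
      exact (Real.lt_log_iff_exp_lt hε).1 hζ
    · simp [Complex.exp_ne_zero]
  have hexp : ∀ ζ : ℂ, HasDerivAt Complex.exp (Complex.exp ζ) ζ := Complex.hasDerivAt_exp
  have HL := H.comp hmaps (φ' := Complex.exp) (φ'' := Complex.exp)
    (fun ζ _ => (hexp ζ).const_add p) (fun ζ _ => hexp ζ) Complex.continuous_exp.continuousOn
    (fun ζ _ => Complex.exp_ne_zero ζ)
  have hc₀ : ((Real.log ε - 1 : ℝ) : ℂ) ∈ {ζ : ℂ | ζ.re < Real.log ε} := by simp
  obtain ⟨P, Q, hP, hQ, hPQ⟩ := HL.exists_rep hopen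
    ((convex_halfSpace_re_lt (Real.log ε)).starConvex hc₀) hc₀
  have hR : IsRep {ζ : ℂ | ζ.re < Real.log ε} (fun ζ => h (p + Complex.exp ζ)) P Q :=
    ⟨hP, hQ, hPQ⟩
  have hexpper : ∀ ζ, Complex.exp (ζ + (2 * π : ℝ) * Complex.I) = Complex.exp ζ := by
    intro ζ
    rw [← Complex.exp_periodic ζ]
    congr 1
    push_cast
    ring
  have hper := hR.periodic_of_bounded HL hc (fun ζ hζ => hlow _ (hmaps hζ))
    (fun ζ hζ => hup _ (hmaps hζ)) (fun ζ => by simp only [hexpper])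
    (fun ζ => by simp only [hexpper])
  refine ⟨_, _, descend_periodic hP (fun ζ hζ => (hper ζ hζ).1),
    descend_periodic hQ (fun ζ hζ => (hper ζ hζ).2), fun z hz => ?_⟩
  have hz0 : z - p ≠ 0 := sub_ne_zero.2 hz.2
  have hre : (Complex.log (z - p)).re < Real.log ε := by
    rw [Complex.log_re]
    refine Real.log_lt_log (norm_pos_iff.2 hz0) ?_
    simpa [dist_eq_norm] using hz.1
  have := hPQ _ hre
  rwa [Complex.exp_log hz0, add_sub_cancel] at this

/-- The plane slit along the real half-lines `[1, ∞)` and `(-∞, -1]`. -/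
def doublySlitPlane : Set ℂ := {z | z.im ≠ 0 ∨ |z.re| < 1}

theorem isOpen_doublySlitPlane : IsOpen doublySlitPlane :=
  (isOpen_ne_fun Complex.continuous_im continuous_const).union
    (isOpen_lt Complex.continuous_re.abs continuous_const)

theorem starConvex_doublySlitPlane : StarConvex ℝ 0 doublySlitPlane := by
  intro y hy a b ha hb hab
  rcases hb.eq_or_lt with rfl | hb
  · right
    simp
  · rcases hy with hy | hy
    · left
      simpa using ⟨hb.ne', hy⟩
    · right
      have : |b * y.re| < 1 := by
        rw [abs_mul, abs_of_pos hb]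
        nlinarith [abs_nonneg y.re]
      simpa using this

theorem abs_re_sub_lt_of_mem_ball {σ ε : ℝ} {z : ℂ} (hz : z ∈ ball (σ : ℂ) ε) :
    |z.re - σ| < ε := by
  have := (Complex.abs_re_le_norm (z - σ)).trans_lt (by simpa [dist_eq_norm] using hz)
  simpa using this

/-- Extension of a representation across the puncture `σ = ±1` and the half-plane behind it. -/
theorem IsRep.glue_half_plane {Ω : Set ℂ} {h : ℂ → ℝ} {W P Q P₁ Q₁ P₂ Q₂ : ℂ → ℂ} {σ ε : ℝ}
    (hσ : σ * σ = 1) (hε : 0 < ε) (hε1 : ε ≤ 1) (hΩ : IsOpen Ω)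
    (hmem : ∀ z : ℂ, 0 < σ * z.re → (z ∈ Ω ↔ z ∈ doublySlitPlane))
    (hR : IsRep Ω h P Q) (hR₁ : IsRep (ball (σ : ℂ) ε \ {(σ : ℂ)}) h P₁ Q₁)
    (hR₂ : IsRep {z : ℂ | 1 < σ * z.re} h P₂ Q₂)
    (H₁ : IsLiouvillePair (ball (σ : ℂ) ε \ {(σ : ℂ)}) h W)
    (H₂ : IsLiouvillePair {z : ℂ | 1 < σ * z.re} h W) :
    ∃ P' Q' : ℂ → ℂ, IsRep (Ω ∪ (ball (σ : ℂ) ε \ {(σ : ℂ)}) ∪ {z : ℂ | 1 < σ * z.re}) h P' Q' := by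
  have hmem' : ∀ z : ℂ, 0 < σ * z.re → (z ∈ Ω ↔ z.im ≠ 0 ∨ σ * z.re < 1) := by
    intro z hz
    have : |z.re| = σ * z.re := by
      rw [← abs_of_pos hz, abs_mul]
      have : |σ| = 1 := by
        have h1 := abs_mul_abs_self σ
        nlinarith [abs_nonneg σ]
      rw [this, one_mul]
    rw [hmem z hz, ← this]
    rfl
  have hballre : ∀ z ∈ ball (σ : ℂ) ε, 0 < σ * z.re := by
    intro z hz
    have h1 := abs_lt.1 (abs_re_sub_lt_of_mem_ball hz)
    rcases mul_self_eq_one_iff.1 hσ with rfl | rfl <;> linarith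
  have ho₁ : IsOpen (ball (σ : ℂ) ε \ {(σ : ℂ)}) := isOpen_ball.sdiff isClosed_singleton
  have ho₂ : IsOpen {z : ℂ | 1 < σ * z.re} :=
    isOpen_lt continuous_const (continuous_const.mul Complex.continuous_re)
  have habs : |σ| = 1 := by
    have h1 := abs_mul_abs_self σ
    nlinarith [abs_nonneg σ]
  have hcen : ∀ t : ℝ, |t| < ε → ((σ * (1 + t) : ℝ) : ℂ) ∈ ball (σ : ℂ) ε := by
    intro t ht
    rw [mem_ball, dist_eq_norm, ← Complex.ofReal_sub, Complex.norm_real, Real.norm_eq_abs,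
      show σ * (1 + t) - σ = σ * t by ring, abs_mul, habs, one_mul]
    exact ht
  have ht1 : |-(ε / 2)| < ε := by rw [abs_neg, abs_of_pos (by linarith)]; linarith
  have ht2 : |ε / 2| < ε := by rw [abs_of_pos (by linarith)]; linarith
  have hx₁ : ((σ * (1 + -(ε / 2)) : ℝ) : ℂ) ∈ Ω ∩ (ball (σ : ℂ) ε \ {(σ : ℂ)}) := by
    refine ⟨(hmem' _ (hballre _ (hcen _ ht1))).2 (Or.inr ?_), hcen _ ht1, ?_⟩
    · rw [Complex.ofReal_re, ← mul_assoc, hσ]; linarith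
    · intro h
      have h := Complex.ofReal_injective (Set.mem_singleton_iff.1 h)
      rcases mul_self_eq_one_iff.1 hσ with rfl | rfl <;> linarith
  have hs₁ : StarConvex ℝ ((σ * (1 + -(ε / 2)) : ℝ) : ℂ) (Ω ∩ (ball (σ : ℂ) ε \ {(σ : ℂ)})) := by
    intro y hy a b ha hb hab
    rcases hb.eq_or_lt with rfl | hb
    · obtain rfl : a = 1 := by linarith
      simpa using hx₁
    · have hb' := (convex_ball (σ : ℂ) ε) (hcen _ ht1) hy.2.1 ha hb.le hab
      have hy' := (hmem' y (hballre y hy.2.1)).1 hy.1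
      have key : ((a • ((σ * (1 + -(ε / 2)) : ℝ) : ℂ) + b • y).im ≠ 0 ∨
          σ * (a • ((σ * (1 + -(ε / 2)) : ℝ) : ℂ) + b • y).re < 1) := by
        rcases hy' with h | h
        · left
          simpa using ⟨hb.ne', h⟩
        · right
          simp only [Complex.add_re, Complex.real_smul, Complex.re_ofReal_mul, Complex.ofReal_re]
          have : σ * (a * (σ * (1 + -(ε / 2))) + b * y.re) =
            a * (σ * σ) * (1 - ε / 2) + b * (σ * y.re) := by ring
          rw [this, hσ]
          nlinarith
      refine ⟨(hmem' _ (hballre _ hb')).2 key, hb', ?_⟩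
      intro h
      rw [Set.mem_singleton_iff] at h
      rw [h] at key
      simp [hσ] at key
  obtain ⟨P', Q', hR'⟩ := hR.glue hΩ ho₁ (hs₁.isPathConnected hx₁).isConnected.isPreconnected
    ⟨_, hx₁⟩ hR₁ H₁
  have hmem₂ : ∀ z : ℂ, 1 < σ * z.re →
      (z ∈ Ω ∪ (ball (σ : ℂ) ε \ {(σ : ℂ)}) ↔ z.im ≠ 0 ∨ z ∈ ball (σ : ℂ) ε) := by
    intro z hz
    have hne : z ≠ σ := by
      rintro rfl
      simp [hσ] at hz
    rw [Set.mem_union, hmem' z (by linarith)]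
    constructor
    · rintro ((h | h) | h)
      · exact Or.inl h
      · linarith
      · exact Or.inr h.1
    · rintro (h | h)
      · exact Or.inl (Or.inl h)
      · exact Or.inr ⟨h, hne⟩
  have hx₂' : ((σ * (1 + ε / 2) : ℝ) : ℂ) ∈ {z : ℂ | 1 < σ * z.re} := by
    change 1 < σ * ((σ * (1 + ε / 2) : ℝ) : ℂ).re
    rw [Complex.ofReal_re, ← mul_assoc, hσ]
    linarith
  have hx₂ : ((σ * (1 + ε / 2) : ℝ) : ℂ) ∈
      (Ω ∪ (ball (σ : ℂ) ε \ {(σ : ℂ)})) ∩ {z : ℂ | 1 < σ * z.re} :=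
    ⟨(hmem₂ _ hx₂').2 (Or.inr (hcen _ ht2)), hx₂'⟩
  have hs₂ : StarConvex ℝ ((σ * (1 + ε / 2) : ℝ) : ℂ)
      ((Ω ∪ (ball (σ : ℂ) ε \ {(σ : ℂ)})) ∩ {z : ℂ | 1 < σ * z.re}) := by
    intro y hy a b ha hb hab
    rcases hb.eq_or_lt with rfl | hb
    · obtain rfl : a = 1 := by linarith
      simpa using hx₂
    · have h1 : a • ((σ * (1 + ε / 2) : ℝ) : ℂ) + b • y ∈ {z : ℂ | 1 < σ * z.re} := by
        have hy2 : 1 < σ * y.re := hy.2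
        change 1 < σ * (a • ((σ * (1 + ε / 2) : ℝ) : ℂ) + b • y).re
        simp only [Complex.add_re, Complex.real_smul, Complex.re_ofReal_mul, Complex.ofReal_re]
        have : σ * (a * (σ * (1 + ε / 2)) + b * y.re) =
          a * (σ * σ) * (1 + ε / 2) + b * (σ * y.re) := by ring
        rw [this, hσ]
        nlinarith
      refine ⟨(hmem₂ _ h1).2 ?_, h1⟩
      rcases (hmem₂ y hy.2).1 hy.1 with h | h
      · left
        simpa using ⟨hb.ne', h⟩
      · exact Or.inr ((convex_ball (σ : ℂ) ε) (hcen _ ht2) h ha hb.le hab)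
  exact hR'.glue (hΩ.union ho₁) ho₂ (hs₂.isPathConnected hx₂).isConnected.isPreconnected
    ⟨_, hx₂⟩ hR₂ H₂

theorem IsRep.mono {Ω Ω' : Set ℂ} {h : ℂ → ℝ} {P Q : ℂ → ℂ} (hR : IsRep Ω h P Q)
    (hsub : Ω' ⊆ Ω) : IsRep Ω' h P Q :=
  ⟨hR.1.mono hsub, hR.2.1.mono hsub, fun z hz => hR.2.2 z (hsub hz)⟩

theorem IsLiouvillePair.exists_rep_of_punctures_unit {h : ℂ → ℝ} {W : ℂ → ℂ} {ε c M : ℝ}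
    (H : IsLiouvillePair ({1, -1}ᶜ) h W) (hε : 0 < ε) (hε1 : ε ≤ 1) (hc : 0 < c)
    (hb : ∀ σ : ℝ, σ * σ = 1 → ∀ z ∈ ball (σ : ℂ) ε \ {(σ : ℂ)}, c ≤ h z ∧ h z ≤ M) :
    ∃ P Q : ℂ → ℂ, IsRep ({1, -1}ᶜ) h P Q := by
  have hcases : ∀ σ : ℝ, σ * σ = 1 → σ = 1 ∨ σ = -1 := fun σ hσ => mul_self_eq_one_iff.1 hσ
  have hsub₁ : ∀ σ : ℝ, σ * σ = 1 → ball (σ : ℂ) ε \ {(σ : ℂ)} ⊆ ({1, -1} : Set ℂ)ᶜ := by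
    intro σ hσ z hz hz'
    have h1 := abs_lt.1 (abs_re_sub_lt_of_mem_ball hz.1)
    rcases hcases σ hσ with rfl | rfl <;> rcases hz' with rfl | hz'
    · simp at hz
    · rw [Set.mem_singleton_iff] at hz'
      subst hz'
      norm_num at h1
      linarith
    · norm_num at h1
      linarith
    · rw [Set.mem_singleton_iff] at hz'
      subst hz'
      simp at hz
  have hsub₂ : ∀ σ : ℝ, σ * σ = 1 → {z : ℂ | 1 < σ * z.re} ⊆ ({1, -1} : Set ℂ)ᶜ := by
    intro σ hσ z hz hz'
    have hz : 1 < σ * z.re := hz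
    rcases hcases σ hσ with rfl | rfl <;> rcases hz' with rfl | hz'
    · norm_num at hz
    · rw [Set.mem_singleton_iff] at hz'
      subst hz'
      norm_num at hz
    · norm_num at hz
    · rw [Set.mem_singleton_iff] at hz'
      subst hz'
      norm_num at hz
  have hsub₀ : doublySlitPlane ⊆ ({1, -1} : Set ℂ)ᶜ := by
    intro z hz hz'
    rcases hz' with rfl | hz'
    · rcases hz with hz | hz <;> norm_num at hz
    · rw [Set.mem_singleton_iff] at hz'
      subst hz'
      rcases hz with hz | hz <;> norm_num at hz
  have hzero : (0 : ℂ) ∈ doublySlitPlane := Or.inr (by simp)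
  have E₁ : ∀ σ : ℝ, σ * σ = 1 → ∃ P Q : ℂ → ℂ, IsRep (ball (σ : ℂ) ε \ {(σ : ℂ)}) h P Q :=
    fun σ hσ => (H.mono (hsub₁ σ hσ)).exists_rep_punctured hε hc (fun z hz => (hb σ hσ z hz).1)
      (fun z hz => (hb σ hσ z hz).2)
  have ho₂ : ∀ σ : ℝ, IsOpen {z : ℂ | 1 < σ * z.re} := fun σ =>
    isOpen_lt continuous_const (continuous_const.mul Complex.continuous_re)
  have E₂ : ∀ σ : ℝ, σ * σ = 1 → ∃ P Q : ℂ → ℂ, IsRep {z : ℂ | 1 < σ * z.re} h P Q := by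
    intro σ hσ
    have hc₀ : ((2 * σ : ℝ) : ℂ) ∈ {z : ℂ | 1 < σ * z.re} := by
      change 1 < σ * ((2 * σ : ℝ) : ℂ).re
      rw [Complex.ofReal_re]
      linarith
    have hconv : Convex ℝ {z : ℂ | 1 < σ * z.re} :=
      (convex_Ioi (1 : ℝ)).linear_preimage (σ • Complex.reLm)
    exact (H.mono (hsub₂ σ hσ)).exists_rep (ho₂ σ) (hconv.starConvex hc₀) hc₀
  obtain ⟨P₀, Q₀, hR₀⟩ := (H.mono hsub₀).exists_rep isOpen_doublySlitPlane
    starConvex_doublySlitPlane hzero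
  obtain ⟨A₁, B₁, hA⟩ := E₁ 1 (by norm_num)
  obtain ⟨A₂, B₂, hA'⟩ := E₂ 1 (by norm_num)
  obtain ⟨C₁, D₁, hC⟩ := E₁ (-1) (by norm_num)
  obtain ⟨C₂, D₂, hC'⟩ := E₂ (-1) (by norm_num)
  obtain ⟨P₁, Q₁, hR₁⟩ := IsRep.glue_half_plane (by norm_num) hε hε1 isOpen_doublySlitPlane
    (fun _ _ => Iff.rfl) hR₀ hA hA' (H.mono (hsub₁ 1 (by norm_num)))
    (H.mono (hsub₂ 1 (by norm_num)))
  obtain ⟨P₂, Q₂, hR₂⟩ := IsRep.glue_half_plane (by norm_num) hε hε1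
    ((isOpen_doublySlitPlane.union (isOpen_ball.sdiff isClosed_singleton)).union (ho₂ 1))
    (fun z hz => by
      refine ⟨?_, fun h => Or.inl (Or.inl h)⟩
      rintro ((h | h) | h)
      · exact h
      · have h1 := abs_lt.1 (abs_re_sub_lt_of_mem_ball h.1)
        linarith
      · have h : 1 < 1 * z.re := h
        linarith) hR₁ hC hC'
    (H.mono (hsub₁ (-1) (by norm_num))) (H.mono (hsub₂ (-1) (by norm_num)))
  refine ⟨P₂, Q₂, hR₂.mono fun z hz => ?_⟩
  have hz1 : z ≠ 1 := fun h => hz (by simp [h])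
  have hz2 : z ≠ -1 := fun h => hz (by simp [h])
  by_cases him : z.im = 0
  · rcases lt_trichotomy z.re 1 with h | h | h
    · rcases lt_trichotomy z.re (-1) with h' | h' | h'
      · right
        change 1 < -1 * z.re
        linarith
      · exact absurd (Complex.ext (by simpa using h') (by simpa using him)) hz2
      · exact Or.inl (Or.inl (Or.inl (Or.inl (Or.inr (abs_lt.2 ⟨h', h⟩)))))
    · exact absurd (Complex.ext (by simpa using h) (by simpa using him)) hz1
    · refine Or.inl (Or.inl (Or.inr ?_))
      change 1 < 1 * z.re
      linarith
  · exact Or.inl (Or.inl (Or.inl (Or.inl (Or.inl him))))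

theorem exists_entire_of_bounded {p₁ p₂ : ℂ} {f : ℂ → ℂ} {ε M : ℝ} (hε : 0 < ε)
    (hf : DifferentiableOn ℂ f {p₁, p₂}ᶜ)
    (hb : ∀ z, z ≠ p₁ → z ≠ p₂ → z ∈ ball p₁ ε ∨ z ∈ ball p₂ ε → ‖f z‖ ≤ M) :
    ∃ F : ℂ → ℂ, Differentiable ℂ F ∧ ∀ z, z ≠ p₁ → z ≠ p₂ → F z = f z := by
  classical
  have key : ∀ (S : Set ℂ) (p : ℂ) (g : ℂ → ℂ), IsOpen S → p ∈ S →
      DifferentiableOn ℂ g (S \ {p}) → (∃ δ > 0, ∀ z ∈ ball p δ, z ≠ p → ‖g z‖ ≤ M) →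
      DifferentiableOn ℂ (Function.update g p (limUnder (𝓝[≠] p) g)) S := by
    rintro S p g hS hp hg ⟨δ, hδ, hbd⟩
    have h1 := Complex.differentiableOn_update_limUnder_of_bddAbove (f := g) (c := p)
      (s := S ∩ ball p δ) (Filter.inter_mem (hS.mem_nhds hp) (ball_mem_nhds p hδ))
      (hg.mono fun z hz => ⟨hz.1.1, hz.2⟩)
      ⟨M, by
        rintro _ ⟨z, hz, rfl⟩
        exact hbd z hz.1.2 hz.2⟩
    intro z hz
    by_cases hzp : z = p
    · subst hzp
      exact (h1.differentiableAt (Filter.inter_mem (hS.mem_nhds hp)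
        (ball_mem_nhds z hδ))).differentiableWithinAt
    · have h2 : DifferentiableAt ℂ g z := hg.differentiableAt
        ((hS.sdiff isClosed_singleton).mem_nhds ⟨hz, hzp⟩)
      refine (h2.congr_of_eventuallyEq ?_).differentiableWithinAt
      filter_upwards [isOpen_ne.mem_nhds hzp] with x hx
      exact Function.update_of_ne hx _ _
  by_cases hp : p₁ = p₂
  · subst hp
    have := key Set.univ p₁ f isOpen_univ trivial (hf.mono fun z hz => by simpa using hz.2)
      ⟨ε, hε, fun z hz hz' => hb z hz' hz' (Or.inl hz)⟩
    exact ⟨_, differentiableOn_univ.1 this, fun z hz _ => Function.update_of_ne hz _ _⟩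
  · have h1 := key {p₂}ᶜ p₁ f isOpen_compl_singleton (by simpa using hp)
      (hf.mono fun z hz => by
        simp only [Set.mem_compl_iff, Set.mem_insert_iff, Set.mem_singleton_iff, not_or]
        exact ⟨hz.2, hz.1⟩)
      ⟨min ε (dist p₁ p₂), lt_min hε (dist_pos.2 hp), fun z hz hz' => hb z hz' (by
        rintro rfl
        have := (mem_ball.1 hz).trans_le (min_le_right _ _)
        rw [dist_comm] at this
        exact lt_irrefl _ this) (Or.inl (ball_subset_ball (min_le_left _ _) hz))⟩
    have h2 := key Set.univ p₂ _ isOpen_univ trivial (h1.mono fun z hz => hz.2)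
      ⟨min ε (dist p₁ p₂), lt_min hε (dist_pos.2 hp), fun z hz hz' => by
        have hz1 : z ≠ p₁ := by
          rintro rfl
          exact lt_irrefl _ ((mem_ball.1 hz).trans_le (min_le_right _ _))
        rw [Function.update_of_ne hz1]
        exact hb z hz1 hz' (Or.inr (ball_subset_ball (min_le_left _ _) hz))⟩
    exact ⟨_, differentiableOn_univ.1 h2, fun z hz hz' => by
      rw [Function.update_of_ne hz', Function.update_of_ne hz]⟩

theorem isOpen_compl_pair (p₁ p₂ : ℂ) : IsOpen ({p₁, p₂}ᶜ : Set ℂ) :=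
  (Set.toFinite _).isClosed.isOpen_compl

theorem mem_compl_pair {p₁ p₂ z : ℂ} : z ∈ ({p₁, p₂}ᶜ : Set ℂ) ↔ z ≠ p₁ ∧ z ≠ p₂ := by
  simp

theorem IsLiouvillePair.exists_rep_of_punctures {p₁ p₂ : ℂ} (hp : p₁ ≠ p₂) {h : ℂ → ℝ}
    {W : ℂ → ℂ} {ε c M : ℝ} (H : IsLiouvillePair ({p₁, p₂}ᶜ) h W) (hε : 0 < ε) (hc : 0 < c)
    (hb : ∀ z, z ≠ p₁ → z ≠ p₂ → z ∈ ball p₁ ε ∨ z ∈ ball p₂ ε → c ≤ h z ∧ h z ≤ M) :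
    ∃ P Q : ℂ → ℂ, IsRep ({p₁, p₂}ᶜ) h P Q := by
  set m : ℂ := (p₁ + p₂) / 2 with hm
  set d : ℂ := (p₁ - p₂) / 2 with hd
  have hd0 : d ≠ 0 := div_ne_zero (sub_ne_zero.2 hp) two_ne_zero
  have hd1 : 0 < ‖d‖ := norm_pos_iff.2 hd0
  have h1 : m + d * 1 = p₁ := by rw [hm, hd]; ring
  have h2 : m + d * (-1) = p₂ := by rw [hm, hd]; ring
  have hinj : ∀ x y : ℂ, m + d * x = m + d * y ↔ x = y := fun x y => by
    rw [add_right_inj, mul_right_inj' hd0]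
  have hmaps : Set.MapsTo (fun w => m + d * w) ({1, -1}ᶜ) ({p₁, p₂}ᶜ) := by
    intro w hw
    rw [mem_compl_pair] at hw ⊢
    rw [← h1, ← h2, Ne, Ne, hinj, hinj]
    exact hw
  have HL := H.comp hmaps (φ' := fun _ => d) (φ'' := fun _ => 0)
    (fun z _ => by simpa using ((hasDerivAt_id z).const_mul d).const_add m)
    (fun z _ => hasDerivAt_const z d) continuousOn_const (fun _ _ => hd0)
  have hball : ∀ x w : ℂ, w ∈ ball x (min 1 (ε / ‖d‖)) → m + d * w ∈ ball (m + d * x) ε := by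
    intro x w hw
    have := (mem_ball.1 hw).trans_le (min_le_right _ _)
    rw [dist_eq_norm, lt_div_iff₀ hd1] at this
    rw [mem_ball, dist_eq_norm, add_sub_add_left_eq_sub, ← mul_sub, norm_mul]
    linarith
  have hne : ∀ σ : ℝ, σ * σ = 1 → ∀ w ∈ ball (σ : ℂ) (min 1 (ε / ‖d‖)) \ {(σ : ℂ)},
      w ∈ ({1, -1}ᶜ : Set ℂ) := by
    intro σ hσ w hw
    have hw1 := abs_lt.1 ((abs_re_sub_lt_of_mem_ball hw.1).trans_le (min_le_left _ _))
    have hw2 := hw.2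
    rw [Set.mem_singleton_iff] at hw2
    rw [mem_compl_pair]
    rcases mul_self_eq_one_iff.1 hσ with rfl | rfl
    · refine ⟨by simpa using hw2, ?_⟩
      rintro rfl
      norm_num at hw1
    · refine ⟨?_, by simpa using hw2⟩
      rintro rfl
      norm_num at hw1
  obtain ⟨P, Q, hP, hQ, hPQ⟩ := HL.exists_rep_of_punctures_unit (ε := min 1 (ε / ‖d‖)) (c := c)
    (M := M) (lt_min one_pos (div_pos hε hd1)) (min_le_left _ _) hc (fun σ hσ w hw => by
      have hw' := hmaps (hne σ hσ w hw)
      rw [mem_compl_pair] at hw'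
      refine hb _ hw'.1 hw'.2 ?_
      have := hball _ _ hw.1
      rcases mul_self_eq_one_iff.1 hσ with rfl | rfl
      · left
        rw [← h1]
        simpa using this
      · right
        rw [← h2]
        simpa using this)
  have hφ : ∀ z, m + d * ((z - m) / d) = z := fun z => by field_simp; ring
  have hmaps' : Set.MapsTo (fun z => (z - m) / d) ({p₁, p₂}ᶜ) ({1, -1}ᶜ) := by
    intro z hz
    rw [mem_compl_pair] at hz ⊢
    refine ⟨fun (h : (z - m) / d = 1) => hz.1 ?_, fun (h : (z - m) / d = -1) => hz.2 ?_⟩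
    · rw [← hφ z, h, h1]
    · rw [← hφ z, h, h2]
  have hψ : DifferentiableOn ℂ (fun z => (z - m) / d) ({p₁, p₂}ᶜ) := by fun_prop
  refine ⟨_, _, hP.comp hψ hmaps', hQ.comp hψ hmaps', fun z hz => ?_⟩
  have := hPQ _ (hmaps' hz)
  simpa only [hφ, Function.comp_apply] using this

/-- Across punctures where `h` is bounded above and below, the representation is entire. -/
theorem IsLiouvillePair.exists_entire_rep {p₁ p₂ : ℂ} (hp : p₁ ≠ p₂) {h : ℂ → ℝ}
    {W : ℂ → ℂ} {ε c M : ℝ} (H : IsLiouvillePair ({p₁, p₂}ᶜ) h W) (hε : 0 < ε) (hc : 0 < c)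
    (hb : ∀ z, z ≠ p₁ → z ≠ p₂ → z ∈ ball p₁ ε ∨ z ∈ ball p₂ ε → c ≤ h z ∧ h z ≤ M) :
    ∃ P Q : ℂ → ℂ, Differentiable ℂ P ∧ Differentiable ℂ Q ∧ (∀ z, 0 < ‖P z‖ ^ 2 + ‖Q z‖ ^ 2) ∧
      (∀ z, z ≠ p₁ → z ≠ p₂ → h z = ‖P z‖ ^ 2 + ‖Q z‖ ^ 2) ∧
      ∃ κ : ℂ, ‖κ‖ = 1 ∧ ∀ z, z ≠ p₁ → z ≠ p₂ → wronskian P Q z = κ * W z := by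
  obtain ⟨P₀, Q₀, hR₀⟩ := H.exists_rep_of_punctures hp hε hc hb
  have hn₀ : ∀ z, z ≠ p₁ → z ≠ p₂ → h z = ‖P₀ z‖ ^ 2 + ‖Q₀ z‖ ^ 2 := fun z h1 h2 =>
    hR₀.norm_sq (mem_compl_pair.2 ⟨h1, h2⟩)
  obtain ⟨P, hP, hPe⟩ := exists_entire_of_bounded (M := √M) hε hR₀.1 fun z h1 h2 h3 => by
    refine Real.le_sqrt_of_sq_le ?_
    have := hn₀ z h1 h2
    have := (hb z h1 h2 h3).2
    nlinarith [sq_nonneg ‖Q₀ z‖]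
  obtain ⟨Q, hQ, hQe⟩ := exists_entire_of_bounded (M := √M) hε hR₀.2.1 fun z h1 h2 h3 => by
    refine Real.le_sqrt_of_sq_le ?_
    have := hn₀ z h1 h2
    have := (hb z h1 h2 h3).2
    nlinarith [sq_nonneg ‖P₀ z‖]
  have hn : ∀ z, z ≠ p₁ → z ≠ p₂ → h z = ‖P z‖ ^ 2 + ‖Q z‖ ^ 2 := fun z h1 h2 => by
    rw [hn₀ z h1 h2, hPe z h1 h2, hQe z h1 h2]
  have hR : IsRep ({p₁, p₂}ᶜ) h P Q := ⟨hP.differentiableOn, hQ.differentiableOn, fun z hz => by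
    rw [mem_compl_pair] at hz
    rw [hPe z hz.1 hz.2, hQe z hz.1 hz.2]
    exact hR₀.2.2 z (mem_compl_pair.2 hz)⟩
  have hcont : Continuous fun z => ‖P z‖ ^ 2 + ‖Q z‖ ^ 2 :=
    (hP.continuous.norm.pow 2).add (hQ.continuous.norm.pow 2)
  have hlow : ∀ p q : ℂ, p ≠ q → (∀ z, z ≠ p → z ≠ q → z ∈ ball p ε →
      c ≤ ‖P z‖ ^ 2 + ‖Q z‖ ^ 2) → 0 < ‖P p‖ ^ 2 + ‖Q p‖ ^ 2 := by
    intro p q hpq hz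
    refine hc.trans_le (ge_of_tendsto (x := 𝓝[≠] p)
      ((hcont.tendsto p).mono_left nhdsWithin_le_nhds) ?_)
    filter_upwards [self_mem_nhdsWithin, nhdsWithin_le_nhds (ball_mem_nhds p hε),
      nhdsWithin_le_nhds (isOpen_ne.mem_nhds hpq)] with z h1 h2 h3 using hz z h1 h3 h2
  have hpre : IsPreconnected ({p₁, p₂}ᶜ : Set ℂ) :=
    (Set.Countable.isConnected_compl_of_one_lt_rank (by
      rw [Complex.rank_real_complex]; norm_num) (Set.toFinite _).countable).isPreconnected
  obtain ⟨κ, -, hκW⟩ := hR.wronskian_eq (isOpen_compl_pair p₁ p₂) hpre H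
  have hκ1 : ‖κ‖ = 1 := by
    obtain ⟨z, hz⟩ : ({p₁, p₂}ᶜ : Set ℂ).Nonempty := (Set.toFinite _).infinite_compl.nonempty
    have h1 := hR.wronskian_norm (isOpen_compl_pair p₁ p₂) H hz
    rw [hκW z hz, Complex.mul_conj', Complex.mul_conj', norm_mul] at h1
    have h2 : (‖κ‖ * ‖W z‖) ^ 2 = ‖W z‖ ^ 2 := by exact_mod_cast h1
    have h3 : ‖W z‖ ^ 2 ≠ 0 := pow_ne_zero 2 (norm_ne_zero_iff.2 (H.2.2.1 z hz))
    rw [mul_pow] at h2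
    exact (pow_eq_one_iff_of_nonneg (norm_nonneg κ) two_ne_zero).1 (mul_eq_right₀ h3 |>.1 h2)
  refine ⟨P, Q, hP, hQ, fun z => ?_, hn, κ, hκ1, fun z h1 h2 => hκW z (mem_compl_pair.2 ⟨h1, h2⟩)⟩
  by_cases h1 : z = p₁
  · subst h1
    exact hlow z p₂ hp fun x hx hx' hx'' => by
      rw [← hn x hx hx']; exact (hb x hx hx' (Or.inl hx'')).1
  by_cases h2 : z = p₂
  · subst h2
    exact hlow z p₁ hp.symm fun x hx hx' hx'' => by
      rw [← hn x hx' hx]; exact (hb x hx' hx (Or.inr hx'')).1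
  rw [← hn z h1 h2]
  exact H.1 z (mem_compl_pair.2 ⟨h1, h2⟩)

section CircleIntegrals

variable {E : Type*} [NormedAddCommGroup E] [NormedSpace ℝ E]

theorem hasDerivAt_intervalIntegral_of_continuous {F F' : ℝ → ℝ → E} {a b : ℝ}
    (hF : ∀ s, Continuous (F s)) (hF' : Continuous fun q : ℝ × ℝ => F' q.1 q.2)
    (hd : ∀ s θ, HasDerivAt (fun s => F s θ) (F' s θ) s) (s : ℝ) :
    HasDerivAt (fun s => ∫ θ in a..b, F s θ) (∫ θ in a..b, F' s θ) s := by
  obtain ⟨K, hK⟩ := ((isCompact_closedBall s 1).prod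
    (isCompact_uIcc (a := a) (b := b))).exists_bound_of_continuousOn hF'.continuousOn
  have hF's : Continuous (F' s) := hF'.comp (f := fun t : ℝ => (s, t)) (by fun_prop)
  exact (intervalIntegral.hasDerivAt_integral_of_dominated_loc_of_deriv_le
    (F := F) (F' := F') (x₀ := s) (bound := fun _ => K) (μ := volume)
    (closedBall_mem_nhds s one_pos)
    (Eventually.of_forall fun w => (hF w).aestronglyMeasurable)
    ((hF s).intervalIntegrable a b) hF's.aestronglyMeasurable
    (Eventually.of_forall fun t ht w hw => hK (w, t) ⟨hw, Set.uIoc_subset_uIcc ht⟩)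
    intervalIntegrable_const
    (Eventually.of_forall fun t _ w _ => hd w t)).2

/-- Integration over a disc in polar coordinates. -/
theorem integral_ball_eq_polar {f : ℂ → E} (hf : Continuous f) (c : ℂ) {R : ℝ} (hR : 0 ≤ R) :
    ∫ z in ball c R, f z =
      ∫ s in (0 : ℝ)..R, ∫ θ in (-π)..π, s • f (c + s * Complex.exp (θ * Complex.I)) := by
  have hcont : Continuous fun q : ℝ × ℝ => q.1 • f (c + q.1 * Complex.exp (q.2 * Complex.I)) := by
    fun_prop
  rw [← integral_indicator measurableSet_ball,
    ← integral_add_left_eq_self (μ := volume) _ c, ← Complex.integral_comp_polarCoord_symm,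
    polarCoord_target]
  have h1 : ∀ p ∈ Set.Ioi (0 : ℝ) ×ˢ Set.Ioo (-π) π,
      p.1 • (ball c R).indicator f (c + Complex.polarCoord.symm p) =
      (Set.Iio R ×ˢ (Set.univ : Set ℝ)).indicator
        (fun q : ℝ × ℝ => q.1 • f (c + q.1 * Complex.exp (q.2 * Complex.I))) p := by
    intro p hp
    have hp1 : 0 < p.1 := hp.1
    have h2 : Complex.polarCoord.symm p = p.1 * Complex.exp (p.2 * Complex.I) := by
      rw [Complex.polarCoord_symm_apply, Complex.exp_mul_I, Complex.ofReal_cos, Complex.ofReal_sin]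
    have h3 : c + Complex.polarCoord.symm p ∈ ball c R ↔
        p ∈ Set.Iio R ×ˢ (Set.univ : Set ℝ) := by
      rw [mem_ball, dist_eq_norm, add_sub_cancel_left, Complex.norm_polarCoord_symm, abs_of_pos hp1]
      simp
    by_cases h : p ∈ Set.Iio R ×ˢ (Set.univ : Set ℝ)
    · rw [Set.indicator_of_mem h, Set.indicator_of_mem (h3.2 h), h2]
    · rw [Set.indicator_of_notMem h, Set.indicator_of_notMem (fun h' => h (h3.1 h')), smul_zero]
  rw [setIntegral_congr_fun (measurableSet_Ioi.prod measurableSet_Ioo) h1,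
    setIntegral_indicator (measurableSet_Iio.prod MeasurableSet.univ), Set.prod_inter_prod,
    Set.inter_univ, Set.Ioi_inter_Iio, Measure.volume_eq_prod, setIntegral_prod]
  · rw [intervalIntegral.integral_of_le hR, integral_Ioc_eq_integral_Ioo]
    refine setIntegral_congr_fun measurableSet_Ioo fun s _ => ?_
    simp only
    rw [intervalIntegral.integral_of_le (by linarith [pi_pos]), integral_Ioc_eq_integral_Ioo]
  · rw [← Measure.volume_eq_prod]
    exact (hcont.continuousOn.integrableOn_compact (isCompact_Icc.prod isCompact_Icc)).mono_set
      (Set.prod_mono Set.Ioo_subset_Icc_self Set.Ioo_subset_Icc_self)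

end CircleIntegrals

/-- The integral of `V dz / i` over the circle of centre `c` and radius `s`. -/
def circleFlux (V : ℂ → ℂ) (c : ℂ) (s : ℝ) : ℂ :=
  ∫ θ in (-π)..π, s * Complex.exp (θ * Complex.I) * V (c + s * Complex.exp (θ * Complex.I))

theorem hasDerivAt_radius (c : ℂ) (s θ : ℝ) :
    HasDerivAt (fun s : ℝ => c + s * Complex.exp (θ * Complex.I)) (Complex.exp (θ * Complex.I)) s :=
  hasDerivAt_ray _ _ _

theorem hasDerivAt_exp_mul_I (θ : ℝ) : HasDerivAt (fun θ : ℝ => Complex.exp (θ * Complex.I))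
    (Complex.I * Complex.exp (θ * Complex.I)) θ := by
  have h := ((Complex.ofRealCLM.hasDerivAt (x := θ)).mul_const Complex.I).cexp
  simpa [mul_comm] using h

theorem conj_exp_mul_I (θ : ℝ) :
    Complex.exp (θ * Complex.I) * conj (Complex.exp (θ * Complex.I)) = 1 := by
  rw [Complex.mul_conj', Complex.norm_exp_ofReal_mul_I]
  simp

theorem hasDerivAt_circleFlux {V b g : ℂ → ℂ} (hV : ∀ z, HasWirtingerAt V (b z) (g z) z)
    (hb : Continuous b) (hg : Continuous g) (c : ℂ) (s : ℝ) :
    HasDerivAt (circleFlux V c)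
      (∫ θ in (-π)..π, 2 * (s • g (c + s * Complex.exp (θ * Complex.I)))) s := by
  have hVc : Continuous V := continuous_iff_continuousAt.2 fun z => (hV z).continuousAt
  set F' : ℝ → ℝ → ℂ := fun s θ =>
    Complex.exp (θ * Complex.I) * V (c + s * Complex.exp (θ * Complex.I)) +
      s * Complex.exp (θ * Complex.I) * (b (c + s * Complex.exp (θ * Complex.I)) *
        Complex.exp (θ * Complex.I) + g (c + s * Complex.exp (θ * Complex.I)) *
        conj (Complex.exp (θ * Complex.I))) with hF'
  have hF'c : Continuous fun q : ℝ × ℝ => F' q.1 q.2 := by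
    have : Continuous fun z : ℂ => conj z := Complex.continuous_conj
    fun_prop
  have key := hasDerivAt_intervalIntegral_of_continuous (a := -π) (b := π)
    (F := fun s θ => s * Complex.exp (θ * Complex.I) * V (c + s * Complex.exp (θ * Complex.I)))
    (F' := F') (fun s => by fun_prop) hF'c (fun s θ => by
      have h1 : HasDerivAt (fun s : ℝ => s * Complex.exp (θ * Complex.I))
          (Complex.exp (θ * Complex.I)) s := by
        simpa using hasDerivAt_radius 0 s θ
      have h2 := (hV _).comp_curve (γ := fun s : ℝ => c + s * Complex.exp (θ * Complex.I))
        (hasDerivAt_radius c s θ)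
      exact h1.mul h2) s
  refine key.congr_deriv ?_
  have htan : ∀ θ : ℝ, HasDerivAt (fun θ : ℝ => Complex.exp (θ * Complex.I) *
      V (c + s * Complex.exp (θ * Complex.I)))
      (Complex.I * (F' s θ - 2 * (s • g (c + s * Complex.exp (θ * Complex.I))))) θ := by
    intro θ
    have h1 := hasDerivAt_exp_mul_I θ
    have h2 := (hV _).comp_curve (γ := fun θ : ℝ => c + s * Complex.exp (θ * Complex.I))
      ((h1.const_mul (s : ℂ)).const_add c)
    refine (h1.mul h2).congr_deriv ?_
    have h3 := conj_exp_mul_I θ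
    simp only [hF', map_mul, Complex.conj_I, Complex.conj_ofReal, Complex.real_smul]
    linear_combination (-2 * Complex.I * s * g (c + s * Complex.exp (θ * Complex.I))) * h3
  have hgc : Continuous fun θ : ℝ => 2 * (s • g (c + s * Complex.exp (θ * Complex.I))) := by
    fun_prop
  have hF's : Continuous (F' s) := hF'c.comp (f := fun t : ℝ => (s, t)) (by fun_prop)
  have h4 := intervalIntegral.integral_eq_sub_of_hasDerivAt (a := -π) (b := π)
    (fun θ _ => htan θ)
    (Continuous.intervalIntegrable (by fun_prop) _ _)
  rw [intervalIntegral.integral_const_mul, intervalIntegral.integral_sub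
    (hF's.intervalIntegrable _ _) (hgc.intervalIntegrable _ _)] at h4
  have h5 : Complex.exp ((-π : ℝ) * Complex.I) = Complex.exp ((π : ℝ) * Complex.I) := by
    rw [← Complex.exp_periodic]
    congr 1
    push_cast
    ring
  rw [h5, sub_self] at h4
  exact sub_eq_zero.1 ((mul_eq_zero.1 h4).resolve_left Complex.I_ne_zero)

/-- The flux of `V` through a circle is twice the integral of `∂̄V` over the disc. -/
theorem circleFlux_eq {V b g : ℂ → ℂ} (hV : ∀ z, HasWirtingerAt V (b z) (g z) z)
    (hb : Continuous b) (hg : Continuous g) (c : ℂ) {R : ℝ} (hR : 0 ≤ R) :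
    circleFlux V c R = 2 * ∫ z in ball c R, g z := by
  have hc : Continuous fun s : ℝ => ∫ θ in (-π)..π,
      2 * (s • g (c + s * Complex.exp (θ * Complex.I))) :=
    intervalIntegral.continuous_parametric_intervalIntegral_of_continuous' (by fun_prop) _ _
  have h := intervalIntegral.integral_eq_sub_of_hasDerivAt (a := 0) (b := R)
    (fun s _ => hasDerivAt_circleFlux hV hb hg c s) (hc.intervalIntegrable _ _)
  have h0 : circleFlux V c 0 = 0 := by simp [circleFlux]
  rw [h0, sub_zero] at h
  rw [← h, integral_ball_eq_polar hg c hR, ← intervalIntegral.integral_const_mul]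
  simp only [intervalIntegral.integral_const_mul]

/-- The integral of `S` over the angle, on the circle of centre `c` and radius `s`. -/
def circleMean (S : ℂ → ℝ) (c : ℂ) (s : ℝ) : ℝ :=
  ∫ θ in (-π)..π, S (c + s * Complex.exp (θ * Complex.I))

section Subharmonic

variable {S g : ℂ → ℝ} {V b : ℂ → ℂ}

theorem hasDerivAt_circleMean
    (hS : ∀ z, HasWirtingerAt (fun x => (S x : ℂ)) (V z) (conj (V z)) z)
    (hV : ∀ z, HasWirtingerAt V (b z) (g z) z) (hb : Continuous b) (hg : Continuous g)
    (c : ℂ) {s : ℝ} (hs : 0 ≤ s) :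
    ∃ m : ℝ, HasDerivAt (circleMean S c) m s ∧ s * m = 4 * ∫ z in ball c s, g z := by
  have hSc : Continuous S := by
    have : Continuous fun x => (S x : ℂ) :=
      continuous_iff_continuousAt.2 fun z => (hS z).continuousAt
    exact Complex.continuous_re.comp this
  have hVc : Continuous V := continuous_iff_continuousAt.2 fun z => (hV z).continuousAt
  have hd : ∀ s θ : ℝ, HasDerivAt (fun s : ℝ => S (c + s * Complex.exp (θ * Complex.I)))
      (2 * (Complex.exp (θ * Complex.I) * V (c + s * Complex.exp (θ * Complex.I))).re) s := by
    intro s θ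
    have h1 := (hS _).comp_curve (γ := fun s : ℝ => c + s * Complex.exp (θ * Complex.I))
      (hasDerivAt_radius c s θ)
    have h2 := Complex.reCLM.hasFDerivAt.comp_hasDerivAt s h1
    refine h2.congr_deriv ?_
    rw [← map_mul]
    simp only [Complex.reCLM_apply, Complex.add_re, Complex.conj_re]
    rw [mul_comm (V _)]
    ring
  have hc1 : Continuous fun q : ℝ × ℝ => (2 * (Complex.exp (q.2 * Complex.I) *
      V (c + q.1 * Complex.exp (q.2 * Complex.I))).re) :=
    continuous_const.mul (Complex.continuous_re.comp (by fun_prop))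
  refine ⟨_, hasDerivAt_intervalIntegral_of_continuous
    (F := fun s θ : ℝ => S (c + s * Complex.exp (θ * Complex.I)))
    (F' := fun s θ : ℝ => 2 * (Complex.exp (θ * Complex.I) *
      V (c + s * Complex.exp (θ * Complex.I))).re) (fun s => by fun_prop) hc1 hd s, ?_⟩
  have hflux := circleFlux_eq hV hb (Complex.continuous_ofReal.comp hg) c hs
  have h3 : (circleFlux V c s).re = ∫ θ in (-π)..π, (s * Complex.exp (θ * Complex.I) *
      V (c + s * Complex.exp (θ * Complex.I))).re := by
    have hi : IntervalIntegrable (fun θ : ℝ => s * Complex.exp (θ * Complex.I) *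
        V (c + s * Complex.exp (θ * Complex.I))) volume (-π) π :=
      Continuous.intervalIntegrable (by fun_prop) _ _
    exact (Complex.reCLM.intervalIntegral_comp_comm hi).symm
  have h4 : (circleFlux V c s).re = 2 * ∫ z in ball c s, g z := by
    rw [hflux, show (∫ z in ball c s, (g z : ℂ)) = ((∫ z in ball c s, g z : ℝ) : ℂ) from
      integral_complex_ofReal, ← Complex.ofReal_ofNat, ← Complex.ofReal_mul, Complex.ofReal_re]
  rw [h3] at h4
  rw [← intervalIntegral.integral_const_mul,
    show (4 : ℝ) * ∫ z in ball c s, g z = 2 * (2 * ∫ z in ball c s, g z) by ring, ← h4,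
    ← intervalIntegral.integral_const_mul]
  refine intervalIntegral.integral_congr fun θ _ => ?_
  simp only [mul_assoc, Complex.re_ofReal_mul]
  ring

theorem continuousOn_circleMean
    (hS : ∀ z, HasWirtingerAt (fun x => (S x : ℂ)) (V z) (conj (V z)) z)
    (hV : ∀ z, HasWirtingerAt V (b z) (g z) z) (hb : Continuous b) (hg : Continuous g) (c : ℂ) :
    ContinuousOn (circleMean S c) (Set.Ici 0) := fun s hs => by
  obtain ⟨m, hm, -⟩ := hasDerivAt_circleMean hS hV hb hg c hs
  exact hm.continuousAt.continuousWithinAt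

theorem monotoneOn_circleMean
    (hS : ∀ z, HasWirtingerAt (fun x => (S x : ℂ)) (V z) (conj (V z)) z)
    (hV : ∀ z, HasWirtingerAt V (b z) (g z) z) (hb : Continuous b) (hg : Continuous g)
    (hg0 : ∀ z, 0 ≤ g z) (c : ℂ) : MonotoneOn (circleMean S c) (Set.Ici 0) := by
  refine monotoneOn_of_deriv_nonneg (convex_Ici 0) (continuousOn_circleMean hS hV hb hg c) ?_ ?_
  · intro s hs
    rw [interior_Ici] at hs
    obtain ⟨m, hm, -⟩ := hasDerivAt_circleMean hS hV hb hg c (le_of_lt hs)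
    exact hm.differentiableAt.differentiableWithinAt
  · intro s hs
    rw [interior_Ici] at hs
    obtain ⟨m, hm, hm'⟩ := hasDerivAt_circleMean hS hV hb hg c (le_of_lt hs)
    rw [hm.deriv]
    have : 0 ≤ s * m := by
      rw [hm']
      exact mul_nonneg (by norm_num) (integral_nonneg hg0)
    exact nonneg_of_mul_nonneg_right this hs

theorem circleMean_le_log
    (hS : ∀ z, HasWirtingerAt (fun x => (S x : ℂ)) (V z) (conj (V z)) z)
    (hV : ∀ z, HasWirtingerAt V (b z) (g z) z) (hb : Continuous b) (hg : Continuous g)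
    (hg0 : ∀ z, 0 ≤ g z) (hgi : Integrable g) (c : ℂ) {r : ℝ} (hr : 1 ≤ r) :
    circleMean S c r ≤ circleMean S c 1 + 4 * (∫ z, g z) * Real.log r := by
  have hpos : ∀ s ∈ interior (Set.Ici (1 : ℝ)), 0 < s := fun s hs => by
    rw [interior_Ici] at hs
    exact one_pos.trans hs
  have hd : ∀ s : ℝ, 0 < s → ∃ m, HasDerivAt (fun s => circleMean S c s -
      4 * (∫ z, g z) * Real.log s) m s ∧ m ≤ 0 := by
    intro s hs
    obtain ⟨m, hm, hm'⟩ := hasDerivAt_circleMean hS hV hb hg c hs.le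
    refine ⟨_, hm.sub ((Real.hasDerivAt_log hs.ne').const_mul _), ?_⟩
    have : ∫ z in ball c s, g z ≤ ∫ z, g z :=
      setIntegral_le_integral hgi (Eventually.of_forall hg0)
    rw [sub_nonpos, ← div_eq_mul_inv, le_div_iff₀ hs]
    linarith
  have hanti : AntitoneOn (fun s => circleMean S c s - 4 * (∫ z, g z) * Real.log s)
      (Set.Ici 1) := by
    refine antitoneOn_of_deriv_nonpos (convex_Ici 1) ?_ ?_ ?_
    · intro s hs
      obtain ⟨m, hm, -⟩ := hd s (one_pos.trans_le hs)
      exact hm.continuousAt.continuousWithinAt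
    · intro s hs
      obtain ⟨m, hm, -⟩ := hd s (hpos s hs)
      exact hm.differentiableAt.differentiableWithinAt
    · intro s hs
      obtain ⟨m, hm, hm'⟩ := hd s (hpos s hs)
      rwa [hm.deriv]
  have := hanti (Set.mem_Ici.2 le_rfl) (Set.mem_Ici.2 hr) hr
  simp only [Real.log_one, mul_zero, sub_zero] at this
  linarith

theorem integral_ball_eq_circleMean (hS : Continuous S) (c : ℂ) {R : ℝ} (hR : 0 ≤ R) :
    ∫ z in ball c R, S z = ∫ s in (0 : ℝ)..R, s * circleMean S c s := by
  rw [integral_ball_eq_polar hS c hR]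
  simp only [smul_eq_mul, intervalIntegral.integral_const_mul, circleMean]

/-- A subharmonic function with Laplacian of finite mass, bounded below in terms of its
Laplacian, grows at most logarithmically. -/
theorem exists_log_growth
    (hS : ∀ z, HasWirtingerAt (fun x => (S x : ℂ)) (V z) (conj (V z)) z)
    (hV : ∀ z, HasWirtingerAt V (b z) (g z) z) (hb : Continuous b) (hg : Continuous g)
    (hg0 : ∀ z, 0 ≤ g z) (hgi : Integrable g) {K L : ℝ} (hK : 0 ≤ K) (hL : 0 ≤ L)
    (hlow : ∀ z, - S z ≤ K + L * g z) :
    ∃ C N : ℝ, ∀ z, 1 ≤ ‖z‖ → S z ≤ C + N * Real.log ‖z‖ := by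
  have hSc : Continuous S := by
    have : Continuous fun x => (S x : ℂ) :=
      continuous_iff_continuousAt.2 fun z => (hS z).continuousAt
    exact Complex.continuous_re.comp this
  set I := ∫ z, g z with hI
  have hI0 : 0 ≤ I := integral_nonneg hg0
  have hint : ∀ c R, IntegrableOn S (ball c R) := fun c R =>
    (hSc.continuousOn.integrableOn_compact (isCompact_closedBall c R)).mono_set
      ball_subset_closedBall
  have hmint : ∀ c (R : ℝ), 0 ≤ R →
      IntervalIntegrable (fun s => s * circleMean S c s) volume 0 R := by
    intro c R hR
    apply ContinuousOn.intervalIntegrable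
    rw [Set.uIcc_of_le hR]
    exact continuousOn_id.mul
      ((continuousOn_circleMean hS hV hb hg c).mono Set.Icc_subset_Ici_self)
  have hlin : ∀ k R : ℝ, ∫ s in (0 : ℝ)..R, s * k = R ^ 2 / 2 * k := by
    intro k R
    rw [intervalIntegral.integral_mul_const, integral_id]
    ring
  have hsub : ∀ c (ρ : ℝ), 0 ≤ ρ → π * ρ ^ 2 * S c ≤ ∫ z in ball c ρ, S z := by
    intro c ρ hρ
    rw [integral_ball_eq_circleMean hSc c hρ]
    have h0 : circleMean S c 0 = 2 * π * S c := by
      rw [circleMean, Complex.ofReal_zero]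
      simp only [zero_mul, add_zero]
      rw [intervalIntegral.integral_const, smul_eq_mul]
      ring
    calc π * ρ ^ 2 * S c = ∫ s in (0 : ℝ)..ρ, s * (2 * π * S c) := by rw [hlin]; ring
      _ ≤ _ := by
        refine intervalIntegral.integral_mono_on hρ (Continuous.intervalIntegrable (by fun_prop) _ _)
          (hmint c ρ hρ) fun s hs => mul_le_mul_of_nonneg_left ?_ hs.1
        rw [← h0]
        exact monotoneOn_circleMean hS hV hb hg hg0 c (Set.mem_Ici.2 le_rfl) hs.1 hs.1
  have hup : ∀ R : ℝ, 1 ≤ R →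
      ∫ z in ball 0 R, S z ≤ R ^ 2 / 2 * (circleMean S 0 1 + 4 * I * Real.log R) := by
    intro R hR
    have hR0 : 0 ≤ R := by linarith
    rw [integral_ball_eq_circleMean hSc 0 hR0, ← hlin]
    refine intervalIntegral.integral_mono_on hR0 (hmint 0 R hR0)
      (Continuous.intervalIntegrable (by fun_prop) _ _)
      fun s hs => mul_le_mul_of_nonneg_left ?_ hs.1
    exact (monotoneOn_circleMean hS hV hb hg hg0 0 hs.1 (Set.mem_Ici.2 hR0) hs.2).trans
      (circleMean_le_log hS hV hb hg hg0 hgi 0 hR)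
  refine ⟨2 / π * (circleMean S 0 1 + 4 * I * Real.log 2) + 4 * K + L * I / π,
    2 / π * (4 * I), fun z hz => ?_⟩
  set ρ := ‖z‖ with hρ
  have hρ0 : 0 < ρ := by linarith
  set T : ℂ → ℝ := fun x => S x + (K + L * g x) with hT
  have hTi : ∀ c R, IntegrableOn T (ball c R) := fun c R =>
    (hint c R).add ((integrableOn_const (by
      exact measure_ball_lt_top.ne)).add (hgi.integrableOn.const_mul L))
  have h1 : ∫ x in ball z ρ, S x ≤ ∫ x in ball 0 (2 * ρ), T x := by
    calc ∫ x in ball z ρ, S x ≤ ∫ x in ball z ρ, T x :=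
          setIntegral_mono (hint z ρ) (hTi z ρ) fun x => by
            have := mul_nonneg hL (hg0 x)
            simp only [hT]
            linarith
      _ ≤ ∫ x in ball 0 (2 * ρ), T x := by
        refine setIntegral_mono_set (hTi 0 (2 * ρ)) (Eventually.of_forall fun x => ?_)
          (Eventually.of_forall fun x (hx : x ∈ ball z ρ) => ?_)
        · have := hlow x
          simp only [hT, Pi.zero_apply]
          linarith
        · rw [mem_ball, dist_eq_norm] at hx
          change x ∈ ball 0 (2 * ρ)
          rw [mem_ball, dist_eq_norm, sub_zero]
          have := norm_add_le (x - z) z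
          rw [sub_add_cancel] at this
          linarith
  have h2 : ∫ x in ball 0 (2 * ρ), T x ≤ (∫ x in ball 0 (2 * ρ), S x) +
      (K * (π * (2 * ρ) ^ 2) + L * I) := by
    have hKi : IntegrableOn (fun _ : ℂ => K) (ball 0 (2 * ρ)) :=
      integrableOn_const measure_ball_lt_top.ne
    have hLi : IntegrableOn (fun x : ℂ => L * g x) (ball 0 (2 * ρ)) :=
      hgi.integrableOn.const_mul L
    simp only [hT]
    rw [integral_add (g := fun x => K + L * g x) (hint 0 (2 * ρ)) (hKi.add hLi),
      integral_add hKi hLi, integral_const_mul, setIntegral_const]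
    have h3 : volume.real (ball (0 : ℂ) (2 * ρ)) = π * (2 * ρ) ^ 2 := by
      rw [Measure.real, Complex.volume_ball, ENNReal.toReal_mul, ENNReal.toReal_pow,
        ENNReal.toReal_ofReal (by linarith)]
      simp
      ring
    have h4 : ∫ x in ball 0 (2 * ρ), g x ≤ I :=
      setIntegral_le_integral hgi (Eventually.of_forall hg0)
    rw [h3, smul_eq_mul, mul_comm _ K]
    have := mul_le_mul_of_nonneg_left h4 hL
    linarith
  have h5 := hsub z ρ hρ0.le
  have h6 := hup (2 * ρ) (by linarith)
  rw [Real.log_mul two_ne_zero hρ0.ne'] at h6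
  have h7 : π * ρ ^ 2 * S z ≤ π * ρ ^ 2 * (2 / π * (circleMean S 0 1 + 4 * I *
      (Real.log 2 + Real.log ρ)) + 4 * K) + L * I := by
    have : π * ρ ^ 2 * (2 / π * (circleMean S 0 1 + 4 * I *
      (Real.log 2 + Real.log ρ)) + 4 * K) = (2 * ρ) ^ 2 / 2 * (circleMean S 0 1 + 4 * I *
      (Real.log 2 + Real.log ρ)) + K * (π * (2 * ρ) ^ 2) := by
      field_simp
      ring
    rw [this]
    linarith
  have h8 : L * I ≤ π * ρ ^ 2 * (L * I / π) := by
    have : π * ρ ^ 2 * (L * I / π) = ρ ^ 2 * (L * I) := by field_simp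
    rw [this]
    have : 1 ≤ ρ ^ 2 := one_le_pow₀ hz
    nlinarith [mul_nonneg hL hI0]
  have h9 : π * ρ ^ 2 * S z ≤ π * ρ ^ 2 * (2 / π * (circleMean S 0 1 + 4 * I *
      (Real.log 2 + Real.log ρ)) + 4 * K + L * I / π) := by linarith
  have h10 := le_of_mul_le_mul_left h9 (by positivity)
  refine h10.trans (le_of_eq ?_)
  ring

end Subharmonic

/-- The logarithmic derivative `∂F / F` of `F = |P|² + |Q|²`. -/
def logNormDeriv (P Q : ℂ → ℂ) (z : ℂ) : ℂ :=
  (deriv P z * conj (P z) + deriv Q z * conj (Q z)) / (P z * conj (P z) + Q z * conj (Q z))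

/-- The density `|P Q' - P' Q|² / (|P|² + |Q|²)²` of the pull-back of the spherical metric. -/
def sphericalDensity (P Q : ℂ → ℂ) (z : ℂ) : ℝ :=
  ‖wronskian P Q z‖ ^ 2 / (‖P z‖ ^ 2 + ‖Q z‖ ^ 2) ^ 2

theorem mul_conj_add_mul_conj (p q : ℂ) :
    p * conj p + q * conj q = ((‖p‖ ^ 2 + ‖q‖ ^ 2 : ℝ) : ℂ) := by
  rw [Complex.mul_conj', Complex.mul_conj']
  push_cast
  rfl

section Entire

variable {P Q : ℂ → ℂ}

theorem hasWirtingerAt_log_norm_sq (hP : Differentiable ℂ P) (hQ : Differentiable ℂ Q) {z : ℂ}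
    (h0 : 0 < ‖P z‖ ^ 2 + ‖Q z‖ ^ 2) :
    HasWirtingerAt (fun x => ((Real.log (‖P x‖ ^ 2 + ‖Q x‖ ^ 2) : ℝ) : ℂ))
      (logNormDeriv P Q z) (conj (logNormDeriv P Q z)) z := by
  have hF := hasWirtingerAt_sum_mul_conj (hP z).hasDerivAt (hQ z).hasDerivAt (hP z).hasDerivAt
    (hQ z).hasDerivAt
  have hs : P z * conj (P z) + Q z * conj (Q z) ∈ Complex.slitPlane := by
    rw [mul_conj_add_mul_conj]
    exact Complex.ofReal_mem_slitPlane.2 h0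
  have hl := HasWirtingerAt.hasDerivAt_comp
    (f := fun x => P x * conj (P x) + Q x * conj (Q x)) (Complex.hasDerivAt_log hs) hF
  have he : (fun x => ((Real.log (‖P x‖ ^ 2 + ‖Q x‖ ^ 2) : ℝ) : ℂ)) =
      fun x => Complex.log (P x * conj (P x) + Q x * conj (Q x)) := by
    funext x
    rw [mul_conj_add_mul_conj, Complex.ofReal_log (by positivity)]
  rw [he]
  refine hl.congr_deriv ?_ ?_
  · rw [logNormDeriv, div_eq_inv_mul]
  · rw [logNormDeriv, div_eq_inv_mul]
    simp only [map_mul, map_add, map_inv₀, Complex.conj_conj]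
    ring

theorem hasWirtingerAt_logNormDeriv (hP : Differentiable ℂ P) (hQ : Differentiable ℂ Q) {z : ℂ}
    (h0 : 0 < ‖P z‖ ^ 2 + ‖Q z‖ ^ 2) :
    HasWirtingerAt (logNormDeriv P Q)
      (((deriv (deriv P) z * conj (P z) + deriv (deriv Q) z * conj (Q z)) *
        (P z * conj (P z) + Q z * conj (Q z)) -
        (deriv P z * conj (P z) + deriv Q z * conj (Q z)) ^ 2) /
        (P z * conj (P z) + Q z * conj (Q z)) ^ 2) (sphericalDensity P Q z) z := by
  have hF := hasWirtingerAt_sum_mul_conj (hP z).hasDerivAt (hQ z).hasDerivAt (hP z).hasDerivAt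
    (hQ z).hasDerivAt
  have hG := hasWirtingerAt_sum_mul_conj (hP.deriv z).hasDerivAt (hQ.deriv z).hasDerivAt
    (hP z).hasDerivAt (hQ z).hasDerivAt
  have hs : P z * conj (P z) + Q z * conj (Q z) ≠ 0 := by
    rw [mul_conj_add_mul_conj]
    exact_mod_cast h0.ne'
  refine (hG.div hF hs).congr_deriv (by ring) ?_
  rw [sphericalDensity, Complex.ofReal_div, Complex.ofReal_pow, Complex.ofReal_pow,
    ← mul_conj_add_mul_conj, ← Complex.mul_conj', wronskian]
  simp only [map_mul, map_sub]
  congr 1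
  ring

theorem continuous_sphericalDensity (hP : Differentiable ℂ P) (hQ : Differentiable ℂ Q)
    (h0 : ∀ z, 0 < ‖P z‖ ^ 2 + ‖Q z‖ ^ 2) : Continuous (sphericalDensity P Q) := by
  have h1 := hP.continuous
  have h2 := hQ.continuous
  have h3 := hP.deriv.continuous
  have h4 := hQ.deriv.continuous
  unfold sphericalDensity wronskian
  exact Continuous.div (by fun_prop) (by fun_prop) fun z => (pow_pos (h0 z) 2).ne'

theorem continuous_deriv_logNormDeriv (hP : Differentiable ℂ P) (hQ : Differentiable ℂ Q)
    (h0 : ∀ z, 0 < ‖P z‖ ^ 2 + ‖Q z‖ ^ 2) : Continuous fun z =>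
      ((deriv (deriv P) z * conj (P z) + deriv (deriv Q) z * conj (Q z)) *
        (P z * conj (P z) + Q z * conj (Q z)) -
        (deriv P z * conj (P z) + deriv Q z * conj (Q z)) ^ 2) /
        (P z * conj (P z) + Q z * conj (Q z)) ^ 2 := by
  have h1 := hP.continuous
  have h2 := hQ.continuous
  have h3 := hP.deriv.continuous
  have h4 := hQ.deriv.continuous
  have h5 := hP.deriv.deriv.continuous
  have h6 := hQ.deriv.deriv.continuous
  have h7 : Continuous fun z => conj (P z) := Complex.continuous_conj.comp h1
  have h8 : Continuous fun z => conj (Q z) := Complex.continuous_conj.comp h2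
  refine Continuous.div (by fun_prop) (by fun_prop) fun z => pow_ne_zero 2 ?_
  rw [mul_conj_add_mul_conj]
  exact_mod_cast (h0 z).ne'

theorem circleFlux_logNormDeriv (hP : Differentiable ℂ P) (hQ : Differentiable ℂ Q)
    (h0 : ∀ z, 0 < ‖P z‖ ^ 2 + ‖Q z‖ ^ 2) {R : ℝ} (hR : 0 ≤ R) :
    circleFlux (logNormDeriv P Q) 0 R =
      ((2 * ∫ z in ball (0 : ℂ) R, sphericalDensity P Q z : ℝ) : ℂ) := by
  rw [circleFlux_eq (fun z => hasWirtingerAt_logNormDeriv hP hQ (h0 z))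
    (continuous_deriv_logNormDeriv hP hQ h0)
    (Complex.continuous_ofReal.comp (continuous_sphericalDensity hP hQ h0)) 0 hR,
    show (∫ z in ball (0 : ℂ) R, (sphericalDensity P Q z : ℂ)) =
      ((∫ z in ball (0 : ℂ) R, sphericalDensity P Q z : ℝ) : ℂ) from integral_complex_ofReal]
  push_cast
  rfl

theorem exists_polynomial_of_growth {f : ℂ → ℂ} (hf : Differentiable ℂ f) {A : ℝ} {n : ℕ}
    (h : ∀ z, 1 ≤ ‖z‖ → ‖f z‖ ≤ A * ‖z‖ ^ n) : ∃ p : Polynomial ℂ, ∀ z, f z = p.eval z := by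
  have hk : ∀ k, n < k → iteratedDeriv k f 0 = 0 := by
    intro k hk
    have hb : ∀ R : ℝ, 1 ≤ R → ‖iteratedDeriv k f 0‖ ≤ k.factorial * A / R := by
      intro R hR
      have hR0 : 0 < R := by linarith
      have hA : 0 ≤ A := by
        have := (norm_nonneg _).trans (h 1 (by simp))
        simpa using this
      refine (Complex.norm_iteratedDeriv_le_of_forall_mem_sphere_norm_le k hR0 hf.diffContOnCl
        (C := A * R ^ n) fun z hz => ?_).trans ?_
      · have hz' : ‖z‖ = R := by simpa using hz
        have := h z (by rw [hz']; exact hR)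
        rwa [hz'] at this
      · rw [div_le_div_iff₀ (by positivity) hR0]
        have : R ^ n * R ≤ R ^ k := by
          rw [← pow_succ]
          exact pow_le_pow_right₀ hR hk
        calc (k.factorial : ℝ) * (A * R ^ n) * R = k.factorial * A * (R ^ n * R) := by ring
          _ ≤ _ := by gcongr
    have ht : Tendsto (fun R : ℝ => k.factorial * A / R) atTop (𝓝 0) :=
      tendsto_const_nhds.div_atTop tendsto_id
    have := ge_of_tendsto ht ((eventually_ge_atTop 1).mono hb)
    exact norm_le_zero_iff.1 this
  refine ⟨∑ k ∈ Finset.range (n + 1),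
    Polynomial.C ((k.factorial : ℂ)⁻¹ * iteratedDeriv k f 0) * Polynomial.X ^ k, fun z => ?_⟩
  have h1 := Complex.hasSum_taylorSeries_of_entire hf 0 z
  have h2 := hasSum_sum_of_ne_finset_zero (L := SummationFilter.unconditional ℕ)
    (s := Finset.range (n + 1))
    (f := fun k : ℕ => (k.factorial : ℂ)⁻¹ • (z - 0) ^ k • iteratedDeriv k f 0) fun k hk' => by
      rw [hk k (by simpa using hk')]
      simp
  rw [h1.unique h2, Polynomial.eval_finsetSum]
  refine Finset.sum_congr rfl fun k _ => ?_
  simp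
  ring

/-- Entire functions whose spherical density is integrable and whose Wronskian is bounded below
near infinity are polynomials. -/
theorem exists_polynomials (hP : Differentiable ℂ P) (hQ : Differentiable ℂ Q)
    (h0 : ∀ z, 0 < ‖P z‖ ^ 2 + ‖Q z‖ ^ 2) (hg : Integrable (sphericalDensity P Q))
    {δ R₀ : ℝ} (hδ : 0 < δ) (hw : ∀ z, R₀ ≤ ‖z‖ → δ ≤ ‖wronskian P Q z‖) :
    ∃ p q : Polynomial ℂ, (∀ z, P z = p.eval z) ∧ ∀ z, Q z = q.eval z := by
  set S : ℂ → ℝ := fun z => Real.log (‖P z‖ ^ 2 + ‖Q z‖ ^ 2) with hS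
  have hSc : Continuous S := by
    have h1 := hP.continuous
    have h2 := hQ.continuous
    exact Continuous.log (by fun_prop) fun z => (h0 z).ne'
  obtain ⟨K, hK⟩ := (isCompact_closedBall (0 : ℂ) R₀).exists_bound_of_continuousOn
    hSc.continuousOn
  have hg0 : ∀ z, 0 ≤ sphericalDensity P Q z := fun z => by unfold sphericalDensity; positivity
  have hlow : ∀ z, - S z ≤ max K 0 + (1 / δ ^ 2) * sphericalDensity P Q z := by
    intro z
    rcases le_total R₀ ‖z‖ with hz | hz
    · have h1 : - S z ≤ 1 / (‖P z‖ ^ 2 + ‖Q z‖ ^ 2) ^ 2 := by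
        have h2 : -(2 * S z) ≤ Real.exp (-(2 * S z)) := by
          linarith [Real.add_one_le_exp (-(2 * S z))]
        have h3 : Real.exp (-(2 * S z)) = 1 / (‖P z‖ ^ 2 + ‖Q z‖ ^ 2) ^ 2 := by
          rw [Real.exp_neg, two_mul, Real.exp_add, hS, Real.exp_log (h0 z), one_div,
            ← sq]
        rw [h3] at h2
        have h4 : 0 ≤ 1 / (‖P z‖ ^ 2 + ‖Q z‖ ^ 2) ^ 2 := by positivity
        linarith
      have h5 : 1 / (‖P z‖ ^ 2 + ‖Q z‖ ^ 2) ^ 2 ≤ (1 / δ ^ 2) * sphericalDensity P Q z := by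
        rw [sphericalDensity, div_mul_div_comm, one_mul,
          div_le_div_iff₀ (pow_pos (h0 z) 2) (mul_pos (pow_pos hδ 2) (pow_pos (h0 z) 2))]
        have h6 : δ ^ 2 ≤ ‖wronskian P Q z‖ ^ 2 := pow_le_pow_left₀ hδ.le (hw z hz) 2
        nlinarith [pow_pos (h0 z) 2]
      linarith [le_max_right K 0]
    · have h1 := hK z (by simpa using hz)
      have h2 : 0 ≤ (1 / δ ^ 2) * sphericalDensity P Q z := mul_nonneg (by positivity) (hg0 z)
      have h3 := neg_abs_le (S z)
      rw [Real.norm_eq_abs] at h1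
      linarith [le_max_left K 0]
  obtain ⟨C, N, hCN⟩ := exists_log_growth (fun z => hasWirtingerAt_log_norm_sq hP hQ (h0 z))
    (fun z => hasWirtingerAt_logNormDeriv hP hQ (h0 z)) (continuous_deriv_logNormDeriv hP hQ h0)
    (continuous_sphericalDensity hP hQ h0) hg0 hg (le_max_right K 0) (by positivity) hlow
  obtain ⟨n, hn⟩ := exists_nat_ge N
  have hgr : ∀ z, 1 ≤ ‖z‖ → ‖P z‖ ^ 2 + ‖Q z‖ ^ 2 ≤ Real.exp C * ‖z‖ ^ n := by
    intro z hz
    have hz0 : 0 < ‖z‖ := by linarith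
    have h1 : S z ≤ C + n * Real.log ‖z‖ :=
      (hCN z hz).trans (by gcongr; exact Real.log_nonneg hz)
    calc ‖P z‖ ^ 2 + ‖Q z‖ ^ 2 = Real.exp (S z) := (Real.exp_log (h0 z)).symm
      _ ≤ Real.exp (C + n * Real.log ‖z‖) := Real.exp_le_exp.2 h1
      _ = _ := by rw [Real.exp_add, Real.exp_nat_mul, Real.exp_log hz0]
  have hx : ∀ x : ℝ, x ≤ 1 + x ^ 2 := fun x => by nlinarith [sq_nonneg (x - 1 / 2)]
  have hP' : ∀ z, 1 ≤ ‖z‖ → ‖P z‖ ≤ (1 + Real.exp C) * ‖z‖ ^ n := fun z hz => by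
    have := hgr z hz
    have h1 : 1 ≤ ‖z‖ ^ n := one_le_pow₀ hz
    nlinarith [hx ‖P z‖, sq_nonneg ‖Q z‖]
  have hQ' : ∀ z, 1 ≤ ‖z‖ → ‖Q z‖ ≤ (1 + Real.exp C) * ‖z‖ ^ n := fun z hz => by
    have := hgr z hz
    have h1 : 1 ≤ ‖z‖ ^ n := one_le_pow₀ hz
    nlinarith [hx ‖Q z‖, sq_nonneg ‖P z‖]
  obtain ⟨p, hp⟩ := exists_polynomial_of_growth hP hP'
  obtain ⟨q, hq⟩ := exists_polynomial_of_growth hQ hQ'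
  exact ⟨p, q, hp, hq⟩

end Entire

theorem Polynomial.tendsto_eval_div_pow (p : Polynomial ℂ) {d : ℕ} (hd : p.natDegree ≤ d) :
    Tendsto (fun z : ℂ => p.eval z / z ^ d) (Bornology.cobounded ℂ) (𝓝 (p.coeff d)) := by
  have h1 : Tendsto (fun z : ℂ => (p.reflect d).eval z⁻¹) (Bornology.cobounded ℂ)
      (𝓝 ((p.reflect d).eval 0)) :=
    (p.reflect d).continuous.continuousAt.tendsto.comp tendsto_inv₀_cobounded
  rw [← Polynomial.coeff_zero_eq_eval_zero, Polynomial.coeff_reflect,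
    Polynomial.revAt_le (Nat.zero_le d), Nat.sub_zero] at h1
  refine h1.congr' ?_
  filter_upwards [(Bornology.eventually_ne_cobounded (0 : ℂ))] with z hz
  let _ := invertibleOfNonzero hz
  have := Polynomial.eval₂_reflect_mul_pow (RingHom.id ℂ) z d p hd
  rw [invOf_eq_inv, Polynomial.eval₂_id, Polynomial.eval₂_id] at this
  rw [← this, mul_div_cancel_right₀ _ (pow_ne_zero d hz)]

/-- For polynomials `p, q` with larger degree `d`, `z ∂F / F → d` at infinity. -/
theorem tendsto_mul_logNormDeriv {p q : Polynomial ℂ} (h : p ≠ 0 ∨ q ≠ 0) :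
    Tendsto (fun z : ℂ => z * logNormDeriv (fun x => p.eval x) (fun x => q.eval x) z)
      (Bornology.cobounded ℂ) (𝓝 (max p.natDegree q.natDegree : ℕ)) := by
  set d := max p.natDegree q.natDegree with hd
  have key : ∀ r : Polynomial ℂ, r.natDegree ≤ d →
      Tendsto (fun z : ℂ => z * (r.derivative).eval z / z ^ d) (Bornology.cobounded ℂ)
        (𝓝 (d * r.coeff d)) := by
    intro r hr
    have h1 : (Polynomial.X * r.derivative).natDegree ≤ d := by
      rcases Nat.eq_zero_or_pos r.natDegree with h0 | h0
      · rw [Polynomial.derivative_of_natDegree_zero h0]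
        simp
      · refine Polynomial.natDegree_mul_le.trans ?_
        have := Polynomial.natDegree_derivative_lt h0.ne'
        simp only [Polynomial.natDegree_X]
        omega
    have h2 := Polynomial.tendsto_eval_div_pow _ h1
    have h3 : (Polynomial.X * r.derivative).coeff d = d * r.coeff d := by
      rcases d with _ | k
      · simp
      · rw [Polynomial.coeff_X_mul, Polynomial.coeff_derivative]
        push_cast
        ring
    rw [h3] at h2
    simpa using h2
  have hp := le_max_left p.natDegree q.natDegree
  have hq := le_max_right p.natDegree q.natDegree
  have p0 := Polynomial.tendsto_eval_div_pow p hp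
  have q0 := Polynomial.tendsto_eval_div_pow q hq
  have p1 := key p hp
  have q1 := key q hq
  rw [← hd] at p0 q0
  have pc := (Complex.continuous_conj.tendsto _).comp p0
  have qc := (Complex.continuous_conj.tendsto _).comp q0
  have hne : p.coeff d * conj (p.coeff d) + q.coeff d * conj (q.coeff d) ≠ 0 := by
    rw [mul_conj_add_mul_conj]
    have : p.coeff d ≠ 0 ∨ q.coeff d ≠ 0 := by
      rcases le_total p.natDegree q.natDegree with hle | hle
      · have hdq : d = q.natDegree := max_eq_right hle
        rcases eq_or_ne q 0 with rfl | hq0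
        · left
          have hp0 : p ≠ 0 := by simpa using h
          have : d = p.natDegree := by simp at hle; simp [hd, hle]
          rw [this]
          exact Polynomial.leadingCoeff_ne_zero.2 hp0
        · right
          rw [hdq]
          exact Polynomial.leadingCoeff_ne_zero.2 hq0
      · have hdp : d = p.natDegree := max_eq_left hle
        rcases eq_or_ne p 0 with rfl | hp0
        · right
          have hq0 : q ≠ 0 := by simpa using h
          have : d = q.natDegree := by simp at hle; simp [hd, hle]
          rw [this]
          exact Polynomial.leadingCoeff_ne_zero.2 hq0
        · left
          rw [hdp]
          exact Polynomial.leadingCoeff_ne_zero.2 hp0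
    have : 0 < ‖p.coeff d‖ ^ 2 + ‖q.coeff d‖ ^ 2 := by
      rcases this with h | h
      · have := norm_pos_iff.2 h
        positivity
      · have := norm_pos_iff.2 h
        positivity
    exact_mod_cast this.ne'
  have hlim := ((p1.mul pc).add (q1.mul qc)).div ((p0.mul pc).add (q0.mul qc)) hne
  have hval : (d * p.coeff d * conj (p.coeff d) + d * q.coeff d * conj (q.coeff d)) /
      (p.coeff d * conj (p.coeff d) + q.coeff d * conj (q.coeff d)) = (d : ℂ) := by
    rw [div_eq_iff hne]
    ring
  rw [hval] at hlim
  refine hlim.congr' ?_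
  filter_upwards [Bornology.eventually_ne_cobounded (0 : ℂ)] with z hz
  have hzd : z ^ d ≠ 0 := pow_ne_zero _ hz
  have hcd : conj (z ^ d) ≠ 0 := by rwa [Ne, map_eq_zero]
  simp only [Function.comp_apply, Pi.div_apply, map_div₀, logNormDeriv,
    Polynomial.deriv]
  rw [div_mul_div_comm, div_mul_div_comm, div_mul_div_comm, div_mul_div_comm, ← add_div,
    ← add_div, div_div_div_cancel_right₀ (mul_ne_zero hzd hcd), mul_div_assoc']
  congr 1
  ring

theorem tendsto_circleFlux {V : ℂ → ℂ} (hV : Continuous V) {m : ℂ}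
    (h : Tendsto (fun z => z * V z) (Bornology.cobounded ℂ) (𝓝 m)) :
    Tendsto (circleFlux V 0) atTop (𝓝 (2 * π * m)) := by
  rw [Metric.tendsto_nhds]
  intro ε hε
  have h1 := (Metric.tendsto_nhds.1 h) (ε / (4 * π)) (by positivity)
  rw [← comap_norm_atTop, eventually_comap] at h1
  filter_upwards [h1, eventually_ge_atTop 0] with R hR hR0
  have hn : ∀ θ : ℝ, ‖(R : ℂ) * Complex.exp (θ * Complex.I)‖ = R := fun θ => by
    rw [norm_mul, Complex.norm_exp_ofReal_mul_I, mul_one, Complex.norm_real, Real.norm_eq_abs,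
      abs_of_nonneg hR0]
  have h2 : circleFlux V 0 R - 2 * π * m = ∫ θ in (-π)..π,
      (R * Complex.exp (θ * Complex.I) * V (0 + R * Complex.exp (θ * Complex.I)) - m) := by
    rw [intervalIntegral.integral_sub (Continuous.intervalIntegrable (by fun_prop) _ _)
      intervalIntegrable_const, intervalIntegral.integral_const, circleFlux, Complex.real_smul]
    push_cast
    ring
  rw [dist_eq_norm, h2]
  refine (intervalIntegral.norm_integral_le_of_norm_le_const (C := ε / (4 * π))
    fun θ _ => ?_).trans_lt ?_
  · have := hR _ (hn θ)
    rw [dist_eq_norm] at this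
    rw [zero_add]
    exact this.le
  · rw [sub_neg_eq_add, abs_of_pos (by positivity)]
    have : ε / (4 * π) * (π + π) = ε / 2 := by field_simp; ring
    rw [this]
    linarith

/-- The spherical area of the image of a pair of polynomials is `π` times the degree. -/
theorem integral_sphericalDensity {p q : Polynomial ℂ}
    (h0 : ∀ z, 0 < ‖p.eval z‖ ^ 2 + ‖q.eval z‖ ^ 2)
    (hi : Integrable (sphericalDensity (fun x => p.eval x) (fun x => q.eval x))) :
    ∫ z, sphericalDensity (fun x => p.eval x) (fun x => q.eval x) z =
      π * (max p.natDegree q.natDegree : ℕ) := by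
  have hne : p ≠ 0 ∨ q ≠ 0 := by
    by_contra! h
    have := h0 0
    simp [h.1, h.2] at this
  have hVc : Continuous (logNormDeriv (fun x => p.eval x) (fun x => q.eval x)) :=
    continuous_iff_continuousAt.2 fun z =>
      (hasWirtingerAt_logNormDeriv p.differentiable q.differentiable (h0 z)).continuousAt
  have h1 := tendsto_circleFlux hVc (tendsto_mul_logNormDeriv hne)
  have h2 := (aecover_ball (μ := (volume : Measure ℂ)) (x := (0 : ℂ))
    (tendsto_id (α := ℝ) (x := atTop))).integral_tendsto_of_countably_generated hi
  have h3 : Tendsto (circleFlux (logNormDeriv (fun x => p.eval x) (fun x => q.eval x)) 0) atTop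
      (𝓝 ((2 * ∫ z, sphericalDensity (fun x => p.eval x) (fun x => q.eval x) z : ℝ) : ℂ)) := by
    refine ((Complex.continuous_ofReal.tendsto _).comp (h2.const_mul 2)).congr' ?_
    filter_upwards [eventually_ge_atTop 0] with R hR
    rw [circleFlux_logNormDeriv p.differentiable q.differentiable h0 hR]
    rfl
  have h4 := tendsto_nhds_unique h1 h3
  have h5 : 2 * π * (max p.natDegree q.natDegree : ℕ) =
      2 * ∫ z, sphericalDensity (fun x => p.eval x) (fun x => q.eval x) z := by
    apply Complex.ofReal_injective
    simpa [-Nat.cast_max] using h4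
  linarith

theorem natDegree_wronskian_of_lt {p q : Polynomial ℂ} (h : q.natDegree < p.natDegree)
    (hw : p.wronskian q ≠ 0) :
    (p.wronskian q).natDegree + 1 = p.natDegree + q.natDegree := by
  have hp0 : p ≠ 0 := by
    rintro rfl
    simp at h
  have hq0 : q ≠ 0 := by
    rintro rfl
    simp at hw
  have hX : ∀ r : Polynomial ℂ, (Polynomial.X * r.derivative).natDegree ≤ r.natDegree := by
    intro r
    rcases Nat.eq_zero_or_pos r.natDegree with h0 | h0
    · rw [Polynomial.derivative_of_natDegree_zero h0]
      simp
    · refine Polynomial.natDegree_mul_le.trans ?_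
      have := Polynomial.natDegree_derivative_lt h0.ne'
      simp only [Polynomial.natDegree_X]
      omega
  have hXc : ∀ (r : Polynomial ℂ) (d : ℕ), (Polynomial.X * r.derivative).coeff d = d * r.coeff d := by
    intro r d
    rcases d with _ | k
    · simp
    · rw [Polynomial.coeff_X_mul, Polynomial.coeff_derivative]
      push_cast
      ring
  have he : Polynomial.X * p.wronskian q =
      p * (Polynomial.X * q.derivative) - (Polynomial.X * p.derivative) * q := by
    rw [Polynomial.wronskian]
    ring
  have hc : (Polynomial.X * p.wronskian q).coeff (p.natDegree + q.natDegree) ≠ 0 := by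
    rw [he, Polynomial.coeff_sub, Polynomial.coeff_mul_add_eq_of_natDegree_le le_rfl (hX q),
      Polynomial.coeff_mul_add_eq_of_natDegree_le (hX p) le_rfl, hXc, hXc]
    have h1 : p.leadingCoeff ≠ 0 := Polynomial.leadingCoeff_ne_zero.2 hp0
    have h2 : q.leadingCoeff ≠ 0 := Polynomial.leadingCoeff_ne_zero.2 hq0
    have h3 : ((q.natDegree : ℂ) - p.natDegree) ≠ 0 := by
      rw [sub_ne_zero]
      exact_mod_cast h.ne
    have : p.leadingCoeff * q.leadingCoeff * ((q.natDegree : ℂ) - p.natDegree) ≠ 0 :=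
      mul_ne_zero (mul_ne_zero h1 h2) h3
    intro h4
    apply this
    rw [← h4]
    simp only [Polynomial.leadingCoeff]
    ring
  have hd : (Polynomial.X * p.wronskian q).natDegree ≤ p.natDegree + q.natDegree := by
    rw [he]
    refine (Polynomial.natDegree_sub_le _ _).trans (max_le ?_ ?_)
    · exact Polynomial.natDegree_mul_le.trans (by gcongr; exact hX q)
    · exact Polynomial.natDegree_mul_le.trans (by gcongr; exact hX p)
  have h5 := le_antisymm hd (Polynomial.le_natDegree_of_ne_zero hc)
  rwa [Polynomial.natDegree_X_mul hw] at h5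

theorem natDegree_wronskian_bounds {p q : Polynomial ℂ} (hw : p.wronskian q ≠ 0) :
    max p.natDegree q.natDegree ≤ (p.wronskian q).natDegree + 1 ∧
      (p.wronskian q).natDegree + 2 ≤ 2 * max p.natDegree q.natDegree := by
  rcases lt_trichotomy q.natDegree p.natDegree with h | h | h
  · have := natDegree_wronskian_of_lt h hw
    rw [max_eq_left h.le]
    omega
  · set r := Polynomial.C p.leadingCoeff * q - Polynomial.C q.leadingCoeff * p with hr
    have hp0 : p ≠ 0 := by
      rintro rfl
      simp at hw
    have hl : p.leadingCoeff ≠ 0 := Polynomial.leadingCoeff_ne_zero.2 hp0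
    have hwr : p.wronskian r = Polynomial.C p.leadingCoeff * p.wronskian q := by
      simp only [hr, Polynomial.wronskian, Polynomial.derivative_sub, Polynomial.derivative_C_mul]
      ring
    have hwr0 : p.wronskian r ≠ 0 := by
      rw [hwr]
      exact mul_ne_zero (Polynomial.C_ne_zero.2 hl) hw
    have hr0 : r ≠ 0 := by
      intro h0
      rw [h0] at hwr0
      simp at hwr0
    have hlt : r.natDegree < p.natDegree := by
      rw [Polynomial.natDegree_lt_iff_degree_lt hr0, Polynomial.degree_lt_iff_coeff_zero]
      intro m hm
      rcases hm.eq_or_lt with rfl | hm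
      · simp only [hr, Polynomial.coeff_sub, Polynomial.coeff_C_mul, Polynomial.leadingCoeff, h]
        ring
      · simp only [hr, Polynomial.coeff_sub, Polynomial.coeff_C_mul,
          Polynomial.coeff_eq_zero_of_natDegree_lt hm,
          Polynomial.coeff_eq_zero_of_natDegree_lt (h.trans_lt hm)]
        ring
    have := natDegree_wronskian_of_lt hlt hwr0
    rw [hwr, Polynomial.natDegree_C_mul hl] at this
    rw [h, max_self]
    omega
  · have hw' : q.wronskian p ≠ 0 := by
      rw [← Polynomial.wronskian_neg_eq]
      exact neg_ne_zero.2 hw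
    have := natDegree_wronskian_of_lt h hw'
    rw [← Polynomial.wronskian_neg_eq, Polynomial.natDegree_neg] at this
    rw [max_eq_right h.le]
    omega

theorem lt_natDegree_of_pow_dvd_wronskian {r s : Polynomial ℂ} {c : ℂ} {n : ℕ} (hr : r.eval c = 0)
    (hs : s.eval c ≠ 0) (hr0 : r ≠ 0) (h : (Polynomial.X - Polynomial.C c) ^ n ∣ r.wronskian s) :
    n < r.natDegree := by
  have hle : r.rootMultiplicity c ≤ r.natDegree := by
    rw [← Polynomial.count_roots]
    exact (Multiset.count_le_card _ _).trans (Polynomial.card_roots' r)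
  refine lt_of_lt_of_le ?_ hle
  by_contra! hm
  have hroot : r.IsRoot c := hr
  have hpos : 0 < r.rootMultiplicity c := (Polynomial.rootMultiplicity_pos hr0).2 hroot
  have h1 : (Polynomial.X - Polynomial.C c) ^ r.rootMultiplicity c ∣ r.wronskian s :=
    (pow_dvd_pow _ hm).trans h
  have h2 := Polynomial.pow_rootMultiplicity_dvd r c
  have h3 : (Polynomial.X - Polynomial.C c) ^ r.rootMultiplicity c ∣ r.derivative * s := by
    have h4 : r.derivative * s = r * s.derivative - r.wronskian s := by
      rw [Polynomial.wronskian]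
      ring
    rw [h4]
    exact dvd_sub (h2.mul_right _) h1
  have hcop : IsCoprime ((Polynomial.X - Polynomial.C c) ^ r.rootMultiplicity c) s := by
    refine IsCoprime.pow_left ?_
    rw [(Polynomial.irreducible_X_sub_C c).coprime_iff_not_dvd, Polynomial.dvd_iff_isRoot]
    exact hs
  have h5 := hcop.dvd_of_dvd_mul_right h3
  have hr' : r.derivative ≠ 0 := by
    intro h6
    have h7 := Polynomial.derivative_eq_zero.1 h6
    rw [Polynomial.eq_C_of_natDegree_eq_zero h7] at hr hr0
    simp at hr hr0
    exact hr0 hr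
  have h6 := (Polynomial.le_rootMultiplicity_iff hr').2 h5
  rw [Polynomial.derivative_rootMultiplicity_of_root hroot] at h6
  omega

theorem lt_max_natDegree_of_pow_dvd_wronskian {p q : Polynomial ℂ} {c : ℂ} {n : ℕ}
    (h0 : p.eval c ≠ 0 ∨ q.eval c ≠ 0) (hw : p.wronskian q ≠ 0)
    (h : (Polynomial.X - Polynomial.C c) ^ n ∣ p.wronskian q) :
    n < max p.natDegree q.natDegree := by
  set r := Polynomial.C (q.eval c) * p - Polynomial.C (p.eval c) * q with hr
  have hrc : r.eval c = 0 := by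
    simp [hr]
    ring
  have hrp : r.wronskian p = Polynomial.C (p.eval c) * p.wronskian q := by
    simp only [hr, Polynomial.wronskian, Polynomial.derivative_sub, Polynomial.derivative_C_mul]
    ring
  have hrq : r.wronskian q = Polynomial.C (q.eval c) * p.wronskian q := by
    simp only [hr, Polynomial.wronskian, Polynomial.derivative_sub, Polynomial.derivative_C_mul]
    ring
  have hr0 : r ≠ 0 := by
    intro h1
    rw [h1, Polynomial.wronskian_zero_left] at hrp hrq
    rcases h0 with h0 | h0
    · exact mul_ne_zero (Polynomial.C_ne_zero.2 h0) hw hrp.symm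
    · exact mul_ne_zero (Polynomial.C_ne_zero.2 h0) hw hrq.symm
  have hdeg : r.natDegree ≤ max p.natDegree q.natDegree := by
    refine (Polynomial.natDegree_sub_le _ _).trans (max_le_max ?_ ?_) <;>
    exact Polynomial.natDegree_C_mul_le _ _
  refine lt_of_lt_of_le ?_ hdeg
  rcases h0 with h0 | h0
  · exact lt_natDegree_of_pow_dvd_wronskian hrc h0 hr0 (hrp ▸ h.mul_left _)
  · exact lt_natDegree_of_pow_dvd_wronskian hrc h0 hr0 (hrq ▸ h.mul_left _)

/-- If the Wronskian of two polynomials of larger degree `d` without common zeros is a multiple of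
`(z - c₁)^(θ₁-1) (z - c₂)^(θ₂-1)`, then `θ₁, θ₂` and `θ₃ = 2d + 1 - θ₁ - θ₂` satisfy the triangle
inequalities. -/
theorem degree_inequalities {p q : Polynomial ℂ} {c₁ c₂ k : ℂ} (hk : k ≠ 0) {n₁ n₂ : ℕ}
    (h0 : ∀ z, 0 < ‖p.eval z‖ ^ 2 + ‖q.eval z‖ ^ 2)
    (h : p.wronskian q = Polynomial.C k * ((Polynomial.X - Polynomial.C c₁) ^ n₁ *
      (Polynomial.X - Polynomial.C c₂) ^ n₂)) :
    max p.natDegree q.natDegree ≤ n₁ + n₂ + 1 ∧ n₁ + n₂ + 2 ≤ 2 * max p.natDegree q.natDegree ∧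
      n₁ < max p.natDegree q.natDegree ∧ n₂ < max p.natDegree q.natDegree := by
  have hm : ((Polynomial.X - Polynomial.C c₁) ^ n₁ * (Polynomial.X - Polynomial.C c₂) ^ n₂).Monic :=
    ((Polynomial.monic_X_sub_C c₁).pow n₁).mul ((Polynomial.monic_X_sub_C c₂).pow n₂)
  have hw : p.wronskian q ≠ 0 := by
    rw [h]
    exact mul_ne_zero (Polynomial.C_ne_zero.2 hk) hm.ne_zero
  have hd : (p.wronskian q).natDegree = n₁ + n₂ := by
    rw [h, Polynomial.natDegree_C_mul hk,
      ((Polynomial.monic_X_sub_C c₁).pow n₁).natDegree_mul ((Polynomial.monic_X_sub_C c₂).pow n₂),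
      Polynomial.natDegree_pow, Polynomial.natDegree_pow, Polynomial.natDegree_X_sub_C,
      Polynomial.natDegree_X_sub_C, mul_one, mul_one]
  have h1 : ∀ c, p.eval c ≠ 0 ∨ q.eval c ≠ 0 := by
    intro c
    by_contra! h2
    have := h0 c
    simp [h2.1, h2.2] at this
  have hb := natDegree_wronskian_bounds hw
  rw [hd] at hb
  refine ⟨hb.1, hb.2, lt_max_natDegree_of_pow_dvd_wronskian (h1 c₁) hw ?_,
    lt_max_natDegree_of_pow_dvd_wronskian (h1 c₂) hw ?_⟩
  · rw [h]
    exact (dvd_mul_right _ _).mul_left _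
  · rw [h]
    exact (dvd_mul_left _ _).mul_left _

theorem exists_wirtinger_of_contDiffOn {U : ℂ → ℝ} {Ω : Set ℂ} (hΩ : IsOpen Ω)
    (hU : ContDiffOn ℝ 2 U Ω) : ∃ v b : ℂ → ℂ, ContinuousOn b Ω ∧ ∀ z ∈ Ω,
      HasWirtingerAt (fun x => (U x : ℂ)) (v z) (conj (v z)) z ∧
      HasWirtingerAt v (b z) (((fderiv ℝ (fun y => fderiv ℝ U y 1) z 1 +
        fderiv ℝ (fun y => fderiv ℝ U y Complex.I) z Complex.I) / 4 : ℝ) : ℂ) z := by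
  have hD1 : ContDiffOn ℝ 1 (fderiv ℝ U) Ω := hU.fderiv_of_isOpen hΩ (by norm_num)
  set D : ℂ → ℂ →L[ℝ] ℂ →L[ℝ] ℝ := fderiv ℝ (fderiv ℝ U) with hD
  have hDc : ContinuousOn D Ω := hD1.continuousOn_fderiv_of_isOpen hΩ le_rfl
  have hDd : ∀ z ∈ Ω, HasFDerivAt (fderiv ℝ U) (D z) z := fun z hz =>
    ((hD1.differentiableOn (by norm_num)).differentiableAt (hΩ.mem_nhds hz)).hasFDerivAt
  have hev : ∀ z ∈ Ω, ∀ w, HasFDerivAt (fun y => fderiv ℝ U y w)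
      ((ContinuousLinearMap.apply ℝ ℝ w).comp (D z)) z := fun z hz w =>
    (ContinuousLinearMap.apply ℝ ℝ w).hasFDerivAt.comp z (hDd z hz)
  refine ⟨fun z => ((fderiv ℝ U z 1 : ℂ) - Complex.I * fderiv ℝ U z Complex.I) / 2,
    fun z => ((D z 1 1 : ℂ) - D z Complex.I Complex.I - Complex.I * D z 1 Complex.I -
      Complex.I * D z Complex.I 1) / 4, ?_, fun z hz => ⟨?_, ?_⟩⟩
  · have hc : ∀ w w' : ℂ, ContinuousOn (fun z => (D z w w' : ℂ)) Ω := fun w w' =>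
      Complex.continuous_ofReal.comp_continuousOn
        ((hDc.clm_apply continuousOn_const).clm_apply continuousOn_const)
    exact ((((hc 1 1).sub (hc _ _)).sub (continuousOn_const.mul (hc _ _))).sub
      (continuousOn_const.mul (hc _ _))).div_const 4
  · have h1 : HasFDerivAt U (fderiv ℝ U z) z :=
      ((hU.differentiableOn (by norm_num)).differentiableAt (hΩ.mem_nhds hz)).hasFDerivAt
    have h2 : HasFDerivAt (fun x => (U x : ℂ)) (Complex.ofRealCLM.comp (fderiv ℝ U z)) z :=
      Complex.ofRealCLM.hasFDerivAt.comp z h1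
    refine HasWirtingerAt.of_hasFDerivAt h2 ?_ ?_
    · simp
    · simp [map_ofNat]
  · have hs : D z 1 Complex.I = D z Complex.I 1 :=
      ((hU.contDiffAt (hΩ.mem_nhds hz)).isSymmSndFDerivAt (by simp)).eq 1 Complex.I
    have ho : ∀ w, HasFDerivAt (fun y => (fderiv ℝ U y w : ℂ))
        (Complex.ofRealCLM.comp ((ContinuousLinearMap.apply ℝ ℝ w).comp (D z))) z := fun w =>
      Complex.ofRealCLM.hasFDerivAt.comp z (hev z hz w)
    have h3 := (((ho 1).sub ((ho Complex.I).const_mul Complex.I)).mul_const (2⁻¹ : ℂ))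
    simp only [← div_eq_mul_inv] at h3
    refine HasWirtingerAt.of_hasFDerivAt h3 ?_ ?_
    · simp
      rw [hs]
      linear_combination (-(D z Complex.I Complex.I : ℂ) / 4) * Complex.I_sq
    · rw [(hev z hz 1).fderiv, (hev z hz Complex.I).fderiv]
      simp
      rw [hs]
      linear_combination ((D z Complex.I Complex.I : ℂ) / 4) * Complex.I_sq

/-- The function `|ω| exp(-U / 2)` attached to a solution of `ΔU + 2 exp U = 0`. -/
def liouvilleNorm (ω : ℂ → ℂ) (U : ℂ → ℝ) (z : ℂ) : ℝ := ‖ω z‖ * Real.exp (-(U z / 2))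

theorem isLiouvillePair_of_liouville {U : ℂ → ℝ} {Ω : Set ℂ} (hΩ : IsOpen Ω)
    (hU : ContDiffOn ℝ 2 U Ω)
    (hpde : ∀ z ∈ Ω, fderiv ℝ (fun y => fderiv ℝ U y 1) z 1 +
      fderiv ℝ (fun y => fderiv ℝ U y Complex.I) z Complex.I + 2 * Real.exp (U z) = 0)
    {ω : ℂ → ℂ} (hω : Differentiable ℂ ω) (hω0 : ∀ z ∈ Ω, ω z ≠ 0) :
    IsLiouvillePair Ω (liouvilleNorm ω U) (fun z => ω z / 2) := by
  obtain ⟨v, b, hb, hv⟩ := exists_wirtinger_of_contDiffOn hΩ hU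
  set h := liouvilleNorm ω U with hh
  set m : ℂ → ℂ := fun z => 2⁻¹ * (deriv ω z / ω z - v z) with hm
  set bm : ℂ → ℂ := fun z => 2⁻¹ * ((deriv (deriv ω) z * ω z - deriv ω z * deriv ω z) / ω z ^ 2 - b z)
    with hbm
  have hm' : ∀ z ∈ Ω, HasWirtingerAt m (bm z) ((Real.exp (U z) / 4 : ℝ) : ℂ) z := by
    intro z hz
    have h1 := (hω.deriv z).hasDerivAt.div (hω z).hasDerivAt (hω0 z hz)
    have h2 := (HasWirtingerAt.const (2⁻¹ : ℂ)).mul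
      ((HasWirtingerAt.of_hasDerivAt h1).sub (hv z hz).2)
    refine h2.congr_deriv (by simp [hbm]) ?_
    have := hpde z hz
    have h3 : (fderiv ℝ (fun y => fderiv ℝ U y 1) z 1 +
      fderiv ℝ (fun y => fderiv ℝ U y Complex.I) z Complex.I) / 4 = - Real.exp (U z) / 2 := by
      linarith
    rw [h3]
    push_cast
    ring
  have hh' : ∀ z ∈ Ω, HasWirtingerAt (fun x => (h x : ℂ)) (h z * m z) (h z * conj (m z)) z := by
    intro z hz
    have h1 := hasWirtingerAt_log_norm_sq hω (differentiable_const (0 : ℂ)) (z := z) (by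
      have := norm_pos_iff.2 (hω0 z hz)
      positivity)
    have h2 := (HasWirtingerAt.const (2⁻¹ : ℂ)).mul (h1.sub (hv z hz).1)
    have h3 := HasWirtingerAt.hasDerivAt_comp (Complex.hasDerivAt_exp _) h2
    have hcz : conj (ω z) ≠ 0 := by
      rw [Ne, map_eq_zero]
      exact hω0 z hz
    have hl : logNormDeriv ω (fun _ => 0) z = deriv ω z / ω z := by
      simp only [logNormDeriv, map_zero, mul_zero, add_zero]
      rw [mul_div_mul_right _ _ hcz]
    have he : ∀ x ∈ Ω, (h x : ℂ) = Complex.exp (2⁻¹ *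
        (((Real.log (‖ω x‖ ^ 2 + ‖(0 : ℂ)‖ ^ 2) : ℝ) : ℂ) - (U x : ℂ))) := by
      intro x hx
      have hp := norm_pos_iff.2 (hω0 x hx)
      have : h x = Real.exp (2⁻¹ * (Real.log (‖ω x‖ ^ 2 + ‖(0 : ℂ)‖ ^ 2) - U x)) := by
        rw [norm_zero, zero_pow two_ne_zero, add_zero, Real.log_pow, mul_sub, sub_eq_add_neg,
          Real.exp_add, Nat.cast_ofNat, inv_mul_cancel_left₀ two_ne_zero, Real.exp_log hp, hh,
          liouvilleNorm]
        congr 3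
        ring
      rw [this]
      push_cast
      rfl
    have h4 : HasWirtingerAt (fun x => (h x : ℂ)) _ _ z := h3.congr_of_eventuallyEq
      (by filter_upwards [hΩ.mem_nhds hz] with x hx using he x hx)
    refine h4.congr_deriv ?_ ?_
    · rw [← he z hz, hl]
      simp [hm]
    · rw [← he z hz, hl]
      simp [hm, map_ofNat]
  refine ⟨fun z hz => mul_pos (norm_pos_iff.2 (hω0 z hz)) (Real.exp_pos _),
    (hω.div_const 2).differentiableOn, fun z hz => div_ne_zero (hω0 z hz) two_ne_zero,
    fun z => h z * m z, fun z => h z * m z * m z + h z * bm z,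
    fun z => h z * conj (m z) * m z + h z * ((Real.exp (U z) / 4 : ℝ) : ℂ), ?_, fun z hz =>
    ⟨(hh' z hz).congr_deriv rfl (by simp), (hh' z hz).mul (hm' z hz), ?_⟩⟩
  · have c1 : ContinuousOn (fun z => (h z : ℂ)) Ω := fun z hz =>
      (hh' z hz).continuousAt.continuousWithinAt
    have c2 : ContinuousOn m Ω := fun z hz => (hm' z hz).continuousAt.continuousWithinAt
    have d0 := hω.continuous
    have d1 := hω.deriv.continuous
    have d2 := hω.deriv.deriv.continuous
    have c3 : ContinuousOn bm Ω := continuousOn_const.mul ((ContinuousOn.div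
      (by fun_prop) (by fun_prop) fun z hz => pow_ne_zero 2 (hω0 z hz)).sub hb)
    exact ((c1.mul c2).mul c2).add (c1.mul c3)
  · have h5 : (h z * h z) * (Real.exp (U z) / 4) = ‖ω z‖ ^ 2 / 4 := by
      have : Real.exp (-(U z / 2)) * Real.exp (-(U z / 2)) * Real.exp (U z) = 1 := by
        rw [← Real.exp_add, ← Real.exp_add, ← Real.exp_zero]
        congr 1
        ring
      rw [hh, liouvilleNorm]
      linear_combination (‖ω z‖ ^ 2 / 4) * this
    have h6 : (h z : ℂ) * h z * ((Real.exp (U z) / 4 : ℝ) : ℂ) = ω z * conj (ω z) / 4 := by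
      rw [Complex.mul_conj']
      exact_mod_cast congrArg Complex.ofReal h5
    simp only [map_mul, map_div₀, Complex.conj_ofReal, map_ofNat]
    linear_combination h6

/-- Two-sided bounds for `|ω| exp(-U / 2)` near a zero of `ω` matching the singularity of `U`. -/
theorem exists_liouvilleNorm_bounds {U : ℂ → ℝ} {c c' : ℂ} (hc : c ≠ c') (n n' : ℕ)
    (hs : ∃ ε > (0 : ℝ), ∃ M : ℝ, ∀ z, z ≠ c → dist z c < ε →
      |U z - 2 * n * Real.log ‖z - c‖| ≤ M) :
    ∃ ε > (0 : ℝ), ∃ m > (0 : ℝ), ∃ M : ℝ, ∀ z, z ≠ c → z ∈ ball c ε →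
      m ≤ liouvilleNorm (fun z => (z - c) ^ n * (z - c') ^ n') U z ∧
        liouvilleNorm (fun z => (z - c) ^ n * (z - c') ^ n') U z ≤ M := by
  obtain ⟨ε, hε, M, hM⟩ := hs
  have hD : 0 < ‖c - c'‖ := norm_pos_iff.2 (sub_ne_zero.2 hc)
  set D := ‖c - c'‖ with hDdef
  refine ⟨min ε (D / 2), lt_min hε (by linarith), Real.exp (-(M / 2)) * (D / 2) ^ n', by positivity,
    Real.exp (M / 2) * (2 * D) ^ n', fun z hz hzb => ?_⟩
  have h1 : dist z c < ε := lt_of_lt_of_le hzb (min_le_left _ _)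
  have h2 : ‖z - c‖ < D / 2 := by
    rw [← dist_eq_norm]
    exact lt_of_lt_of_le hzb (min_le_right _ _)
  have h0 : 0 < ‖z - c‖ := norm_pos_iff.2 (sub_ne_zero.2 hz)
  have h3 : D / 2 ≤ ‖z - c'‖ := by
    have := norm_sub_le (z - c') (z - c)
    rw [show z - c' - (z - c) = c - c' by ring] at this
    linarith
  have h4 : ‖z - c'‖ ≤ 2 * D := by
    have := norm_add_le (z - c) (c - c')
    rw [show z - c + (c - c') = z - c' by ring] at this
    linarith
  have h5 := abs_le.1 (hM z hz h1)
  have h6 : liouvilleNorm (fun z => (z - c) ^ n * (z - c') ^ n') U z =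
      Real.exp (n * Real.log ‖z - c‖ - U z / 2) * ‖z - c'‖ ^ n' := by
    rw [liouvilleNorm, norm_mul, norm_pow, norm_pow, sub_eq_add_neg (_ * _),
      Real.exp_add,
      Real.exp_nat_mul, Real.exp_log h0]
    ring
  rw [h6]
  constructor
  · have : Real.exp (-(M / 2)) ≤ Real.exp (n * Real.log ‖z - c‖ - U z / 2) :=
      Real.exp_le_exp.2 (by linarith [h5.2])
    have hh : (D / 2) ^ n' ≤ ‖z - c'‖ ^ n' := pow_le_pow_left₀ (by linarith) h3 n'
    gcongr
  · have : Real.exp (n * Real.log ‖z - c‖ - U z / 2) ≤ Real.exp (M / 2) :=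
      Real.exp_le_exp.2 (by linarith [h5.1])
    gcongr

theorem liouville_mass {c₁ c₂ : ℂ} (hc : c₁ ≠ c₂) (n₁ n₂ : ℕ) {U : ℂ → ℝ}
    (hU : ContDiffOn ℝ 2 U ({c₁, c₂}ᶜ))
    (hpde : ∀ z ∈ ({c₁, c₂}ᶜ : Set ℂ), fderiv ℝ (fun y => fderiv ℝ U y 1) z 1 +
      fderiv ℝ (fun y => fderiv ℝ U y Complex.I) z Complex.I + 2 * Real.exp (U z) = 0)
    (hs₁ : ∃ ε > (0 : ℝ), ∃ M : ℝ, ∀ z, z ≠ c₁ → dist z c₁ < ε →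
      |U z - 2 * n₁ * Real.log ‖z - c₁‖| ≤ M)
    (hs₂ : ∃ ε > (0 : ℝ), ∃ M : ℝ, ∀ z, z ≠ c₂ → dist z c₂ < ε →
      |U z - 2 * n₂ * Real.log ‖z - c₂‖| ≤ M)
    (hint : Integrable fun z => Real.exp (U z)) :
    ∃ d : ℕ, d ≤ n₁ + n₂ + 1 ∧ n₁ + n₂ + 2 ≤ 2 * d ∧ n₁ < d ∧ n₂ < d ∧
      ∫ z, Real.exp (U z) = 4 * π * d := by
  set ω : ℂ → ℂ := fun z => (z - c₁) ^ n₁ * (z - c₂) ^ n₂ with hω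
  have hω' : ω = fun z => (z - c₂) ^ n₂ * (z - c₁) ^ n₁ := funext fun z => mul_comm _ _
  have hωd : Differentiable ℂ ω := by fun_prop
  have hω0 : ∀ z ∈ ({c₁, c₂}ᶜ : Set ℂ), ω z ≠ 0 := fun z hz =>
    mul_ne_zero (pow_ne_zero _ (sub_ne_zero.2 (mem_compl_pair.1 hz).1))
      (pow_ne_zero _ (sub_ne_zero.2 (mem_compl_pair.1 hz).2))
  have H := isLiouvillePair_of_liouville (isOpen_compl_pair c₁ c₂) hU hpde hωd hω0
  obtain ⟨ε₁, hε₁, m₁, hm₁, M₁, hb₁⟩ := exists_liouvilleNorm_bounds hc n₁ n₂ hs₁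
  obtain ⟨ε₂, hε₂, m₂, hm₂, M₂, hb₂⟩ := exists_liouvilleNorm_bounds hc.symm n₂ n₁ hs₂
  rw [← hω] at hb₁
  rw [← hω'] at hb₂
  obtain ⟨P, Q, hP, hQ, h0, hh, κ, hκ, hw⟩ := H.exists_entire_rep (ε := min ε₁ ε₂)
    (c := min m₁ m₂) (M := max M₁ M₂) hc (lt_min hε₁ hε₂) (lt_min hm₁ hm₂)
    fun z hz₁ hz₂ hz => by
      rcases hz with hz | hz
      · have := hb₁ z hz₁ (ball_subset_ball (min_le_left _ _) hz)
        exact ⟨(min_le_left _ _).trans this.1, this.2.trans (le_max_left _ _)⟩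
      · have := hb₂ z hz₂ (ball_subset_ball (min_le_right _ _) hz)
        exact ⟨(min_le_right _ _).trans this.1, this.2.trans (le_max_right _ _)⟩
  have hg : ∀ z ∈ ({c₁, c₂}ᶜ : Set ℂ), sphericalDensity P Q z = Real.exp (U z) / 4 := by
    intro z hz
    obtain ⟨hz₁, hz₂⟩ := mem_compl_pair.1 hz
    have hn := norm_pos_iff.2 (hω0 z hz)
    rw [sphericalDensity, ← hh z hz₁ hz₂, hw z hz₁ hz₂, liouvilleNorm, norm_mul, hκ, norm_div,
      Complex.norm_ofNat, one_mul, mul_pow, ← Real.exp_nat_mul, Nat.cast_ofNat,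
      show 2 * -(U z / 2) = -U z by ring, Real.exp_neg]
    field_simp
    norm_num
  have hae : (fun z => sphericalDensity P Q z) =ᵐ[volume] fun z => Real.exp (U z) / 4 := by
    have : ({c₁, c₂}ᶜ : Set ℂ) ∈ ae (volume : Measure ℂ) :=
      compl_mem_ae_iff.2 ((Set.toFinite _).measure_zero _)
    filter_upwards [this] with z hz using hg z hz
  have hgi : Integrable (sphericalDensity P Q) := (hint.div_const 4).congr hae.symm
  have hlow : ∀ z, ‖c₁‖ + ‖c₂‖ + 1 ≤ ‖z‖ → 2⁻¹ ≤ ‖wronskian P Q z‖ := by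
    intro z hz
    have e₁ : 1 ≤ ‖z - c₁‖ := by linarith [norm_sub_norm_le z c₁, norm_nonneg c₂]
    have e₂ : 1 ≤ ‖z - c₂‖ := by linarith [norm_sub_norm_le z c₂, norm_nonneg c₁]
    have hne : ∀ c, 1 ≤ ‖z - c‖ → z ≠ c := by
      rintro c hc rfl
      norm_num at hc
    rw [hw z (hne _ e₁) (hne _ e₂), norm_mul, hκ, one_mul, norm_div, Complex.norm_ofNat, norm_mul,
      norm_pow, norm_pow]
    have := one_le_mul_of_one_le_of_one_le (one_le_pow₀ e₁ (n := n₁)) (one_le_pow₀ e₂ (n := n₂))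
    linarith
  obtain ⟨p, q, hp, hq⟩ := exists_polynomials hP hQ h0 hgi (by norm_num) hlow
  obtain rfl : P = fun x => p.eval x := funext hp
  obtain rfl : Q = fun x => q.eval x := funext hq
  have hκ0 : κ / 2 ≠ 0 := div_ne_zero (norm_pos_iff.1 (by rw [hκ]; norm_num)) two_ne_zero
  have hpoly : p.wronskian q = Polynomial.C (κ / 2) * ((Polynomial.X - Polynomial.C c₁) ^ n₁ *
      (Polynomial.X - Polynomial.C c₂) ^ n₂) := by
    refine Polynomial.eq_of_infinite_eval_eq _ _
      ((Set.toFinite ({c₁, c₂} : Set ℂ)).infinite_compl.mono fun z hz => ?_)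
    obtain ⟨hz₁, hz₂⟩ := mem_compl_pair.1 hz
    have := hw z hz₁ hz₂
    simp only [wronskian, Polynomial.deriv] at this
    simp only [Set.mem_ofPred_eq, Polynomial.wronskian, Polynomial.eval_sub, Polynomial.eval_mul,
      Polynomial.eval_C, Polynomial.eval_pow, Polynomial.eval_X, this, hω]
    ring
  obtain ⟨d₁, d₂, d₃, d₄⟩ := degree_inequalities hκ0 h0 hpoly
  refine ⟨_, d₁, d₂, d₃, d₄, ?_⟩
  have h1 := integral_sphericalDensity h0 hgi
  rw [integral_congr_ae hae, integral_div] at h1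
  linarith

/-- Second derivatives of a function on `ℝ²` read in the complex coordinate. -/
theorem lap_orthonormalBasisOneI (u : E2 → ℝ) (z : ℂ) :
    fderiv ℝ (fun y => fderiv ℝ (fun x => u (Complex.orthonormalBasisOneI.repr x)) y 1) z 1 +
      fderiv ℝ (fun y => fderiv ℝ (fun x => u (Complex.orthonormalBasisOneI.repr x)) y Complex.I) z
        Complex.I = lap u (Complex.orthonormalBasisOneI.repr z) := by
  set ι := Complex.orthonormalBasisOneI.repr with hι
  have key : ∀ (f : E2 → ℝ) (x w : ℂ), fderiv ℝ (fun x => f (ι x)) x w =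
      fderiv ℝ f (ι x) (ι w) := fun f x w => by
    have := ι.toContinuousLinearEquiv.comp_right_fderiv (f := f) (x := x)
    exact congrArg (fun L : ℂ →L[ℝ] ℝ => L w) this
  have e0 : ι 1 = EuclideanSpace.single 0 1 := by
    rw [← OrthonormalBasis.repr_self Complex.orthonormalBasisOneI 0]
    simp [hι]
  have e1 : ι Complex.I = EuclideanSpace.single 1 1 := by
    rw [← OrthonormalBasis.repr_self Complex.orthonormalBasisOneI 1]
    simp [hι]
  simp only [key u]
  rw [key (fun y => fderiv ℝ u y (ι 1)), key (fun y => fderiv ℝ u y (ι Complex.I)), lap,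
    Fin.sum_univ_two, e0, e1]

/-- Theorem B-1 (after Eremenko): for a solution of
`Δu + 2eᵘ = 4π(θ₁−1)δ_{p₁} + 4π(θ₂−1)δ_{p₂}` with `θ₁, θ₂` positive integers and finite
energy, the total mass is `θ₁ + θ₂ + θ₃ − 1` for some positive integer `θ₃` with
`θ₁ + θ₂ + θ₃` odd and the triangle inequalities `θᵢ + θⱼ > θₖ`. -/
theorem eremenko_two_integer_singularities
    (p₁ p₂ : E2) (hp : p₁ ≠ p₂) (θ₁ θ₂ : ℕ) (hθ₁ : 0 < θ₁) (hθ₂ : 0 < θ₂)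
    (u : E2 → ℝ)
    (hreg : ContDiffOn ℝ 2 u ({p₁, p₂}ᶜ))
    (hpde : ∀ x : E2, x ≠ p₁ → x ≠ p₂ → lap u x + 2 * exp (u x) = 0)
    (hsing1 : ∃ ε > (0:ℝ), ∃ M : ℝ, ∀ x : E2, x ≠ p₁ → dist x p₁ < ε →
      |u x - 2 * ((θ₁ : ℝ) - 1) * Real.log ‖x - p₁‖| ≤ M)
    (hsing2 : ∃ ε > (0:ℝ), ∃ M : ℝ, ∀ x : E2, x ≠ p₂ → dist x p₂ < ε →
      |u x - 2 * ((θ₂ : ℝ) - 1) * Real.log ‖x - p₂‖| ≤ M)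
    (hint : Integrable (fun x : E2 => exp (u x))) :
    ∃ θ₃ : ℕ, 0 < θ₃ ∧ Odd (θ₁ + θ₂ + θ₃) ∧
      θ₁ + θ₂ > θ₃ ∧ θ₂ + θ₃ > θ₁ ∧ θ₁ + θ₃ > θ₂ ∧
      (1 / (2 * π)) * (∫ x : E2, exp (u x)) = (θ₁ : ℝ) + (θ₂ : ℝ) + (θ₃ : ℝ) - 1 := by
  set ι := Complex.orthonormalBasisOneI.repr with hι
  obtain ⟨n₁, rfl⟩ := Nat.exists_eq_succ_of_ne_zero hθ₁.ne'
  obtain ⟨n₂, rfl⟩ := Nat.exists_eq_succ_of_ne_zero hθ₂.ne'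
  have hne : ∀ {z : ℂ} {p : E2}, z ≠ ι.symm p → ι z ≠ p := fun h h' =>
    h (by rw [← h', LinearIsometryEquiv.symm_apply_apply])
  have hsing : ∀ {n : ℕ} {p : E2}, (∃ ε > (0 : ℝ), ∃ M : ℝ, ∀ x : E2, x ≠ p → dist x p < ε →
      |u x - 2 * (((n.succ : ℕ) : ℝ) - 1) * Real.log ‖x - p‖| ≤ M) →
      ∃ ε > (0 : ℝ), ∃ M : ℝ, ∀ z : ℂ, z ≠ ι.symm p → dist z (ι.symm p) < ε →
        |u (ι z) - 2 * n * Real.log ‖z - ι.symm p‖| ≤ M := by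
    rintro n p ⟨ε, hε, M, hM⟩
    refine ⟨ε, hε, M, fun z hz hd => ?_⟩
    have h1 : ‖ι z - p‖ = ‖z - ι.symm p‖ := by
      rw [← ι.norm_map (z - ι.symm p), map_sub, LinearIsometryEquiv.apply_symm_apply]
    have h2 := hM (ι z) (hne hz) (by rwa [dist_eq_norm, h1, ← dist_eq_norm])
    rwa [h1, Nat.cast_succ, add_sub_cancel_right] at h2
  have hmp := ι.measurePreserving
  have hme : MeasurableEmbedding ι := ι.toHomeomorph.measurableEmbedding
  obtain ⟨d, d₁, d₂, d₃, d₄, hd⟩ := liouville_mass (U := fun z => u (ι z))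
    (fun h => hp (ι.symm.injective h)) n₁ n₂
    (hreg.comp ι.contDiff.contDiffOn fun z hz => by
      obtain ⟨hz₁, hz₂⟩ := mem_compl_pair.1 hz
      simpa using ⟨hne hz₁, hne hz₂⟩)
    (fun z hz => by
      obtain ⟨hz₁, hz₂⟩ := mem_compl_pair.1 hz
      rw [lap_orthonormalBasisOneI]
      exact hpde _ (hne hz₁) (hne hz₂))
    (hsing hsing1) (hsing hsing2) ((hmp.integrable_comp_emb hme).2 hint)
  rw [hmp.integral_comp hme (fun x => exp (u x))] at hd
  refine ⟨2 * d - n₁ - n₂ - 1, by omega, ⟨d, by omega⟩, by omega, by omega, by omega, ?_⟩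
  rw [hd, Nat.sub_sub, Nat.sub_sub, Nat.cast_sub (by omega)]
  push_cast
  field_simp
  ring
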